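/- arXiv:2303.00570 — 3 statements merged into one kernel-verified Lean document; each statement's English description precedes it below -/
import Mathlib

section
/- Let d ≥ 1 be an integer and β > d. Let V ∈ C²(ℝ^d) be positive and convex with ∇²V(x) invertible for every x ∈ ℝ^d, and assume Z_β := ∫_{ℝ^d} V(x)^{-β} dx < ∞. Then for every smooth function g on ℝ^d that is square-integrable with respect to π_β, writing G := V·g, one has (β+1)·Var_{π_β}(g) ≤ ∫_{ℝ^d} (⟨(∇²V)^{-1}(x) ∇G(x), ∇G(x)⟩ / V(x)) π_β(x) dx + (d/(β−d)) (∫_{ℝ^d} g dπ_β)². -/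
open MeasureTheory Real Matrix

/-- The Hessian matrix of `f : ℝ^d → ℝ` at `x`, with entries the second
iterated derivatives in coordinate directions. -/
noncomputable def hessianMatrix {d : ℕ} (f : EuclideanSpace ℝ (Fin d) → ℝ)
    (x : EuclideanSpace ℝ (Fin d)) : Matrix (Fin d) (Fin d) ℝ :=
  Matrix.of fun i j =>
    iteratedFDeriv ℝ 2 f x ![EuclideanSpace.single i 1, EuclideanSpace.single j 1]


/-- partial derivative along coordinate `i`. -/
def HasPD {n : ℕ} (i : Fin n) (f f' : (Fin n → ℝ) → ℝ) : Prop :=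
  ∀ x, HasDerivAt (fun s => f (Function.update x i s)) (f' x) (x i)

/-- the cube. -/
def cube (n : ℕ) (R : ℝ) : Set (Fin n → ℝ) := Set.Icc (fun _ => -R) (fun _ => R)

lemma HasPD.mul {n : ℕ} {i : Fin n} {f f' g g' : (Fin n → ℝ) → ℝ}
    (hf : HasPD i f f') (hg : HasPD i g g') :
    HasPD i (fun x => f x * g x) (fun x => f' x * g x + f x * g' x) := by
  intro x
  have := (hf x).fun_mul (hg x)
  simpa only [Function.update_eq_self] using this

lemma HasPD.of_indep {n : ℕ} {i : Fin n} {f : (Fin n → ℝ) → ℝ}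
    (hf : ∀ x t, f (Function.update x i t) = f x) : HasPD i f (fun _ => 0) := by
  intro x
  simp only [hf]
  exact hasDerivAt_const _ _

lemma HasPD.congr' {n : ℕ} {i : Fin n} {f f' g' : (Fin n → ℝ) → ℝ}
    (hf : HasPD i f f') (h : ∀ x, f' x = g' x) : HasPD i f g' := by
  intro x; rw [← h]; exact hf x

lemma HasPD.indep {n : ℕ} {i j : Fin n} (hij : i ≠ j) {f f' : (Fin n → ℝ) → ℝ}
    (hf : HasPD i f f') (h : ∀ x t, f (Function.update x j t) = f x) :
    ∀ x t, f' (Function.update x j t) = f' x := by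
  intro x t
  have h1 := hf (Function.update x j t)
  simp only [Function.update_of_ne hij] at h1
  have h2 : (fun s => f (Function.update (Function.update x j t) i s)) =
      (fun s => f (Function.update x i s)) := by
    funext s
    rw [Function.update_comm hij.symm, h]
  rw [h2] at h1
  exact h1.unique (hf x)

lemma isCompact_cube (n : ℕ) (R : ℝ) : IsCompact (cube n R) := isCompact_Icc

lemma integrableOn_cube {n : ℕ} {R : ℝ} {f : (Fin n → ℝ) → ℝ} (hf : Continuous f) :
    IntegrableOn f (cube n R) :=
  hf.continuousOn.integrableOn_compact (isCompact_cube n R)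

lemma cube_fubini {n : ℕ} {R : ℝ} (hR : 0 ≤ R) (i : Fin (n + 1)) {f : (Fin (n + 1) → ℝ) → ℝ}
    (hf : Continuous f) :
    ∫ x in cube (n + 1) R, f x =
      ∫ y in cube n R, ∫ t in (-R)..R, f (i.insertNth t y) := by
  have hmp := (volume_preserving_piFinSuccAbove (fun _ : Fin (n + 1) => ℝ) i).symm
  have hpre : (MeasurableEquiv.piFinSuccAbove (fun _ : Fin (n + 1) => ℝ) i).symm ⁻¹' (cube (n + 1) R)
      = (Set.Icc (-R) R) ×ˢ (cube n R) := by
    ext p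
    simp only [Set.mem_preimage, cube, Set.mem_prod]
    exact Fin.insertNth_mem_Icc
  have hcont : Continuous (fun p : ℝ × (Fin n → ℝ) =>
      f ((MeasurableEquiv.piFinSuccAbove (fun _ : Fin (n + 1) => ℝ) i).symm p)) := by
    refine hf.comp ?_
    exact Continuous.finInsertNth (A := fun _ : Fin (n + 1) => ℝ) i continuous_fst continuous_snd
  rw [← hmp.setIntegral_preimage_emb (MeasurableEquiv.measurableEmbedding _) f, hpre,
    Measure.volume_eq_prod, ← setIntegral_prod_swap, setIntegral_prod]
  · refine setIntegral_congr_fun measurableSet_Icc fun y _ => ?_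
    simp only [Prod.swap]
    rw [intervalIntegral.integral_of_le (by linarith), integral_Icc_eq_integral_Ioc]
    rfl
  · rw [← Measure.volume_eq_prod]
    refine ContinuousOn.integrableOn_compact ((isCompact_cube n R).prod isCompact_Icc) ?_
    exact (hcont.comp continuous_swap).continuousOn

lemma cube_ibp {n : ℕ} {R : ℝ} (hR : 0 ≤ R) (i : Fin n) {f f' : (Fin n → ℝ) → ℝ}
    (hf' : Continuous f') (h : HasPD i f f')
    (h0 : ∀ x, x i = -R → f x = 0) (h1 : ∀ x, x i = R → f x = 0) :
    ∫ x in cube n R, f' x = 0 := by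
  cases n with
  | zero => exact i.elim0
  | succ n =>
    rw [cube_fubini hR i hf']
    have : ∀ y : Fin n → ℝ, ∫ t in (-R)..R, f' (i.insertNth t y) = 0 := by
      intro y
      have hd : ∀ t ∈ Set.uIcc (-R) R, HasDerivAt (fun t => f (i.insertNth (α := fun _ => ℝ) t y))
          (f' (i.insertNth t y)) t := by
        intro t _
        have := h (i.insertNth t y)
        simpa [Fin.update_insertNth] using this
      rw [intervalIntegral.integral_eq_sub_of_hasDerivAt hd]
      · rw [h1 (i.insertNth R y) (by simp), h0 (i.insertNth (-R) y) (by simp), sub_zero]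
      · exact (hf'.comp (Continuous.finInsertNth i continuous_id continuous_const)).intervalIntegrable _ _
    simp [this]

/-- differentiation under the integral over coordinate 0. -/
lemma hasPD_integral {n : ℕ} {R : ℝ} (i : Fin n) {w dw : (Fin (n + 1) → ℝ) → ℝ}
    (hw : Continuous w) (hdw : Continuous dw) (h : HasPD i.succ w dw) :
    HasPD i (fun y => ∫ t in (-R)..R, w (Fin.cons t y)) (fun y => ∫ t in (-R)..R, dw (Fin.cons t y)) := by
  intro y
  have hc : Continuous (fun p : ℝ × ℝ => dw (Fin.cons p.2 (Function.update y i p.1))) := by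
    fun_prop
  obtain ⟨C, hC⟩ := ((isCompact_Icc (a := y i - 1) (b := y i + 1)).prod
    (isCompact_uIcc (a := -R) (b := R))).exists_bound_of_continuousOn hc.continuousOn
  have := (intervalIntegral.hasDerivAt_integral_of_dominated_loc_of_deriv_le (μ := volume)
    (F := fun s t => w (Fin.cons t (Function.update y i s)))
    (F' := fun s t => dw (Fin.cons t (Function.update y i s))) (x₀ := y i)
    (s := Set.Icc (y i - 1) (y i + 1)) (a := -R) (b := R) (bound := fun _ => C)
    (Icc_mem_nhds (by linarith) (by linarith)) ?_ ?_ ?_ ?_ ?_ ?_).2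
  · simpa using this
  · refine Filter.Eventually.of_forall fun s => Continuous.aestronglyMeasurable ?_
    fun_prop
  · refine Continuous.intervalIntegrable ?_ _ _
    fun_prop
  · refine Continuous.aestronglyMeasurable ?_
    fun_prop
  · refine Filter.Eventually.of_forall fun t ht s hs => hC (s, t) ⟨hs, Set.uIoc_subset_uIcc ht⟩
  · exact intervalIntegrable_const
  · refine Filter.Eventually.of_forall fun t ht s hs => ?_
    have := h (Fin.cons t (Function.update y i s))
    simpa [← Fin.cons_update] using this

/-- The infinitesimal Knothe (triangular) field solving `div (w S) = q` on the cube. -/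
lemma exists_field {R : ℝ} (hR : 0 < R) : ∀ (n : ℕ) (w q : (Fin n → ℝ) → ℝ)
    (dw : Fin n → (Fin n → ℝ) → ℝ), Continuous w → (∀ x, 0 < w x) → Continuous q →
    (∀ i, Continuous (dw i)) → (∀ i, HasPD i w (dw i)) → ∫ x in cube n R, q x = 0 →
    ∃ S dS : Fin n → (Fin n → ℝ) → ℝ, (∀ i, Continuous (S i)) ∧ (∀ i, Continuous (dS i)) ∧
      (∀ i, HasPD i (S i) (dS i)) ∧ (∀ i x, x i = -R → S i x = 0) ∧
      (∀ i x, x i = R → S i x = 0) ∧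
      (∀ i j, j < i → ∀ x t, S i (Function.update x j t) = S i x) ∧
      ∀ x, ∑ i, (dw i x * S i x + w x * dS i x) = q x := by
  intro n
  induction n with
  | zero =>
    intro w q dw _ _ _ _ _ hq
    refine ⟨fun i => i.elim0, fun i => i.elim0, fun i => i.elim0, fun i => i.elim0,
      fun i => i.elim0, fun i => i.elim0, fun i => i.elim0, fun i => i.elim0, fun x => ?_⟩
    have hc : cube 0 R = Set.univ := by
      ext y; simp [cube, Subsingleton.elim y 0]
    rw [hc, Measure.restrict_univ, volume_pi, Measure.pi_of_empty (x := x), integral_dirac] at hq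
    simp [hq]
  | succ n ih =>
    intro w q dw hw hwp hq hdw hwd hq0
    have hcons : ∀ f : (Fin (n + 1) → ℝ) → ℝ, Continuous f →
        Continuous (fun y : Fin n → ℝ => ∫ t in (-R)..R, f (Fin.cons t y)) := by
      intro f hf
      apply intervalIntegral.continuous_parametric_intervalIntegral_of_continuous'
      exact hf.comp (by fun_prop)
    have hii : ∀ f : (Fin (n + 1) → ℝ) → ℝ, Continuous f → ∀ y : Fin n → ℝ, ∀ a b : ℝ,
        IntervalIntegrable (fun t => f (Fin.cons t y)) volume a b := by
      intro f hf y a b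
      exact (hf.comp (by fun_prop)).intervalIntegrable a b
    obtain ⟨S', dS', hS', hdS', hSd', hS0', hS1', htri', heq'⟩ := ih
      (fun y => ∫ t in (-R)..R, w (Fin.cons t y)) (fun y => ∫ t in (-R)..R, q (Fin.cons t y))
      (fun i y => ∫ t in (-R)..R, dw i.succ (Fin.cons t y)) (hcons w hw)
      (fun y => intervalIntegral.intervalIntegral_pos_of_pos (hii w hw y _ _) (fun t => hwp _)
        (by linarith)) (hcons q hq)
      (fun i => hcons _ (hdw _)) (fun i => hasPD_integral i hw (hdw _) (hwd _))
      (by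
        rw [cube_fubini hR.le 0 hq] at hq0
        simpa [Fin.insertNth_zero] using hq0)
    set r : (Fin (n + 1) → ℝ) → ℝ := fun x => q x -
      ∑ i : Fin n, (dw i.succ x * S' i (Fin.tail x) + w x * dS' i (Fin.tail x)) with hr
    have htail : Continuous (fun x : Fin (n + 1) → ℝ => Fin.tail x) := by
      unfold Fin.tail; fun_prop
    have hrc : Continuous r := by
      refine hq.sub (continuous_finsetSum _ fun i _ => ?_)
      exact ((hdw _).mul ((hS' i).comp htail)).add (hw.mul ((hdS' i).comp htail))
    set P : (Fin (n + 1) → ℝ) → ℝ := fun x => ∫ s in (-R)..(x 0), r (Fin.cons s (Fin.tail x)) with hP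
    have hPc : Continuous P := by
      apply intervalIntegral.continuous_parametric_intervalIntegral_of_continuous
      · refine hrc.comp ?_
        exact Continuous.finCons (A := fun _ => ℝ) continuous_snd (htail.comp continuous_fst)
      · fun_prop
    have hupd0 : ∀ (x : Fin (n + 1) → ℝ) s, Fin.tail (Function.update x 0 s) = Fin.tail x := by
      intro x s; exact Fin.tail_update_zero x s
    have hPd : HasPD 0 P r := by
      intro x
      simp only [hP, hupd0, Function.update_self]
      have hc : Continuous (fun s => r (Fin.cons (α := fun _ => ℝ) s (Fin.tail x))) :=
        hrc.comp (by fun_prop)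
      have := intervalIntegral.integral_hasDerivAt_right (hc.intervalIntegrable (-R) (x 0))
        (hc.stronglyMeasurableAtFilter _ _) hc.continuousAt
      simpa only [Fin.cons_self_tail] using this
    have hP0 : ∀ x, x 0 = -R → P x = 0 := by
      intro x hx; simp [hP, hx]
    have hP1 : ∀ x, x 0 = R → P x = 0 := by
      intro x hx
      simp only [hP, hx, hr, Fin.tail_cons]
      rw [intervalIntegral.integral_sub (hii q hq _ _ _), intervalIntegral.integral_finsetSum,
        sub_eq_zero, ← heq']
      · refine Finset.sum_congr rfl fun i _ => ?_
        rw [intervalIntegral.integral_add, intervalIntegral.integral_mul_const,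
          intervalIntegral.integral_mul_const]
        · exact (hii _ (hdw _) _ _ _).mul_const _
        · exact (hii _ hw _ _ _).mul_const _
      · intro i _
        exact ((hii _ (hdw _) _ _ _).mul_const _).add ((hii _ hw _ _ _).mul_const _)
      · have := hii (fun x => ∑ i : Fin n, (dw i.succ x * S' i (Fin.tail x) + w x * dS' i (Fin.tail x))) 
          (continuous_finsetSum _ fun i _ => ((hdw _).mul ((hS' i).comp htail)).add (hw.mul ((hdS' i).comp htail)))
          (Fin.tail x) (-R) R
        simpa only [Fin.tail_cons] using this
    have hwne : ∀ x, w x ≠ 0 := fun x => (hwp x).ne'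
    refine ⟨Fin.cons (fun x => P x / w x) (fun i x => S' i (Fin.tail x)),
      Fin.cons (fun x => (r x * w x - P x * dw 0 x) / w x ^ 2) (fun i x => dS' i (Fin.tail x)),
      ?_, ?_, ?_, ?_, ?_, ?_, ?_⟩
    · refine Fin.cases ?_ fun i => ?_
      · exact hPc.div hw hwne
      · exact (hS' i).comp htail
    · refine Fin.cases ?_ fun i => ?_
      · exact ((hrc.mul hw).sub (hPc.mul (hdw 0))).div (hw.pow 2) fun x => pow_ne_zero 2 (hwne x)
      · exact (hdS' i).comp htail
    · refine Fin.cases ?_ fun i => ?_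
      · intro x
        have := (hPd x).fun_div (hwd 0 x) (hwne _)
        simpa only [Function.update_eq_self, Fin.cons_zero] using this
      · intro x
        have := hSd' i (Fin.tail x)
        simp only [Fin.cons_succ, Fin.tail_update_succ]
        exact this
    · refine Fin.cases ?_ fun i => ?_
      · intro x hx; simp [hP0 x hx]
      · intro x hx; exact hS0' i _ hx
    · refine Fin.cases ?_ fun i => ?_
      · intro x hx; simp [hP1 x hx]
      · intro x hx; exact hS1' i _ hx
    · refine Fin.cases ?_ fun i => ?_
      · intro j hj; exact absurd hj (Fin.not_lt_zero j)
      · refine Fin.cases ?_ fun j => ?_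
        · intro _ x t
          simp only [Fin.cons_succ, hupd0]
        · intro hj x t
          simp only [Fin.cons_succ, Fin.tail_update_succ]
          exact htri' i j (Fin.succ_lt_succ_iff.mp hj) _ _
    · intro x
      rw [Fin.sum_univ_succ]
      simp only [Fin.cons_zero, Fin.cons_succ]
      have h1 : dw 0 x * (P x / w x) + w x * ((r x * w x - P x * dw 0 x) / w x ^ 2) = r x := by
        have := hwne x
        field_simp
        ring
      rw [h1, hr]
      ring

lemma scalar_ineq {n β D α g m T : ℝ} (hn : 0 < n) (hβ : n < β)
    (h : D - β * α = -β * (g - m)) (hT : D ^ 2 ≤ n * T) :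
    (β + 1) * (g ^ 2 - m ^ 2) - m ^ 2 * (n / (β - n)) ≤
      2 * β * g * (g - m) + 2 * g * α - (β + 1) * α ^ 2 + 2 * D * α - D ^ 2 / β + T / β := by
  have hβ0 : 0 < β := hn.trans hβ
  have hbn : 0 < β - n := by linarith
  have hα : α = D / β + (g - m) := by
    field_simp
    linarith
  have hT' : D ^ 2 / n / β ≤ T / β := by
    gcongr
    rw [div_le_iff₀ hn]; linarith
  have key : 2 * β * g * (g - m) + 2 * g * α - (β + 1) * α ^ 2 + 2 * D * α - D ^ 2 / β
      + D ^ 2 / n / β - ((β + 1) * (g ^ 2 - m ^ 2) - m ^ 2 * (n / (β - n))) =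
      (β - n) / (β ^ 2 * n) * (D + m * β * n / (β - n)) ^ 2 := by
    rw [hα]
    field_simp
    ring
  have : 0 ≤ (β - n) / (β ^ 2 * n) * (D + m * β * n / (β - n)) ^ 2 := by positivity
  linarith

lemma HasPD.rpow {n : ℕ} {i : Fin n} {V dV : (Fin n → ℝ) → ℝ} (h : HasPD i V dV)
    (hV : ∀ x, 0 < V x) (p : ℝ) :
    HasPD i (fun x => V x ^ p) (fun x => dV x * p * V x ^ (p - 1)) := by
  intro x
  have := (h x).rpow_const (p := p) (Or.inl (hV _).ne')
  simpa only [Function.update_eq_self] using this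

lemma box_ineq {n : ℕ} (hn : 1 ≤ n) {β : ℝ} (hβ : (n : ℝ) < β) {R : ℝ} (hR : 0 < R)
    (V g K : (Fin n → ℝ) → ℝ) (dV dg : Fin n → (Fin n → ℝ) → ℝ)
    (ddV : Fin n → Fin n → (Fin n → ℝ) → ℝ)
    (hVc : Continuous V) (hVp : ∀ x, 0 < V x) (hdVc : ∀ i, Continuous (dV i))
    (hddVc : ∀ i j, Continuous (ddV i j)) (hgc : Continuous g) (hdgc : ∀ i, Continuous (dg i))
    (hV : ∀ i, HasPD i V (dV i)) (hdV : ∀ i j, HasPD j (dV i) (ddV i j))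
    (hsymm : ∀ i j x, ddV i j x = ddV j i x) (hg : ∀ i, HasPD i g (dg i))
    (hK : ∀ x (s : Fin n → ℝ), 2 * ∑ i, (dV i x * g x + V x * dg i x) * s i
      - ∑ i, ∑ j, ddV i j x * s i * s j ≤ K x)
    (hKi : IntegrableOn (fun x => K x * V x ^ (-β - 1)) (cube n R)) :
    (β + 1) * ((∫ x in cube n R, g x ^ 2 * V x ^ (-β)) -
        (∫ x in cube n R, g x * V x ^ (-β)) ^ 2 / ∫ x in cube n R, V x ^ (-β)) ≤
      (∫ x in cube n R, K x * V x ^ (-β - 1)) + (n : ℝ) / (β - n) *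
        ((∫ x in cube n R, g x * V x ^ (-β)) ^ 2 / ∫ x in cube n R, V x ^ (-β)) := by
  have hn0 : (0 : ℝ) < n := by exact_mod_cast hn
  have hβ0 : 0 < β := hn0.trans hβ
  have hVne : ∀ x, V x ≠ 0 := fun x => (hVp x).ne'
  have hpow : ∀ p : ℝ, Continuous (fun x => V x ^ p) := fun p =>
    hVc.rpow_const fun x => Or.inl (hVne x)
  obtain ⟨w, hwdef⟩ : ∃ w : (Fin n → ℝ) → ℝ, w = fun x => V x ^ (-β) := ⟨_, rfl⟩
  obtain ⟨u, hudef⟩ : ∃ u : (Fin n → ℝ) → ℝ, u = fun x => V x ^ (-β - 1) := ⟨_, rfl⟩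
  have hwx : ∀ x, V x ^ (-β) = w x := fun x => by rw [hwdef]
  have hux : ∀ x, V x ^ (-β - 1) = u x := fun x => by rw [hudef]
  have hwu : ∀ x, w x = V x * u x := by
    intro x
    rw [← hwx, ← hux, Real.rpow_sub_one (hVne x)]
    field_simp [hVne x]
  have hu2 : ∀ x, V x ^ (-β - 1 - 1) = u x / V x := by
    intro x
    rw [← hux, Real.rpow_sub_one (hVne x)]
  have hup : ∀ x, 0 < u x := fun x => by rw [← hux]; exact Real.rpow_pos_of_pos (hVp x) _
  have hwp : ∀ x, 0 < w x := fun x => by rw [← hwx]; exact Real.rpow_pos_of_pos (hVp x) _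
  have hwc : Continuous w := by rw [hwdef]; exact hpow _
  have huc : Continuous u := by rw [hudef]; exact hpow _
  simp only [hwx, hux] at hKi ⊢
  obtain ⟨dw, hdwdef⟩ : ∃ dw : Fin n → (Fin n → ℝ) → ℝ, dw = fun i x => dV i x * (-β) * u x :=
    ⟨_, rfl⟩
  have hdwx : ∀ i x, dw i x = dV i x * (-β) * u x := fun i x => by rw [hdwdef]
  have hdwc : ∀ i, Continuous (dw i) := fun i => by
    rw [hdwdef]; exact ((hdVc i).mul continuous_const).mul huc
  have hw : ∀ i, HasPD i w (dw i) := by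
    intro i
    rw [hwdef]
    refine ((hV i).rpow hVp (-β)).congr' fun x => ?_
    rw [hdwx, hux]
  obtain ⟨ddw, hddwdef⟩ : ∃ ddw : Fin n → Fin n → (Fin n → ℝ) → ℝ, ddw = fun i j x =>
    -β * (ddV i j x * u x - (β + 1) * (dV i x * dV j x * (u x / V x))) := ⟨_, rfl⟩
  have hddwx : ∀ i j x, ddw i j x =
    -β * (ddV i j x * u x - (β + 1) * (dV i x * dV j x * (u x / V x))) :=
    fun i j x => by rw [hddwdef]
  have hddwc : ∀ i j, Continuous (ddw i j) := fun i j => by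
    rw [hddwdef]
    exact continuous_const.mul (((hddVc i j).mul huc).sub (continuous_const.mul
      (((hdVc i).mul (hdVc j)).mul (huc.div hVc hVne))))
  have hddw : ∀ i j, HasPD j (dw i) (ddw i j) := by
    intro i j
    have hu : HasPD j u (fun x => dV j x * (-β - 1) * (u x / V x)) := by
      have h := (hV j).rpow hVp (-β - 1)
      rw [hudef]
      refine h.congr' fun x => ?_
      rw [hu2, hudef]
    have hc : HasPD j (fun _ : Fin n → ℝ => -β) (fun _ => 0) := HasPD.of_indep (by simp)
    rw [hdwdef]
    refine (((hdV i j).mul hc).mul hu).congr' fun x => ?_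
    rw [hddwx]
    ring
  have hddws : ∀ i j x, ddw i j x = ddw j i x := by
    intro i j x
    rw [hddwx, hddwx, hsymm i j]; ring
  have hI : ∀ {f : (Fin n → ℝ) → ℝ}, Continuous f → IntegrableOn f (cube n R) :=
    fun hf => integrableOn_cube hf
  -- mean
  set Z := ∫ x in cube n R, w x with hZ
  have hZp : 0 < Z := by
    rw [hZ, setIntegral_pos_iff_support_of_nonneg_ae
      (Filter.Eventually.of_forall fun x => (hwp x).le) (hI hwc)]
    have : Function.support w = Set.univ := by
      ext x; simp [(hwp x).ne']
    rw [this, Set.univ_inter, cube, Real.volume_Icc_pi]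
    simp only [Finset.prod_const]
    refine ENNReal.pow_pos ?_ _
    simp [hR]
  set I1 := ∫ x in cube n R, g x * w x with hI1
  obtain ⟨m, hm⟩ : ∃ m, m = I1 / Z := ⟨_, rfl⟩
  have hgw : Continuous fun x => g x * w x := hgc.mul hwc
  have hg2w : Continuous fun x => g x ^ 2 * w x := (hgc.pow 2).mul hwc
  have hq0 : ∫ x in cube n R, -β * ((g x - m) * w x) = 0 := by
    rw [integral_const_mul]
    simp only [sub_mul]
    have hmw : Continuous fun x => m * w x := continuous_const.mul hwc
    rw [integral_sub (hI hgw) (hI hmw), integral_const_mul, ← hZ, ← hI1, hm]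
    field_simp
    simp
  obtain ⟨S, dS, hSc, hdSc, hSd, hS0, hS1, htri, hdiv⟩ := exists_field hR n w
    (fun x => -β * ((g x - m) * w x)) dw hwc hwp
    (continuous_const.mul ((hgc.sub continuous_const).mul hwc)) hdwc hw hq0
  -- vanishing integrals
  have hF : ∀ i, ∫ x in cube n R, (dg i x * w x * S i x + g x * dw i x * S i x + g x * w x * dS i x) = 0 := by
    intro i
    refine cube_ibp (f := fun x => g x * w x * S i x) hR.le i ?_ ?_ ?_ ?_
    · exact ((((hdgc i).mul hwc).mul (hSc i)).add ((hgc.mul (hdwc i)).mul (hSc i))).add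
        (hgw.mul (hdSc i))
    · refine (((hg i).mul (hw i)).mul (hSd i)).congr' fun x => ?_
      ring
    · intro x hx; simp [hS0 i x hx]
    · intro x hx; simp [hS1 i x hx]
  obtain ⟨E, hEdef⟩ : ∃ E : Fin n → Fin n → (Fin n → ℝ) → ℝ, E = fun i j x =>
    ddw i j x * S i x * S j x + dw i x * S i x * dS j x + dw j x * S j x * dS i x +
      (if i = j then 0 else w x * dS i x * dS j x) := ⟨_, rfl⟩
  have hEc : ∀ i j, Continuous (E i j) := by
    intro i j
    rw [hEdef]
    have h4 : Continuous fun x => (if i = j then 0 else w x * dS i x * dS j x) := by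
      split_ifs
      · exact continuous_const
      · exact (hwc.mul (hdSc i)).mul (hdSc j)
    exact (((((hddwc i j).mul (hSc i)).mul (hSc j)).add (((hdwc i).mul (hSc i)).mul (hdSc j))).add
      (((hdwc j).mul (hSc j)).mul (hdSc i))).add h4
  have hE1 : ∀ i j, j < i → ∫ x in cube n R, E i j x = 0 := by
    intro i j hij
    refine cube_ibp (f := fun x => S i x * (dw i x * S j x) + dS i x * (w x * S j x)) hR.le j
      (hEc i j) ?_ ?_ ?_
    · have h1 := (HasPD.of_indep (htri i j hij)).mul ((hddw i j).mul (hSd j))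
      have h2 := (HasPD.of_indep ((hSd i).indep hij.ne' (htri i j hij))).mul ((hw j).mul (hSd j))
      intro x
      refine ((h1 x).fun_add (h2 x)).congr_deriv ?_
      simp only [hEdef, if_neg hij.ne']
      ring
    · intro x hx; simp [hS0 j x hx]
    · intro x hx; simp [hS1 j x hx]
  have hE : ∀ i j, ∫ x in cube n R, E i j x = 0 := by
    intro i j
    rcases lt_trichotomy j i with h | h | h
    · exact hE1 i j h
    · subst h
      refine cube_ibp (f := fun x => dw j x * S j x * S j x) hR.le j (hEc j j) ?_ ?_ ?_
      · refine (((hddw j j).mul (hSd j)).mul (hSd j)).congr' fun x => ?_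
        simp only [hEdef, if_true]
        ring
      · intro x hx; simp [hS0 j x hx]
      · intro x hx; simp [hS1 j x hx]
    · rw [← hE1 j i h]
      refine setIntegral_congr_fun measurableSet_Icc fun x _ => ?_
      simp only [hEdef, hddws i j x, if_neg h.ne, if_neg h.ne']
      ring
  -- main pointwise bound
  have hpt : ∀ x, (β + 1) * (g x ^ 2 * w x) - ((β + 1) * m ^ 2 + m ^ 2 * (n / (β - n))) * w x
      + (∑ i, 2 * (dg i x * w x * S i x + g x * dw i x * S i x + g x * w x * dS i x)
        + ∑ i, ∑ j, β⁻¹ * E i j x) ≤ K x * u x := by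
    intro x
    have hVx := hVp x
    have hux' := hup x
    obtain ⟨a, ha⟩ : ∃ a, a = ∑ i, dV i x * S i x := ⟨_, rfl⟩
    obtain ⟨b, hb⟩ : ∃ b, b = ∑ i, dg i x * S i x := ⟨_, rfl⟩
    obtain ⟨D, hD⟩ : ∃ D, D = ∑ i, dS i x := ⟨_, rfl⟩
    obtain ⟨T, hT⟩ : ∃ T, T = ∑ i, dS i x ^ 2 := ⟨_, rfl⟩
    obtain ⟨X, hX⟩ : ∃ X, X = ∑ i, ∑ j, ddV i j x * S i x * S j x := ⟨_, rfl⟩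
    have e1 : ∑ i, 2 * (dg i x * w x * S i x + g x * dw i x * S i x + g x * w x * dS i x) =
        2 * (w x * b - β * u x * g x * a + g x * w x * D) := by
      rw [← Finset.mul_sum, Finset.sum_add_distrib, Finset.sum_add_distrib, ha, hb, hD,
        Finset.mul_sum, Finset.mul_sum, Finset.mul_sum, sub_eq_add_neg, ← Finset.sum_neg_distrib]
      simp only [hdwx]
      have p1 : ∑ i, dg i x * w x * S i x = ∑ i, w x * (dg i x * S i x) :=
        Finset.sum_congr rfl fun i _ => by ring
      have p2 : ∑ i, g x * (dV i x * -β * u x) * S i x = ∑ i, -(β * u x * g x * (dV i x * S i x)) :=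
        Finset.sum_congr rfl fun i _ => by ring
      rw [p1, p2]
    have e2 : ∑ i, ∑ j, β⁻¹ * E i j x = β⁻¹ * (-β * (u x * X - (β + 1) * (u x / V x) * a ^ 2)
        - 2 * β * u x * a * D + w x * (D ^ 2 - T)) := by
      have hE' : ∀ i j, β⁻¹ * E i j x = β⁻¹ * (-β * u x * (ddV i j x * S i x * S j x)
          + β * (β + 1) * (u x / V x) * ((dV i x * S i x) * (dV j x * S j x))
          + (-β * u x) * ((dV i x * S i x) * dS j x) + (-β * u x) * (dS i x * (dV j x * S j x))
          + w x * (dS i x * dS j x) - w x * (if i = j then dS i x ^ 2 else 0)) := by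
        intro i j
        simp only [hEdef, hddwx, hdwx]
        split_ifs with h
        · subst h; ring
        · ring
      simp only [hE']
      simp only [← Finset.mul_sum, Finset.sum_add_distrib, Finset.sum_sub_distrib, ← Finset.sum_mul,
        Finset.sum_ite_eq, Finset.mem_univ, if_true, ← ha, ← hD, ← hX, ← hT]
      ring
    have e3 : -β * u x * a + w x * D = -β * ((g x - m) * w x) := by
      have := hdiv x
      rw [Finset.sum_add_distrib, ← Finset.mul_sum, ← hD] at this
      rw [← this, ha, Finset.mul_sum]
      congr 1
      refine Finset.sum_congr rfl fun i _ => ?_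
      rw [hdwx]; ring
    have e4 := hK x (fun i => S i x)
    have e5 : ∑ i, (dV i x * g x + V x * dg i x) * S i x = g x * a + V x * b := by
      rw [ha, hb, Finset.mul_sum, Finset.mul_sum, ← Finset.sum_add_distrib]
      refine Finset.sum_congr rfl fun i _ => ?_
      ring
    rw [e5, ← hX] at e4
    have e6 : D ^ 2 ≤ n * T := by
      have := sq_sum_le_card_mul_sum_sq (s := Finset.univ) (f := fun i => dS i x)
      simpa [hD, hT] using this
    have e7 : D - β * (a / V x) = -β * (g x - m) := by
      rw [hwu] at e3
      have : V x * u x ≠ 0 := by positivity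
      apply mul_left_cancel₀ this
      have h2 : V x * u x * (D - β * (a / V x)) = -β * u x * a + V x * u x * D := by
        field_simp
        ring
      rw [h2, e3]
      ring
    have e8 := scalar_ineq hn0 hβ e7 e6
    have e9 := mul_le_mul_of_nonneg_left e8 (hwp x).le
    have e10 := mul_le_mul_of_nonneg_right e4 hux'.le
    rw [e1, e2]
    refine le_trans ?_ e10
    refine le_trans (b := w x * (2 * β * g x * (g x - m) + 2 * g x * (a / V x) - (β + 1) * (a / V x) ^ 2
      + 2 * D * (a / V x) - D ^ 2 / β + T / β) + (2 * (w x * b - β * u x * g x * a + g x * w x * D) +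
      β⁻¹ * (-β * (u x * X - (β + 1) * (u x / V x) * a ^ 2)
        - 2 * β * u x * a * D + w x * (D ^ 2 - T)))) ?_ (le_of_eq ?_)
    · linarith
    · have hD' : D = β * (a / V x) - β * (g x - m) := by linarith
      rw [hwu]
      have h1 : 2 * β * g x * (g x - m) = 2 * g x * (β * (a / V x) - D) := by rw [hD']; ring
      rw [h1]
      field_simp
      ring
  have hFs : ∫ x in cube n R, (∑ i, 2 * (dg i x * w x * S i x + g x * dw i x * S i x + g x * w x * dS i x)
        + ∑ i, ∑ j, β⁻¹ * E i j x) = 0 := by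
    have c1 : ∀ i, Continuous fun x => 2 * (dg i x * w x * S i x + g x * dw i x * S i x + g x * w x * dS i x) :=
      fun i => continuous_const.mul (((((hdgc i).mul hwc).mul (hSc i)).add ((hgc.mul (hdwc i)).mul (hSc i))).add
        (hgw.mul (hdSc i)))
    have c2 : ∀ i j, Continuous fun x => β⁻¹ * E i j x := fun i j => continuous_const.mul (hEc i j)
    have c3 : ∀ i, Continuous fun x => ∑ j, β⁻¹ * E i j x := fun i =>
      continuous_finsetSum _ fun j _ => c2 i j
    rw [integral_add (hI (continuous_finsetSum _ fun i _ => c1 i))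
      (hI (continuous_finsetSum _ fun i _ => c3 i)),
      integral_finsetSum _ (fun i _ => hI (c1 i)), integral_finsetSum _ (fun i _ => hI (c3 i))]
    have : ∀ i, ∫ x in cube n R, ∑ j, β⁻¹ * E i j x = 0 := by
      intro i
      rw [integral_finsetSum _ (fun j _ => hI (c2 i j))]
      simp only [integral_const_mul, hE]; simp
    simp only [this, integral_const_mul, hF]
    simp
  have c1 : Continuous fun x => (∑ i, 2 * (dg i x * w x * S i x + g x * dw i x * S i x + g x * w x * dS i x)
        + ∑ i, ∑ j, β⁻¹ * E i j x) := by
    refine (continuous_finsetSum _ fun i _ => ?_).add (continuous_finsetSum _ fun i _ =>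
      continuous_finsetSum _ fun j _ => continuous_const.mul (hEc i j))
    exact continuous_const.mul (((((hdgc i).mul hwc).mul (hSc i)).add ((hgc.mul (hdwc i)).mul (hSc i))).add
        (hgw.mul (hdSc i)))
  have c2 : Continuous fun x => (β + 1) * (g x ^ 2 * w x) := continuous_const.mul hg2w
  have c3 : Continuous fun x => ((β + 1) * m ^ 2 + m ^ 2 * (n / (β - n))) * w x :=
    continuous_const.mul hwc
  have c4 : Continuous fun x => (β + 1) * (g x ^ 2 * w x) -
    ((β + 1) * m ^ 2 + m ^ 2 * (n / (β - n))) * w x := c2.sub c3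
  have hfin := setIntegral_mono (hI (c4.add c1)) hKi hpt
  simp only [Pi.add_apply] at hfin
  rw [integral_add (hI c4) (hI c1), hFs, integral_sub (hI c2) (hI c3),
    integral_const_mul, integral_const_mul, ← hZ] at hfin
  have hmZ : I1 ^ 2 / Z = m ^ 2 * Z := by
    rw [hm]; field_simp
  rw [hmZ]
  linarith

lemma hasPD_toLp {d : ℕ} {f : EuclideanSpace ℝ (Fin d) → ℝ} (hf : Differentiable ℝ f) (i : Fin d) :
    HasPD i (fun x => f (WithLp.toLp 2 x))
      (fun x => fderiv ℝ f (WithLp.toLp 2 x) (EuclideanSpace.single i 1)) := by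
  intro x
  have hu : ∀ s, WithLp.toLp 2 (Function.update x i s) =
      WithLp.toLp 2 x + (s - x i) • EuclideanSpace.single i (1 : ℝ) := by
    intro s
    ext j
    by_cases h : j = i
    · subst h; simp
    · simp [h]
  have h1 : HasDerivAt (fun s : ℝ => WithLp.toLp 2 x + (s - x i) • EuclideanSpace.single i (1 : ℝ))
      ((1 : ℝ) • EuclideanSpace.single i (1 : ℝ)) (x i) :=
    (((hasDerivAt_id (x i)).sub_const (x i)).smul_const _).const_add _
  have h2 := (hf (WithLp.toLp 2 x + (x i - x i) • EuclideanSpace.single i (1 : ℝ))).hasFDerivAt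
  have := h2.comp_hasDerivAt (x i) h1
  simp only [hu]
  simpa [Function.comp_def] using this

lemma gradient_coord {d : ℕ} (f : EuclideanSpace ℝ (Fin d) → ℝ) (x : EuclideanSpace ℝ (Fin d))
    (i : Fin d) : gradient f x i = fderiv ℝ f x (EuclideanSpace.single i 1) := by
  have h : inner ℝ (gradient f x) (EuclideanSpace.single i (1 : ℝ)) =
      fderiv ℝ f x (EuclideanSpace.single i 1) := by
    rw [gradient, InnerProductSpace.toDual_symm_apply]
  rw [← h, EuclideanSpace.inner_single_right]
  simp

lemma hessian_apply {d : ℕ} (f : EuclideanSpace ℝ (Fin d) → ℝ) (x : EuclideanSpace ℝ (Fin d))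
    (i j : Fin d) : hessianMatrix f x i j =
      fderiv ℝ (fderiv ℝ f) x (EuclideanSpace.single i 1) (EuclideanSpace.single j 1) := by
  simp [hessianMatrix, iteratedFDeriv_two_apply]

lemma hessian_symm {d : ℕ} {f : EuclideanSpace ℝ (Fin d) → ℝ} (hf : ContDiff ℝ 2 f)
    (x : EuclideanSpace ℝ (Fin d)) (i j : Fin d) : hessianMatrix f x i j = hessianMatrix f x j i := by
  rw [hessian_apply, hessian_apply]
  exact (hf.contDiffAt.isSymmSndFDerivAt (by simp)) _ _

lemma hess_quad_nonneg {d : ℕ} {V : EuclideanSpace ℝ (Fin d) → ℝ} (hV : ContDiff ℝ 2 V)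
    (hc : ConvexOn ℝ Set.univ V) (x v : EuclideanSpace ℝ (Fin d)) :
    0 ≤ fderiv ℝ (fderiv ℝ V) x v v := by
  have hl : ∀ t : ℝ, HasDerivAt (fun t : ℝ => x + t • v) v t := by
    intro t
    simpa using ((hasDerivAt_id t).smul_const v).const_add x
  have hVd : Differentiable ℝ V := hV.differentiable (by simp)
  have hV1 : ContDiff ℝ 1 (fderiv ℝ V) := hV.fderiv_right (by norm_num)
  have hVdd : Differentiable ℝ (fderiv ℝ V) := hV1.differentiable (by simp)
  have h1 : ∀ t : ℝ, HasDerivAt (fun t : ℝ => V (x + t • v)) (fderiv ℝ V (x + t • v) v) t :=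
    fun t => (hVd _).hasFDerivAt.comp_hasDerivAt t (hl t)
  have h2 : HasDerivAt (fun t : ℝ => fderiv ℝ V (x + t • v) v)
      (fderiv ℝ (fderiv ℝ V) (x + (0 : ℝ) • v) v v) 0 := by
    have := (hVdd (x + (0 : ℝ) • v)).hasFDerivAt.comp_hasDerivAt 0 (hl 0)
    exact this.clm_apply (hasDerivAt_const _ v) |>.congr_deriv (by simp)
  have hconv : ConvexOn ℝ Set.univ (fun t : ℝ => V (x + t • v)) := by
    refine ⟨convex_univ, fun s _ t _ a b ha hb hab => ?_⟩
    have := hc.2 (Set.mem_univ (x + s • v)) (Set.mem_univ (x + t • v)) ha hb hab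
    refine le_trans (le_of_eq ?_) this
    have hx : a • (x + s • v) + b • (x + t • v) = x + (a • s + b • t) • v := by
      have hb' : b = 1 - a := by linarith
      rw [hb']
      simp only [smul_eq_mul]
      module
    rw [hx]
  have hm := hconv.monotoneOn_deriv (fun t _ => (h1 t).differentiableAt)
  have hde : deriv (fun t : ℝ => V (x + t • v)) = fun t => fderiv ℝ V (x + t • v) v :=
    funext fun t => (h1 t).deriv
  rw [hde, monotoneOn_univ] at hm
  have := hm.deriv_nonneg (x := 0)
  rw [h2.deriv] at this
  simpa using this

lemma hess_sum {d : ℕ} (V : EuclideanSpace ℝ (Fin d) → ℝ) (x : EuclideanSpace ℝ (Fin d))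
    (s : Fin d → ℝ) : s ⬝ᵥ (hessianMatrix V x).mulVec s =
      fderiv ℝ (fderiv ℝ V) x (WithLp.toLp 2 s) (WithLp.toLp 2 s) := by
  have hs : WithLp.toLp 2 s = ∑ i, s i • EuclideanSpace.single i (1 : ℝ) := by
    ext j
    simp [Finset.sum_apply, Pi.single_apply]
  rw [hs]
  simp only [map_sum, _root_.sum_apply, map_smul, _root_.smul_apply,
    smul_eq_mul, dotProduct, mulVec, hessian_apply, Finset.mul_sum]
  rw [Finset.sum_comm]
  refine Finset.sum_congr rfl fun i _ => Finset.sum_congr rfl fun j _ => ?_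
  ring

lemma matrix_cs {d : ℕ} (H : Matrix (Fin d) (Fin d) ℝ) (hs : ∀ i j, H i j = H j i)
    (hu : IsUnit H) (hp : ∀ s : Fin d → ℝ, 0 ≤ s ⬝ᵥ H.mulVec s) (v s : Fin d → ℝ) :
    2 * (v ⬝ᵥ s) - s ⬝ᵥ H.mulVec s ≤ v ⬝ᵥ H⁻¹.mulVec v := by
  have hdet : IsUnit H.det := (Matrix.isUnit_iff_isUnit_det H).mp hu
  obtain ⟨p, hpdef⟩ : ∃ p, p = H⁻¹.mulVec v := ⟨_, rfl⟩
  have hHp : H.mulVec p = v := by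
    rw [hpdef, Matrix.mulVec_mulVec, Matrix.mul_nonsing_inv _ hdet, Matrix.one_mulVec]
  have hT : Hᵀ = H := by ext i j; exact hs j i
  have h := hp (s - p)
  have hps : p ⬝ᵥ H.mulVec s = v ⬝ᵥ s := by
    rw [Matrix.dotProduct_mulVec, ← Matrix.mulVec_transpose, hT, hHp]
  rw [Matrix.mulVec_sub, hHp, sub_dotProduct, dotProduct_sub, dotProduct_sub, hps,
    dotProduct_comm s v, dotProduct_comm p v] at h
  rw [← hpdef]
  linarith

lemma tendsto_cube {d : ℕ} {f : (Fin d → ℝ) → ℝ} (hf : Integrable f) :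
    Filter.Tendsto (fun k : ℕ => ∫ x in cube d ((k : ℝ) + 1), f x) Filter.atTop
      (nhds (∫ x, f x)) := by
  have hU : ⋃ k : ℕ, cube d ((k : ℝ) + 1) = Set.univ := by
    ext x
    simp only [Set.mem_iUnion, Set.mem_univ, iff_true]
    obtain ⟨k, hk⟩ := exists_nat_ge ‖x‖
    refine ⟨k, ?_, ?_⟩ <;> intro i <;>
    · have := norm_le_pi_norm x i
      have h2 := abs_le.mp (Real.norm_eq_abs (x i) ▸ this)
      linarith [h2.1, h2.2]
  have := tendsto_setIntegral_of_monotone (μ := volume) (f := f)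
    (s := fun k : ℕ => cube d ((k : ℝ) + 1)) (fun k => measurableSet_Icc) ?_ ?_
  · rwa [hU, Measure.restrict_univ] at this
  · intro a b hab
    have : (a : ℝ) ≤ b := by exact_mod_cast hab
    exact Set.Icc_subset_Icc (fun i => by linarith) (fun i => by linarith)
  · exact hf.integrableOn

/-- Weighted Poincaré inequality (Bobkov–Ledoux, Theorem 2.3): for `β > d`,
`V` positive, convex, `C²` with invertible Hessian and `Z_β < ∞`, every smooth
`π_β`-square-integrable `g` satisfies, with `G = V g`,
`(β+1) Var_{π_β}(g) ≤ ∫ ⟨(∇²V)⁻¹ ∇G, ∇G⟩ / V dπ_β + (d/(β-d)) (∫ g dπ_β)²`. -/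
theorem weighted_poincare_inequality
    (d : ℕ) (hd : 1 ≤ d) (β : ℝ) (hβ : (d : ℝ) < β)
    (V : EuclideanSpace ℝ (Fin d) → ℝ)
    (hV : ContDiff ℝ 2 V) (hVpos : ∀ x, 0 < V x)
    (hVconv : ConvexOn ℝ Set.univ V)
    (hVinv : ∀ x, IsUnit (hessianMatrix V x))
    (Zβ : ℝ) (hZβ : Zβ = ∫ x, V x ^ (-β))
    (hZint : Integrable fun x : EuclideanSpace ℝ (Fin d) => V x ^ (-β))
    (πβ : EuclideanSpace ℝ (Fin d) → ℝ)
    (hπβ : ∀ x, πβ x = Zβ⁻¹ * V x ^ (-β))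
    (g : EuclideanSpace ℝ (Fin d) → ℝ) (hg : ContDiff ℝ (⊤ : ℕ∞) g)
    (hg2 : Integrable fun x => g x ^ 2 * πβ x)
    (hg1 : Integrable fun x => g x * πβ x)
    (G : EuclideanSpace ℝ (Fin d) → ℝ) (hG : ∀ x, G x = V x * g x)
    (hRHS : Integrable fun x =>
      ((fun i => gradient G x i) ⬝ᵥ (hessianMatrix V x)⁻¹.mulVec fun i => gradient G x i)
        / V x * πβ x) :
    (β + 1) * ((∫ x, g x ^ 2 * πβ x) - (∫ x, g x * πβ x) ^ 2) ≤
      (∫ x, ((fun i => gradient G x i) ⬝ᵥ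
          (hessianMatrix V x)⁻¹.mulVec fun i => gradient G x i) / V x * πβ x)
        + ((d : ℝ) / (β - d)) * (∫ x, g x * πβ x) ^ 2 := by
  have hmp := PiLp.volume_preserving_toLp (Fin d)
  have hemb : MeasurableEmbedding (WithLp.toLp 2 : (Fin d → ℝ) → EuclideanSpace ℝ (Fin d)) :=
    (MeasurableEquiv.toLp 2 (Fin d → ℝ)).measurableEmbedding
  have hint : ∀ f : EuclideanSpace ℝ (Fin d) → ℝ,
      ∫ x : Fin d → ℝ, f (WithLp.toLp 2 x) = ∫ x, f x := fun f => hmp.integral_comp hemb f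
  have hintb : ∀ f : EuclideanSpace ℝ (Fin d) → ℝ, Integrable f →
      Integrable (fun x : Fin d → ℝ => f (WithLp.toLp 2 x)) := fun f hf =>
    (hmp.integrable_comp_emb hemb).mpr hf
  have htc : Continuous (fun x : Fin d → ℝ => WithLp.toLp 2 x) := PiLp.continuous_toLp 2 _
  obtain ⟨K, hKdef⟩ : ∃ K : EuclideanSpace ℝ (Fin d) → ℝ, K = fun x =>
    ((fun i => gradient G x i) ⬝ᵥ (hessianMatrix V x)⁻¹.mulVec fun i => gradient G x i) :=
    ⟨_, rfl⟩
  have hKx : ∀ x, ((fun i => gradient G x i) ⬝ᵥ (hessianMatrix V x)⁻¹.mulVec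
      fun i => gradient G x i) = K x := fun x => by rw [hKdef]
  simp only [hKx] at hRHS ⊢
  have hZpos : 0 < Zβ := by
    rw [hZβ, integral_pos_iff_support_of_nonneg (fun x => (Real.rpow_pos_of_pos (hVpos x) _).le) hZint]
    have : Function.support (fun x => V x ^ (-β)) = Set.univ := by
      ext x; simp [(Real.rpow_pos_of_pos (hVpos x) _).ne']
    rw [this]
    exact isOpen_univ.measure_pos _ Set.univ_nonempty
  have hZne : Zβ ≠ 0 := hZpos.ne'
  have hVne : ∀ x, V x ≠ 0 := fun x => (hVpos x).ne'
  have r1 : ∀ x, g x * πβ x = Zβ⁻¹ * (g x * V x ^ (-β)) := fun x => by rw [hπβ]; ring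
  have r2 : ∀ x, g x ^ 2 * πβ x = Zβ⁻¹ * (g x ^ 2 * V x ^ (-β)) := fun x => by rw [hπβ]; ring
  have r3 : ∀ x, K x / V x * πβ x = Zβ⁻¹ * (K x * V x ^ (-β - 1)) := fun x => by
    rw [hπβ, Real.rpow_sub_one (hVne x)]; ring
  simp only [r1, r2, r3] at hg1 hg2 hRHS ⊢
  have hiu : IsUnit Zβ⁻¹ := (inv_ne_zero hZne).isUnit
  rw [integrable_const_mul_iff hiu] at hg1 hg2 hRHS
  simp only [integral_const_mul]
  -- regularity
  have hVd : Differentiable ℝ V := hV.differentiable (by simp)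
  have hV1 : ContDiff ℝ 1 (fderiv ℝ V) := hV.fderiv_right (by norm_num)
  have hVdd : Differentiable ℝ (fderiv ℝ V) := hV1.differentiable (by simp)
  have hV2c : Continuous (fderiv ℝ (fderiv ℝ V)) := hV1.continuous_fderiv (by simp)
  have hgd : Differentiable ℝ g := hg.differentiable (by simp)
  have hgc1 : Continuous (fderiv ℝ g) := hg.continuous_fderiv (by simp)
  have hGe : G = fun x => V x * g x := funext hG
  have hGg : ∀ x i, gradient G x i = fderiv ℝ V x (EuclideanSpace.single i 1) * g x +
      V x * fderiv ℝ g x (EuclideanSpace.single i 1) := by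
    intro x i
    rw [gradient_coord, hGe, fderiv_fun_mul (hVd x) (hgd x)]
    simp only [_root_.add_apply, _root_.smul_apply, smul_eq_mul]
    ring
  have hKb : ∀ (x : Fin d → ℝ) (s : Fin d → ℝ),
      2 * ∑ i, (fderiv ℝ V (WithLp.toLp 2 x) (EuclideanSpace.single i 1) * g (WithLp.toLp 2 x) +
        V (WithLp.toLp 2 x) * fderiv ℝ g (WithLp.toLp 2 x) (EuclideanSpace.single i 1)) * s i
      - ∑ i, ∑ j, hessianMatrix V (WithLp.toLp 2 x) i j * s i * s j ≤ K (WithLp.toLp 2 x) := by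
    intro x s
    have h := matrix_cs (hessianMatrix V (WithLp.toLp 2 x)) (hessian_symm hV _) (hVinv _)
      (fun s => by rw [hess_sum]; exact hess_quad_nonneg hV hVconv _ _)
      (fun i => gradient G (WithLp.toLp 2 x) i) s
    rw [hKx] at h
    refine le_trans (le_of_eq ?_) h
    congr 1
    · simp only [dotProduct, hGg]
    · simp only [dotProduct, mulVec, Finset.mul_sum]
      refine Finset.sum_congr rfl fun i _ => Finset.sum_congr rfl fun j _ => ?_
      ring
  have hbox := fun k : ℕ => box_ineq hd hβ (R := (k : ℝ) + 1) (by positivity)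
    (fun x => V (WithLp.toLp 2 x)) (fun x => g (WithLp.toLp 2 x)) (fun x => K (WithLp.toLp 2 x))
    (fun i x => fderiv ℝ V (WithLp.toLp 2 x) (EuclideanSpace.single i 1))
    (fun i x => fderiv ℝ g (WithLp.toLp 2 x) (EuclideanSpace.single i 1))
    (fun i j x => hessianMatrix V (WithLp.toLp 2 x) i j)
    (hV.continuous.comp htc) (fun x => hVpos _)
    (fun i => (hV1.continuous.comp htc).clm_apply continuous_const)
    (fun i j => by
      simp only [hessian_apply]
      exact ((hV2c.comp htc).clm_apply continuous_const).clm_apply continuous_const)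
    (hg.continuous.comp htc)
    (fun i => (hgc1.comp htc).clm_apply continuous_const)
    (fun i => hasPD_toLp hVd i)
    (fun i j => by
      have hdi : Differentiable ℝ (fun y => fderiv ℝ V y (EuclideanSpace.single i 1)) :=
        hVdd.clm_apply (differentiable_const _)
      refine (hasPD_toLp hdi j).congr' fun x => ?_
      rw [hessian_symm hV, hessian_apply, fderiv_clm_apply (hVdd _) (differentiableAt_const _)]
      simp)
    (fun i j x => hessian_symm hV _ i j)
    (fun i => hasPD_toLp hgd i) hKb
    (hintb _ hRHS).integrableOn
  have t1 := tendsto_cube (hintb _ hg1)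
  have t2 := tendsto_cube (hintb _ hg2)
  have t3 := tendsto_cube (hintb _ hRHS)
  have t0 := tendsto_cube (hintb _ hZint)
  rw [hint (fun x => g x * V x ^ (-β))] at t1
  rw [hint (fun x => g x ^ 2 * V x ^ (-β))] at t2
  rw [hint (fun x => K x * V x ^ (-β - 1))] at t3
  rw [hint (fun x => V x ^ (-β)), ← hZβ] at t0
  have tq := (t1.pow 2).div t0 hZne
  have hlim := le_of_tendsto_of_tendsto' ((t2.sub tq).const_mul (β + 1))
    (t3.add (tq.const_mul ((d : ℝ) / (β - d)))) hbox
  have hfin := mul_le_mul_of_nonneg_left hlim (inv_pos.mpr hZpos).le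
  refine le_trans (le_of_eq ?_) (le_trans hfin (le_of_eq ?_))
  · field_simp
  · field_simp
end

section
/- Let d ≥ 1 be an integer and β > d. Let V ∈ C²(ℝ^d) be positive and convex with ∇²V(x) invertible for every x ∈ ℝ^d and Z_β := ∫_{ℝ^d} V(x)^{-β} dx < ∞. Suppose there exists a constant C_V ∈ (0, β+1) such that ⟨(∇²V)^{-1}(x)∇V(x), ∇V(x)⟩ / V(x) ≤ C_V for all x ∈ ℝ^d. Then for every smooth, π_β-square-integrable function φ on ℝ^d: Var_{π_β}(φ) ≤ (√(β+1) − √(C_V))^{-2} ∫_{ℝ^d} ⟨V(x)(∇²V)^{-1}(x)∇φ(x), ∇φ(x)⟩ π_β(x) dx. -/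
open MeasureTheory Real Matrix

lemma wp_hasFDerivAt_param {E : Type*} [NormedAddCommGroup E] [NormedSpace ℝ E]
    [FiniteDimensional ℝ E] {f : E × ℝ → ℝ} (hf : ContDiff ℝ 1 f) (a b : ℝ) (x : E) :
    HasFDerivAt (fun y => ∫ t in a..b, f (y, t))
      (∫ t in a..b, (fderiv ℝ f (x, t)).comp (ContinuousLinearMap.inl ℝ E ℝ)) x := by
  have : ProperSpace E := FiniteDimensional.proper ℝ E
  have cf := hf.continuous
  have cf' : Continuous (fderiv ℝ f) := hf.continuous_fderiv (by norm_num)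
  have cF' : Continuous fun p : E × ℝ => (fderiv ℝ f p).comp (ContinuousLinearMap.inl ℝ E ℝ) :=
    cf'.clm_comp continuous_const
  obtain ⟨C, hC⟩ := ((isCompact_closedBall x 1).prod (isCompact_uIcc (a := a) (b := b))).exists_bound_of_continuousOn
    cF'.continuousOn
  refine intervalIntegral.hasFDerivAt_integral_of_dominated_of_fderiv_le (μ := volume)
    (F' := fun y t => (fderiv ℝ f (y, t)).comp (ContinuousLinearMap.inl ℝ E ℝ))
    (bound := fun _ => C) (Metric.closedBall_mem_nhds x one_pos) ?_ ?_ ?_ ?_ ?_ ?_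
  · refine Filter.Eventually.of_forall fun y => Continuous.aestronglyMeasurable (by fun_prop)
  · exact Continuous.intervalIntegrable (by fun_prop) _ _
  · exact (cF'.comp (by fun_prop : Continuous fun t : ℝ => (x, t))).aestronglyMeasurable
  · refine Filter.Eventually.of_forall fun t ht y hy => hC (y, t) ⟨hy, Set.uIoc_subset_uIcc ht⟩
  · simp
  · refine Filter.Eventually.of_forall fun t ht y hy => ?_
    have h1 : HasFDerivAt f (fderiv ℝ f (y, t)) (y, t) :=
      (hf.differentiable (by norm_num) _).hasFDerivAt
    exact h1.comp y (hasFDerivAt_prodMk_left y t)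

lemma wp_fderiv_param {E : Type*} [NormedAddCommGroup E] [NormedSpace ℝ E]
    [FiniteDimensional ℝ E] {f : E × ℝ → ℝ} (hf : ContDiff ℝ 1 f) (a b : ℝ) (x v : E) :
    fderiv ℝ (fun y => ∫ t in a..b, f (y, t)) x v = ∫ t in a..b, fderiv ℝ f (x, t) (v, 0) := by
  rw [(wp_hasFDerivAt_param hf a b x).fderiv, ContinuousLinearMap.intervalIntegral_apply]
  · simp
  · have cf' : Continuous (fderiv ℝ f) := hf.continuous_fderiv (by norm_num)
    have cF' : Continuous fun p : E × ℝ => (fderiv ℝ f p).comp (ContinuousLinearMap.inl ℝ E ℝ) :=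
      cf'.clm_comp continuous_const
    exact (cF'.comp (by fun_prop : Continuous fun t : ℝ => (x, t))).intervalIntegrable _ _

lemma wp_continuous_param {E : Type*} [NormedAddCommGroup E] [NormedSpace ℝ E]
    {f : E × ℝ → ℝ} (hf : Continuous f) (a b : ℝ) :
    Continuous (fun y => ∫ t in a..b, f (y, t)) :=
  intervalIntegral.continuous_parametric_intervalIntegral_of_continuous' (by fun_prop) a b

lemma wp_contDiff_param {E : Type*} [NormedAddCommGroup E] [NormedSpace ℝ E]
    [FiniteDimensional ℝ E] (n : ℕ) {f : E × ℝ → ℝ} (hf : ContDiff ℝ n f) (a b : ℝ) :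
    ContDiff ℝ n (fun y => ∫ t in a..b, f (y, t)) := by
  induction n generalizing f with
  | zero =>
    simp only [Nat.cast_zero, contDiff_zero] at hf ⊢
    exact wp_continuous_param hf a b
  | succ n ih =>
    have h1 : ContDiff ℝ 1 f := hf.of_le (by push_cast; exact le_add_self)
    push_cast at hf ⊢
    rw [contDiff_succ_iff_fderiv_apply]
    refine ⟨fun x => (wp_hasFDerivAt_param h1 a b x).differentiableAt, by simp, fun v => ?_⟩
    simp_rw [wp_fderiv_param h1]
    have := (contDiff_succ_iff_fderiv_apply.1 hf).2.2 (v, 0)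
    exact ih this

/-- The local condition that is stable under taking marginals. -/
def WPCond {E : Type*} [NormedAddCommGroup E] [NormedSpace ℝ E] (β : ℝ) (ρ h R : E → ℝ) : Prop :=
  ContDiff ℝ 2 ρ ∧ ContDiff ℝ 1 h ∧ Continuous R ∧ (∀ x, 0 < ρ x) ∧
    ∀ x v, 2 * fderiv ℝ h x v + fderiv ℝ (fun y => fderiv ℝ ρ y v) x v / (β + 1)
      - ((β + 1) * h x + fderiv ℝ ρ x v) ^ 2 / (β * ρ x) ≤ R x

lemma WPCond.comp {E F : Type*} [NormedAddCommGroup E] [NormedSpace ℝ E]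
    [NormedAddCommGroup F] [NormedSpace ℝ F] {β : ℝ} {ρ h R : E → ℝ}
    (H : WPCond β ρ h R) (L : F →L[ℝ] E) :
    WPCond β (fun x => ρ (L x)) (fun x => h (L x)) (fun x => R (L x)) := by
  obtain ⟨h1, h2, h3, h4, h5⟩ := H
  refine ⟨h1.comp L.contDiff, h2.comp L.contDiff, h3.comp L.continuous, fun x => h4 _, fun x v => ?_⟩
  have key : ∀ (f : E → ℝ), ContDiff ℝ 1 f → ∀ y, fderiv ℝ (fun x => f (L x)) y v
      = fderiv ℝ f (L y) (L v) := fun f hf y => by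
    have h1 : HasFDerivAt f (fderiv ℝ f (L y)) (L y) :=
      (hf.differentiable (by norm_num) _).hasFDerivAt
    have := h1.comp y L.hasFDerivAt
    rw [show (fun x => f (L x)) = f ∘ L from rfl, this.fderiv]; simp
  rw [key h h2]
  simp_rw [key ρ (h1.of_le (by norm_num))]
  have h6 : ContDiff ℝ 1 fun y => fderiv ℝ ρ y (L v) :=
    (h1.fderiv_right (m := 1) (by norm_num)).clm_apply contDiff_const
  rw [key (fun y => fderiv ℝ ρ y (L v)) h6]
  exact h5 (L x) (L v)

lemma wp_one_dim {a b β : ℝ} (hab : a < b) (hβ : 1 < β)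
    (r rt rtt h ht rs rst rss hs R : ℝ → ℝ)
    (hr : ∀ t, HasDerivAt r (rt t) t) (hrt : ∀ t, HasDerivAt rt (rtt t) t)
    (hh : ∀ t, HasDerivAt h (ht t) t) (hrs : ∀ t, HasDerivAt rs (rst t) t)
    (crtt : Continuous rtt) (cht : Continuous ht) (crst : Continuous rst)
    (crss : Continuous rss) (chs : Continuous hs) (cR : Continuous R)
    (rpos : ∀ t, 0 < r t)
    (hR : ∀ t τ, 2 * ((β + 1) / β * (hs t + τ * ht t))
      + (((β + 1) / β) ^ 2 * (rss t + 2 * τ * rst t + τ ^ 2 * rtt t)) / (β + 1)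
      - ((β + 1) * h t + (β + 1) / β * (rs t + τ * rt t)) ^ 2 / (β * r t) ≤ R t) :
    2 * (∫ t in a..b, hs t) + (∫ t in a..b, rss t) / β
      - (β * (∫ t in a..b, h t) + ∫ t in a..b, rs t) ^ 2 / ((β - 1) * ∫ t in a..b, r t)
      ≤ β / (β + 1) * ∫ t in a..b, R t := by
  have cr : Continuous r := continuous_iff_continuousAt.2 fun t => (hr t).continuousAt
  have crt : Continuous rt := continuous_iff_continuousAt.2 fun t => (hrt t).continuousAt
  have ch : Continuous h := continuous_iff_continuousAt.2 fun t => (hh t).continuousAt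
  have crs : Continuous rs := continuous_iff_continuousAt.2 fun t => (hrs t).continuousAt
  have Ipos : 0 < ∫ t in a..b, r t :=
    intervalIntegral.intervalIntegral_pos_of_pos (cr.intervalIntegrable _ _) rpos hab
  set I := ∫ t in a..b, r t with hI
  set J := ∫ t in a..b, h t with hJ
  set S := ∫ t in a..b, rs t with hS
  obtain ⟨σ, hσ⟩ : ∃ σ, σ = -(β * J + S) / I := ⟨_, rfl⟩
  have hσI : β * J + S + σ * I = 0 := by rw [hσ]; field_simp; ring
  have cf : Continuous fun t => β * h t + rs t + σ * r t := by fun_prop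
  obtain ⟨P, hP⟩ : ∃ P : ℝ → ℝ, P = fun t => ∫ s in a..t, (β * h s + rs s + σ * r s) := ⟨_, rfl⟩
  have hPd : ∀ t, HasDerivAt P (β * h t + rs t + σ * r t) t := fun t => by
    rw [hP]
    exact intervalIntegral.integral_hasDerivAt_right (cf.intervalIntegrable _ _)
      (cf.stronglyMeasurableAtFilter _ _) cf.continuousAt
  have hPa : P a = 0 := by simp [hP]
  have hPb : P b = 0 := by
    rw [hP]
    simp only
    rw [intervalIntegral.integral_add, intervalIntegral.integral_add,
      intervalIntegral.integral_const_mul, intervalIntegral.integral_const_mul]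
    · exact hσI
    all_goals exact Continuous.intervalIntegrable (by fun_prop) _ _
  have cP : Continuous P := continuous_iff_continuousAt.2 fun t => (hPd t).continuousAt
  obtain ⟨τ, hτ⟩ : ∃ τ : ℝ → ℝ, τ = fun t => -(P t / r t) := ⟨_, rfl⟩
  obtain ⟨τ', hτ'⟩ : ∃ τ' : ℝ → ℝ, τ' = fun t =>
    -(((β * h t + rs t + σ * r t) * r t - P t * rt t) / r t ^ 2) := ⟨_, rfl⟩
  have hτd : ∀ t, HasDerivAt τ (τ' t) t := fun t => by
    rw [hτ, hτ']
    exact ((hPd t).div (hr t) (rpos t).ne').neg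
  have cτ : Continuous τ := continuous_iff_continuousAt.2 fun t => (hτd t).continuousAt
  have cτ' : Continuous τ' := by
    rw [hτ']
    have : ∀ t, r t ^ 2 ≠ 0 := fun t => (pow_pos (rpos t) 2).ne'
    fun_prop (disch := assumption)
  have hA : ∀ t, β * h t + rs t + τ t * rt t = - r t * (τ' t + σ) := fun t => by
    have := (rpos t).ne'
    rw [hτ, hτ']; field_simp; ring
  obtain ⟨F, hF⟩ : ∃ F : ℝ → ℝ, F = fun t => 2 * (τ t * h t) +
    (2 * (τ t * rs t) + τ t ^ 2 * rt t) / β := ⟨_, rfl⟩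
  obtain ⟨F', hF'⟩ : ∃ F' : ℝ → ℝ, F' = fun t => 2 * (τ' t * h t + τ t * ht t) +
    (2 * (τ' t * rs t + τ t * rst t) + (2 * τ t * τ' t * rt t + τ t ^ 2 * rtt t)) / β := ⟨_, rfl⟩
  have hFd : ∀ t, HasDerivAt F (F' t) t := fun t => by
    rw [hF, hF']
    have := (((hτd t).mul (hh t)).const_mul 2).add
      (((((hτd t).mul (hrs t)).const_mul 2).add (((hτd t).pow 2).mul (hrt t))).div_const β)
    refine this.congr_deriv ?_
    simp
  have cF' : Continuous F' := by rw [hF']; fun_prop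
  have hFint : ∫ t in a..b, F' t = 0 := by
    rw [intervalIntegral.integral_eq_sub_of_hasDerivAt (fun t _ => hFd t)
      (cF'.intervalIntegrable _ _)]
    simp [hF, hτ, hPa, hPb]
  have key : ∀ t, 2 * hs t + rss t / β + F' t - σ ^ 2 / (β - 1) * r t ≤ β / (β + 1) * R t := by
    intro t
    have h1 := hR t (τ t)
    have hb : 0 < β := by linarith
    have hb1 : 0 < β - 1 := by linarith
    have hrp := rpos t
    have h2 : β / (β + 1) * (2 * ((β + 1) / β * (hs t + τ t * ht t))
      + (((β + 1) / β) ^ 2 * (rss t + 2 * τ t * rst t + τ t ^ 2 * rtt t)) / (β + 1)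
      - ((β + 1) * h t + (β + 1) / β * (rs t + τ t * rt t)) ^ 2 / (β * r t)) ≤ β / (β + 1) * R t :=
      mul_le_mul_of_nonneg_left h1 (by positivity)
    refine le_trans ?_ h2
    have h3 : ((β + 1) * h t + (β + 1) / β * (rs t + τ t * rt t)) =
      (β + 1) / β * (- r t * (τ' t + σ)) := by
      rw [← hA]; field_simp; ring
    rw [h3]
    have h4 : rs t = - r t * (τ' t + σ) - τ t * rt t - β * h t := by linarith [hA t]
    have h5 : β / (β + 1) * (2 * ((β + 1) / β * (hs t + τ t * ht t))
      + (((β + 1) / β) ^ 2 * (rss t + 2 * τ t * rst t + τ t ^ 2 * rtt t)) / (β + 1)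
      - ((β + 1) / β * (- r t * (τ' t + σ))) ^ 2 / (β * r t))
      - (2 * hs t + rss t / β + F' t - σ ^ 2 / (β - 1) * r t)
      = r t * (β - 1) / β ^ 2 * (τ' t - σ / (β - 1)) ^ 2 := by
      rw [hF']; simp only; rw [h4]; field_simp; ring
    have h6 : 0 ≤ r t * (β - 1) / β ^ 2 * (τ' t - σ / (β - 1)) ^ 2 := by positivity
    linarith
  have hmono := intervalIntegral.integral_mono_on (μ := volume) (a := a) (b := b) hab.le
    (f := fun t => 2 * hs t + rss t / β + F' t - σ ^ 2 / (β - 1) * r t)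
    (g := fun t => β / (β + 1) * R t)
    (Continuous.intervalIntegrable (by fun_prop) _ _)
    (Continuous.intervalIntegrable (by fun_prop) _ _) (fun t _ => key t)
  rw [intervalIntegral.integral_sub, intervalIntegral.integral_add, intervalIntegral.integral_add,
      intervalIntegral.integral_const_mul, intervalIntegral.integral_const_mul,
      intervalIntegral.integral_const_mul, intervalIntegral.integral_div, hFint] at hmono
  · have hb1 : 0 < β - 1 := by linarith
    have : (β * J + S) ^ 2 / ((β - 1) * I) = σ ^ 2 / (β - 1) * I := by
      rw [hσ]; field_simp
    rw [this]; linarith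
  all_goals exact Continuous.intervalIntegrable (by fun_prop) _ _

lemma wp_fderiv_fderiv {E : Type*} [NormedAddCommGroup E] [NormedSpace ℝ E] {ρ : E → ℝ}
    (h : ContDiff ℝ 2 ρ) (x u w : E) :
    fderiv ℝ (fun y => fderiv ℝ ρ y u) x w = fderiv ℝ (fderiv ℝ ρ) x w u := by
  have h1 : DifferentiableAt ℝ (fderiv ℝ ρ) x :=
    (h.fderiv_right (m := 1) (by norm_num)).differentiable (by norm_num) x
  have := h1.hasFDerivAt.clm_apply (hasFDerivAt_const u x)
  rw [this.fderiv]; simp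

lemma WPCond.marginal {E : Type*} [NormedAddCommGroup E] [NormedSpace ℝ E]
    [FiniteDimensional ℝ E] {β a b : ℝ} (hβ : 1 < β) (hab : a < b) {ρ h R : E × ℝ → ℝ}
    (H : WPCond β ρ h R) :
    WPCond (β - 1) (fun x => ∫ t in a..b, ρ (x, t)) (fun x => ∫ t in a..b, h (x, t))
      (fun x => β / (β + 1) * ∫ t in a..b, R (x, t)) := by
  obtain ⟨h1, h2, h3, h4, h5⟩ := H
  have h1' : ContDiff ℝ 1 ρ := h1.of_le (by norm_num)
  refine ⟨wp_contDiff_param 2 h1 a b, wp_contDiff_param 1 h2 a b,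
    continuous_const.mul (wp_continuous_param h3 a b), fun x => ?_, fun x v => ?_⟩
  · have cr := h1.continuous
    exact intervalIntegral.intervalIntegral_pos_of_pos
      (Continuous.intervalIntegrable (by fun_prop) _ _) (fun t => h4 _) hab
  have hd : ∀ (f : E × ℝ → ℝ), ContDiff ℝ 1 f → ∀ t,
      HasDerivAt (fun t => f (x, t)) (fderiv ℝ f (x, t) (0, 1)) t := fun f hf t => by
    have h1 : HasFDerivAt f (fderiv ℝ f (x, t)) (x, t) :=
      (hf.differentiable (by norm_num) _).hasFDerivAt
    have h2 : HasDerivAt (fun t : ℝ => (x, t)) ((0 : E), (1 : ℝ)) t :=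
      (hasDerivAt_const t x).prodMk (hasDerivAt_id t)
    exact h1.comp_hasDerivAt t h2
  have hD1 : ∀ u, ContDiff ℝ 1 fun y => fderiv ℝ ρ y u := fun u =>
    (h1.fderiv_right (m := 1) (by norm_num)).clm_apply contDiff_const
  have hc : ∀ (f : E × ℝ → ℝ), ContDiff ℝ 1 f → ∀ u, Continuous fun t => fderiv ℝ f (x, t) u :=
    fun f hf u => ((hf.continuous_fderiv (by norm_num)).clm_apply continuous_const).comp
      (by fun_prop : Continuous fun t : ℝ => (x, t))
  have := wp_one_dim hab hβ (fun t => ρ (x, t)) (fun t => fderiv ℝ ρ (x, t) (0, 1))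
    (fun t => fderiv ℝ (fun y => fderiv ℝ ρ y (0, 1)) (x, t) (0, 1))
    (fun t => h (x, t)) (fun t => fderiv ℝ h (x, t) (0, 1))
    (fun t => fderiv ℝ ρ (x, t) (v, 0))
    (fun t => fderiv ℝ (fun y => fderiv ℝ ρ y (v, 0)) (x, t) (0, 1))
    (fun t => fderiv ℝ (fun y => fderiv ℝ ρ y (v, 0)) (x, t) (v, 0))
    (fun t => fderiv ℝ h (x, t) (v, 0))
    (fun t => R (x, t))
    (hd ρ h1') (hd _ (hD1 _)) (hd h h2) (hd _ (hD1 _)) (hc _ (hD1 _) _) (hc _ h2 _)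
    (hc _ (hD1 _) _) (hc _ (hD1 _) _) (hc _ h2 _) (by fun_prop) (fun t => h4 _) ?_
  · rw [wp_fderiv_param h2]
    simp_rw [wp_fderiv_param h1']
    rw [wp_fderiv_param (hD1 _)]
    simpa using this
  · intro t τ
    have h6 := h5 (x, t) (((β + 1) / β) • ((v, (0 : ℝ)) + τ • ((0 : E), (1 : ℝ))))
    have hs : fderiv ℝ (fderiv ℝ ρ) (x, t) (v, 0) (0, 1) =
        fderiv ℝ (fderiv ℝ ρ) (x, t) (0, 1) (v, 0) :=
      (h1.contDiffAt.isSymmSndFDerivAt (by simp)).eq _ _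
    simp only [wp_fderiv_fderiv h1] at h6 ⊢
    simp only [map_smul, map_add, _root_.add_apply, _root_.smul_apply,
      smul_eq_mul, hs] at h6
    refine le_trans (le_of_eq ?_) h6
    ring

/-- product measure on a cube -/
noncomputable def wpCube (n : ℕ) (a b : ℝ) : Measure (Fin n → ℝ) :=
  Measure.pi fun _ => (volume : Measure ℝ).restrict (Set.Ioc a b)

instance (n : ℕ) (a b : ℝ) : IsFiniteMeasure (wpCube n a b) := by
  unfold wpCube; infer_instance

lemma wpCube_eq (n : ℕ) (a b : ℝ) :
    wpCube n a b = volume.restrict (Set.univ.pi fun _ => Set.Ioc a b) := by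
  rw [wpCube, volume_pi, Measure.restrict_pi_pi]

lemma wpCube_integrable (n : ℕ) (a b : ℝ) {f : (Fin n → ℝ) → ℝ} (hf : Continuous f) :
    Integrable f (wpCube n a b) := by
  rw [wpCube_eq]
  have : IntegrableOn f (Set.univ.pi fun _ => Set.Icc a b) volume :=
    hf.continuousOn.integrableOn_compact (isCompact_univ_pi fun _ => isCompact_Icc)
  exact this.mono_set (Set.pi_mono fun _ _ => Set.Ioc_subset_Icc_self)

/-- `(x, t) ↦ (t, x)` as a continuous linear map. -/
noncomputable def wpCons (n : ℕ) : ((Fin n → ℝ) × ℝ) →L[ℝ] (Fin (n + 1) → ℝ) :=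
  LinearMap.toContinuousLinearMap
    { toFun := fun p => Fin.cons p.2 p.1
      map_add' := fun p q => by
        funext i; refine Fin.cases ?_ (fun j => ?_) i <;> simp
      map_smul' := fun c p => by
        funext i; refine Fin.cases ?_ (fun j => ?_) i <;> simp }

lemma wpCons_apply (n : ℕ) (p : (Fin n → ℝ) × ℝ) : wpCons n p = Fin.cons p.2 p.1 := rfl

lemma wpCube_succ (n : ℕ) {a b : ℝ} (hab : a ≤ b) {f : (Fin (n + 1) → ℝ) → ℝ}
    (hf : Continuous f) :
    ∫ x, f x ∂(wpCube (n + 1) a b) = ∫ x, (∫ t in a..b, f (wpCons n (x, t))) ∂(wpCube n a b) := by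
  have hm := (measurePreserving_piFinSuccAbove
    (fun _ : Fin (n + 1) => (volume : Measure ℝ).restrict (Set.Ioc a b)) 0).symm
  have hi := wpCube_integrable (n + 1) a b hf
  have hcons : ∀ p : ℝ × (Fin n → ℝ),
      (MeasurableEquiv.piFinSuccAbove (fun _ : Fin (n + 1) => ℝ) 0).symm p
        = wpCons n (p.2, p.1) := fun p => by
    simp [MeasurableEquiv.piFinSuccAbove_symm_apply, Fin.insertNthEquiv, wpCons_apply]
  have e1 : ∫ x, f x ∂(wpCube (n + 1) a b) = ∫ p : ℝ × (Fin n → ℝ), f (wpCons n (p.2, p.1))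
      ∂(((volume : Measure ℝ).restrict (Set.Ioc a b)).prod (wpCube n a b)) := by
    rw [wpCube, ← hm.integral_comp']
    simp_rw [hcons]
    rfl
  have hi2 : Integrable (fun p : ℝ × (Fin n → ℝ) => f (wpCons n (p.2, p.1)))
      (((volume : Measure ℝ).restrict (Set.Ioc a b)).prod (wpCube n a b)) := by
    rw [wpCube, ← hm.integrable_comp_emb (MeasurableEquiv.measurableEmbedding _)] at hi
    rw [Function.comp_def] at hi
    simp_rw [hcons] at hi
    exact hi
  rw [e1, integral_prod_symm _ hi2]
  simp_rw [intervalIntegral.integral_of_le hab]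

theorem WPCond.main (n : ℕ) {a b : ℝ} (hab : a < b) {β : ℝ} (hβ : (n : ℝ) < β)
    {ρ h R : (Fin n → ℝ) → ℝ} (H : WPCond β ρ h R)
    (h0 : ∫ x, h x ∂(wpCube n a b) = 0) : 0 ≤ ∫ x, R x ∂(wpCube n a b) := by
  induction n generalizing β with
  | zero =>
    obtain ⟨h1, h2, h3, h4, h5⟩ := H
    have hx : ∀ x : Fin 0 → ℝ, x = 0 := fun x => Subsingleton.elim _ _
    have e : ∀ f : (Fin 0 → ℝ) → ℝ, ∫ x, f x ∂(wpCube 0 a b) = f 0 := fun f => by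
      rw [integral_congr_ae (g := fun _ => f 0) (Filter.Eventually.of_forall fun x => by rw [hx x])]
      simp [wpCube, Measure.real]
    rw [e] at h0 ⊢
    have := h5 0 0
    simp only [map_zero, h0, mul_zero, add_zero, zero_div] at this
    simpa using this
  | succ n ih =>
    push_cast at hβ
    have hn : (0 : ℝ) ≤ n := Nat.cast_nonneg n
    have H' := (H.comp (wpCons n)).marginal (a := a) (b := b) (by linarith) hab
    rw [wpCube_succ n hab.le H.2.1.continuous] at h0
    have := ih (β := β - 1) (by linarith) H' h0
    rw [integral_const_mul] at this
    rw [wpCube_succ n hab.le H.2.2.1]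
    have hp : 0 < β / (β + 1) := by apply div_pos <;> linarith
    exact nonneg_of_mul_nonneg_right this hp

lemma wp_matrix {d : ℕ} {M : Matrix (Fin d) (Fin d) ℝ} (hs : Mᵀ = M) (hu : IsUnit M)
    (hp : ∀ v, 0 ≤ v ⬝ᵥ M *ᵥ v) (v w : Fin d → ℝ) {a p : ℝ} (hp0 : 0 < p) :
    2 * (a * (w ⬝ᵥ v)) - p * (v ⬝ᵥ M *ᵥ v) ≤ a ^ 2 / p * (w ⬝ᵥ M⁻¹ *ᵥ w) := by
  have h1 := hp (p • v - a • M⁻¹ *ᵥ w)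
  have hMM : M *ᵥ (M⁻¹ *ᵥ w) = w := by
    rw [mulVec_mulVec, Matrix.mul_nonsing_inv _ ((Matrix.isUnit_iff_isUnit_det _).1 hu), one_mulVec]
  have h3 : (M⁻¹ *ᵥ w) ⬝ᵥ M *ᵥ v = w ⬝ᵥ v := by
    rw [dotProduct_mulVec, ← mulVec_transpose, hs, hMM]
  simp only [mulVec_sub, mulVec_smul, hMM, dotProduct_sub, sub_dotProduct, smul_dotProduct,
    dotProduct_smul, smul_eq_mul, h3] at h1
  rw [dotProduct_comm v w, dotProduct_comm _ w] at h1
  have h4 : 0 ≤ p * (p * (v ⬝ᵥ M *ᵥ v)) - 2 * (a * (p * (w ⬝ᵥ v)))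
      + a ^ 2 * (w ⬝ᵥ M⁻¹ *ᵥ w) := by linarith
  have h5 : a ^ 2 / p * (w ⬝ᵥ M⁻¹ *ᵥ w) - (2 * (a * (w ⬝ᵥ v)) - p * (v ⬝ᵥ M *ᵥ v))
    = (p * (p * (v ⬝ᵥ M *ᵥ v)) - 2 * (a * (p * (w ⬝ᵥ v)))
      + a ^ 2 * (w ⬝ᵥ M⁻¹ *ᵥ w)) / p := by field_simp; ring
  have := div_nonneg h4 hp0.le
  linarith

lemma wp_hessian_apply {d : ℕ} (V : EuclideanSpace ℝ (Fin d) → ℝ)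
    (x v : EuclideanSpace ℝ (Fin d)) :
    (fun i => v i) ⬝ᵥ (hessianMatrix V x) *ᵥ (fun i => v i)
      = fderiv ℝ (fderiv ℝ V) x v v := by
  have hv : v = ∑ i, v i • EuclideanSpace.single i (1 : ℝ) := by
    ext j
    simp [Finset.sum_apply, Pi.single_apply]
  conv_rhs => rw [hv]
  simp only [map_sum, map_smul, _root_.sum_apply, _root_.smul_apply, dotProduct, mulVec,
    hessianMatrix, of_apply, iteratedFDeriv_two_apply, smul_eq_mul, Finset.mul_sum]
  rw [Finset.sum_comm]
  refine Finset.sum_congr rfl fun i _ => Finset.sum_congr rfl fun j _ => ?_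
  simp; ring

lemma wp_hessian_symm {d : ℕ} {V : EuclideanSpace ℝ (Fin d) → ℝ} (hV : ContDiff ℝ 2 V)
    (x : EuclideanSpace ℝ (Fin d)) : (hessianMatrix V x)ᵀ = hessianMatrix V x := by
  ext i j
  simp only [transpose_apply, hessianMatrix, of_apply, iteratedFDeriv_two_apply]
  exact (hV.contDiffAt.isSymmSndFDerivAt (by simp)).eq _ _

lemma wp_hessian_cont {d : ℕ} {V : EuclideanSpace ℝ (Fin d) → ℝ} (hV : ContDiff ℝ 2 V) :
    Continuous (hessianMatrix V) := by
  refine continuous_matrix fun i j => ?_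
  simp only [hessianMatrix, of_apply, iteratedFDeriv_two_apply]
  have : Continuous (fderiv ℝ (fderiv ℝ V)) :=
    (hV.fderiv_right (m := 1) (by norm_num)).continuous_fderiv (by norm_num)
  exact (this.clm_apply continuous_const).clm_apply continuous_const

lemma wp_hessian_inv_cont {d : ℕ} {V : EuclideanSpace ℝ (Fin d) → ℝ} (hV : ContDiff ℝ 2 V)
    (hu : ∀ x, IsUnit (hessianMatrix V x)) :
    Continuous fun x => (hessianMatrix V x)⁻¹ := by
  have h := wp_hessian_cont hV
  simp_rw [Matrix.inv_def, Ring.inverse_eq_inv]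
  exact (h.matrix_det.inv₀ fun x => ((Matrix.isUnit_iff_isUnit_det _).1 (hu x)).ne_zero).smul
    h.matrix_adjugate

lemma wp_hessian_nonneg {E : Type*} [NormedAddCommGroup E] [NormedSpace ℝ E] {V : E → ℝ}
    (hV : ContDiff ℝ 2 V) (hc : ConvexOn ℝ Set.univ V) (x v : E) :
    0 ≤ fderiv ℝ (fderiv ℝ V) x v v := by
  have hline : ∀ s : ℝ, HasDerivAt (fun s : ℝ => x + s • v) v s := fun s => by
    simpa using ((hasDerivAt_id s).smul_const v).const_add x
  have h1 : ∀ s : ℝ, HasDerivAt (fun s : ℝ => V (x + s • v)) (fderiv ℝ V (x + s • v) v) s :=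
    fun s => ((hV.differentiable (by norm_num) _).hasFDerivAt).comp_hasDerivAt s (hline s)
  have hD1 : ContDiff ℝ 1 fun y => fderiv ℝ V y v :=
    (hV.fderiv_right (m := 1) (by norm_num)).clm_apply contDiff_const
  have h2 : HasDerivAt (fun s : ℝ => fderiv ℝ V (x + s • v) v)
      (fderiv ℝ (fun y => fderiv ℝ V y v) (x + (0 : ℝ) • v) v) 0 :=
    ((hD1.differentiable (by norm_num) _).hasFDerivAt).comp_hasDerivAt (0 : ℝ) (hline 0)
  have hcv : ConvexOn ℝ Set.univ (fun s : ℝ => V (x + s • v)) := by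
    refine ⟨convex_univ, fun s _ t _ a b ha hb hab => ?_⟩
    have := hc.2 (Set.mem_univ (x + s • v)) (Set.mem_univ (x + t • v)) ha hb hab
    refine le_trans (le_of_eq ?_) this
    change V (x + (a • s + b • t) • v) = V (a • (x + s • v) + b • (x + t • v))
    congr 1
    have hx : x = a • x + b • x := by rw [← add_smul, hab, one_smul]
    conv_lhs => rw [hx]
    simp only [smul_add, add_smul, smul_smul, smul_eq_mul]
    abel
  have hm := hcv.monotoneOn_deriv (fun s _ => (h1 s).differentiableAt)
  rw [monotoneOn_univ] at hm
  have he : deriv (fun s : ℝ => V (x + s • v)) = fun s => fderiv ℝ V (x + s • v) v :=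
    funext fun s => (h1 s).deriv
  rw [he] at hm
  have := hm.deriv_nonneg (x := 0)
  rw [h2.deriv, wp_fderiv_fderiv hV] at this
  simpa using this

lemma wp_gradient_apply {d : ℕ} (f : EuclideanSpace ℝ (Fin d) → ℝ)
    (x v : EuclideanSpace ℝ (Fin d)) :
    (fun i => gradient f x i) ⬝ᵥ (fun i => v i) = fderiv ℝ f x v := by
  rw [← inner_gradient_left, PiLp.inner_apply]
  simp [dotProduct, mul_comm]

lemma wp_gradient_cont {d : ℕ} {f : EuclideanSpace ℝ (Fin d) → ℝ} (hf : ContDiff ℝ 1 f) :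
    Continuous fun x => (fun i => gradient f x i : Fin d → ℝ) := by
  refine continuous_pi fun i => ?_
  have : ∀ x, gradient f x i = fderiv ℝ f x (EuclideanSpace.single i 1) := fun x => by
    rw [← wp_gradient_apply]
    simp [dotProduct]
  simp_rw [this]
  exact (hf.continuous_fderiv (by norm_num)).clm_apply continuous_const

lemma wp_local {d : ℕ} {β : ℝ} (hβ : 0 < β)
    {V : EuclideanSpace ℝ (Fin d) → ℝ}
    (hV : ContDiff ℝ 2 V) (hVpos : ∀ x, 0 < V x)
    (hVconv : ConvexOn ℝ Set.univ V)
    (hVinv : ∀ x, IsUnit (hessianMatrix V x))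
    {CV : ℝ} (hCV0 : 0 < CV) (hCVβ : CV < β + 1)
    (hCV : ∀ x,
      ((fun i => gradient V x i) ⬝ᵥ (hessianMatrix V x)⁻¹.mulVec fun i => gradient V x i)
        / V x ≤ CV)
    {φ : EuclideanSpace ℝ (Fin d) → ℝ} (hφ : ContDiff ℝ 1 φ) (c : ℝ) :
    WPCond β (fun x => V x ^ (-β)) (fun x => (φ x - c) * V x ^ (-β))
      (fun x => (β + 1) * √(β + 1) / (β * (√(β + 1) - √CV)) *
        (((V x • (hessianMatrix V x)⁻¹).mulVec (fun i => gradient φ x i) ⬝ᵥ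
        fun i => gradient φ x i) * V x ^ (-β) -
          (√(β + 1) - √CV) ^ 2 * ((φ x - c) ^ 2 * V x ^ (-β)))) := by
  have hne : ∀ x, V x ≠ 0 := fun x => (hVpos x).ne'
  have cV := hV.continuous
  have cρ : ∀ γ : ℝ, ContDiff ℝ 2 fun x => V x ^ γ := fun γ => hV.rpow_const_of_ne hne
  have cρ' := (cρ (-β)).continuous
  have cφ := hφ.continuous
  refine ⟨cρ _, (hφ.sub contDiff_const).mul ((cρ _).of_le (by norm_num)), ?_,
    fun x => rpow_pos_of_pos (hVpos x) _, fun x v => ?_⟩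
  · have h1 := wp_hessian_inv_cont hV hVinv
    have h2 := wp_gradient_cont hφ
    have h3 : Continuous fun x => (V x • (hessianMatrix V x)⁻¹).mulVec
        (fun i => gradient φ x i) ⬝ᵥ fun i => gradient φ x i :=
      ((cV.smul h1).matrix_mulVec h2).dotProduct h2
    exact continuous_const.mul ((h3.mul cρ').sub
      (continuous_const.mul (((cφ.sub continuous_const).pow 2).mul cρ')))
  -- derivative formulas
  have hdV : ∀ y, HasFDerivAt V (fderiv ℝ V y) y := fun y =>
    (hV.differentiable (by norm_num) y).hasFDerivAt
  have hpow : ∀ (γ : ℝ) y w, fderiv ℝ (fun x => V x ^ γ) y w = γ * V y ^ (γ - 1) * fderiv ℝ V y w :=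
    fun γ y w => by
      rw [((hdV y).rpow_const (Or.inl (hne y))).fderiv]; simp
  have hD1 : ContDiff ℝ 1 fun y => fderiv ℝ V y v :=
    (hV.fderiv_right (m := 1) (by norm_num)).clm_apply contDiff_const
  have hsec : fderiv ℝ (fun y => fderiv ℝ (fun x => V x ^ (-β)) y v) x v =
      -β * ((-β - 1) * V x ^ (-β - 1 - 1) * fderiv ℝ V x v * fderiv ℝ V x v
        + V x ^ (-β - 1) * fderiv ℝ (fderiv ℝ V) x v v) := by
    simp_rw [hpow]
    have e1 : HasFDerivAt (fun x => V x ^ (-β - 1)) (fderiv ℝ (fun x => V x ^ (-β - 1)) x) x :=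
      ((cρ _).differentiable (by norm_num) x).hasFDerivAt
    have e2 := (hD1.differentiable (by norm_num) x).hasFDerivAt
    rw [((e1.const_mul (-β)).fun_mul e2).fderiv]
    simp only [_root_.add_apply, _root_.smul_apply, smul_eq_mul, hpow, wp_fderiv_fderiv hV]
    ring
  have hfst : fderiv ℝ (fun x => (φ x - c) * V x ^ (-β)) x v =
      fderiv ℝ φ x v * V x ^ (-β) + (φ x - c) * (-β * V x ^ (-β - 1) * fderiv ℝ V x v) := by
    have e1 : HasFDerivAt (fun x => V x ^ (-β)) (fderiv ℝ (fun x => V x ^ (-β)) x) x :=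
      ((cρ _).differentiable (by norm_num) x).hasFDerivAt
    have e2 := ((hφ.differentiable (by norm_num) x).hasFDerivAt).sub_const c
    rw [(e2.fun_mul e1).fderiv]
    simp only [_root_.add_apply, _root_.smul_apply, smul_eq_mul, hpow]
    ring
  rw [hfst, hsec, hpow]
  have hx := hVpos x
  have r1 : V x ^ (-β - 1) = V x ^ (-β) / V x := by rw [rpow_sub_one hx.ne']
  have r2 : V x ^ (-β - 1 - 1) = V x ^ (-β) / V x / V x := by
    rw [rpow_sub_one hx.ne', rpow_sub_one hx.ne']
  rw [r2, r1]
  have hρ : 0 < V x ^ (-β) := rpow_pos_of_pos hx _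
  -- matrix inequalities
  obtain ⟨s, hs⟩ : ∃ s, s = √(β + 1) := ⟨_, rfl⟩
  obtain ⟨u, hu⟩ : ∃ u, u = √CV := ⟨_, rfl⟩
  have hss : s ^ 2 = β + 1 := by rw [hs]; exact sq_sqrt (by linarith)
  have huu : u ^ 2 = CV := by rw [hu]; exact sq_sqrt hCV0.le
  have hu0 : 0 < u := by rw [hu]; exact sqrt_pos.2 hCV0
  have hus : u < s := by rw [hu, hs]; exact sqrt_lt_sqrt hCV0.le hCVβ
  have hs0 : 0 < s := hu0.trans hus
  have hsu : 0 < s - u := by linarith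
  have hpsd : ∀ w : Fin d → ℝ, 0 ≤ w ⬝ᵥ hessianMatrix V x *ᵥ w := fun w => by
    have := wp_hessian_apply V x (WithLp.toLp 2 w)
    have h2 := wp_hessian_nonneg hV hVconv x (WithLp.toLp 2 w)
    rw [← this] at h2
    exact h2
  have hp0 : 0 < β / (β + 1) * ((s - u) / s) := by positivity
  have hq0 : 0 < β / (β + 1) * (u / s) := by positivity
  have m1 := wp_matrix (wp_hessian_symm hV x) (hVinv x) hpsd (fun i => v i)
    (fun i => gradient φ x i) (a := V x) hp0
  have m2 := wp_matrix (wp_hessian_symm hV x) (hVinv x) hpsd (fun i => v i)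
    (fun i => gradient V x i) (a := φ x - c) hq0
  rw [wp_gradient_apply, wp_hessian_apply] at m1 m2
  have hS : (V x • (hessianMatrix V x)⁻¹).mulVec (fun i => gradient φ x i) ⬝ᵥ
      (fun i => gradient φ x i) = V x * ((fun i => gradient φ x i) ⬝ᵥ
        (hessianMatrix V x)⁻¹ *ᵥ (fun i => gradient φ x i)) := by
    rw [smul_mulVec, smul_dotProduct, dotProduct_comm, smul_eq_mul]
  have m3 := (div_le_iff₀ hx).1 (hCV x)
  beta_reduce
  rw [hS, ← hs, ← hu]
  generalize (fun i => gradient φ x i) ⬝ᵥ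
        (hessianMatrix V x)⁻¹ *ᵥ (fun i => gradient φ x i) = Qφ at *
  generalize (fun i => gradient V x i) ⬝ᵥ
        (hessianMatrix V x)⁻¹ *ᵥ (fun i => gradient V x i) = QV at *
  generalize fderiv ℝ (fderiv ℝ V) x v v = Vvv at *
  generalize fderiv ℝ V x v = Vv at *
  generalize fderiv ℝ φ x v = φv at *
  generalize V x ^ (-β) = ρ at *
  generalize φ x - c = ψ at *
  generalize V x = W at *
  have m4 : ψ ^ 2 / (β / (β + 1) * (u / s)) * QV ≤ ψ ^ 2 / (β / (β + 1) * (u / s)) * (CV * W) :=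
    mul_le_mul_of_nonneg_left m3 (by positivity)
  have m5 : 2 * (W * φv) + 2 * (ψ * Vv) - β / (β + 1) * Vvv ≤
      W ^ 2 / (β / (β + 1) * ((s - u) / s)) * Qφ + ψ ^ 2 / (β / (β + 1) * (u / s)) * (CV * W) := by
    have : β / (β + 1) * Vvv = β / (β + 1) * ((s - u) / s) * Vvv + β / (β + 1) * (u / s) * Vvv := by
      field_simp; ring
    linarith
  have e1 : 2 * (φv * ρ + ψ * (-β * (ρ / W) * Vv)) +
      -β * ((-β - 1) * (ρ / W / W) * Vv * Vv + ρ / W * Vvv) / (β + 1) -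
      ((β + 1) * (ψ * ρ) + -β * (ρ / W) * Vv) ^ 2 / (β * ρ)
      = ρ / W * (2 * (W * φv) + 2 * (ψ * Vv) - β / (β + 1) * Vvv) - (β + 1) ^ 2 / β * ψ ^ 2 * ρ := by
    field_simp; ring
  have e2 : (β + 1) * s / (β * (s - u)) * (W * Qφ * ρ - (s - u) ^ 2 * (ψ ^ 2 * ρ))
      = ρ / W * (W ^ 2 / (β / (β + 1) * ((s - u) / s)) * Qφ
        + ψ ^ 2 / (β / (β + 1) * (u / s)) * (CV * W)) - (β + 1) ^ 2 / β * ψ ^ 2 * ρ := by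
    rw [← huu, ← hss]; field_simp; ring
  rw [e1, e2]
  have := mul_le_mul_of_nonneg_left m5 (show 0 ≤ ρ / W by positivity)
  linarith

lemma wp_box {d : ℕ} {β : ℝ} (hd : (d : ℝ) < β)
    {V : EuclideanSpace ℝ (Fin d) → ℝ}
    (hV : ContDiff ℝ 2 V) (hVpos : ∀ x, 0 < V x)
    (hVconv : ConvexOn ℝ Set.univ V)
    (hVinv : ∀ x, IsUnit (hessianMatrix V x))
    {CV : ℝ} (hCV0 : 0 < CV) (hCVβ : CV < β + 1)
    (hCV : ∀ x,
      ((fun i => gradient V x i) ⬝ᵥ (hessianMatrix V x)⁻¹.mulVec fun i => gradient V x i)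
        / V x ≤ CV)
    {φ : EuclideanSpace ℝ (Fin d) → ℝ} (hφ : ContDiff ℝ 1 φ)
    (S : EuclideanSpace ℝ (Fin d) → ℝ)
    (hS : S = fun x => ((V x • (hessianMatrix V x)⁻¹).mulVec (fun i => gradient φ x i) ⬝ᵥ
        fun i => gradient φ x i) * V x ^ (-β)) {a b : ℝ} (hab : a < b) :
    (√(β + 1) - √CV) ^ 2 *
      ((∫ x, φ (WithLp.toLp 2 x) ^ 2 * V (WithLp.toLp 2 x) ^ (-β) ∂(wpCube d a b)) *
        (∫ x, V (WithLp.toLp 2 x) ^ (-β) ∂(wpCube d a b))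
        - (∫ x, φ (WithLp.toLp 2 x) * V (WithLp.toLp 2 x) ^ (-β) ∂(wpCube d a b)) ^ 2) ≤
      (∫ x, S (WithLp.toLp 2 x) ∂(wpCube d a b)) *
        ∫ x, V (WithLp.toLp 2 x) ^ (-β) ∂(wpCube d a b) := by
  have hβ : 0 < β := lt_of_le_of_lt (Nat.cast_nonneg d) hd
  have hne : ∀ x, V x ≠ 0 := fun x => (hVpos x).ne'
  let L : (Fin d → ℝ) →L[ℝ] EuclideanSpace ℝ (Fin d) :=
    ((EuclideanSpace.equiv (Fin d) ℝ).symm : (Fin d → ℝ) →L[ℝ] EuclideanSpace ℝ (Fin d))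
  have hL : ∀ x, L x = WithLp.toLp 2 x := fun x => rfl
  simp_rw [← hL]
  have cL : Continuous L := L.continuous
  have cρ : Continuous fun x => V (L x) ^ (-β) :=
    (hV.rpow_const_of_ne (p := -β) hne).continuous.comp cL
  have cφ : Continuous fun x => φ (L x) := hφ.continuous.comp cL
  have cS : Continuous fun x => S (L x) := by
    have h1 := wp_hessian_inv_cont hV hVinv
    have h2 := wp_gradient_cont hφ
    have h3 : Continuous fun x => (V x • (hessianMatrix V x)⁻¹).mulVec
        (fun i => gradient φ x i) ⬝ᵥ fun i => gradient φ x i :=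
      ((hV.continuous.smul h1).matrix_mulVec h2).dotProduct h2
    rw [hS]
    exact (h3.comp cL).mul cρ
  have iρ := wpCube_integrable d a b cρ
  have iφ : Integrable (fun x => φ (L x) * V (L x) ^ (-β)) (wpCube d a b) :=
    wpCube_integrable d a b (cφ.mul cρ)
  have iφ2 : Integrable (fun x => φ (L x) ^ 2 * V (L x) ^ (-β)) (wpCube d a b) :=
    wpCube_integrable d a b ((cφ.pow 2).mul cρ)
  have iS := wpCube_integrable d a b cS
  obtain ⟨A, hA⟩ : ∃ A, A = ∫ x, V (L x) ^ (-β) ∂(wpCube d a b) := ⟨_, rfl⟩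
  obtain ⟨B, hB⟩ : ∃ B, B = ∫ x, φ (L x) * V (L x) ^ (-β) ∂(wpCube d a b) := ⟨_, rfl⟩
  obtain ⟨D, hD⟩ : ∃ D, D = ∫ x, φ (L x) ^ 2 * V (L x) ^ (-β) ∂(wpCube d a b) := ⟨_, rfl⟩
  obtain ⟨T, hT⟩ : ∃ T, T = ∫ x, S (L x) ∂(wpCube d a b) := ⟨_, rfl⟩
  rw [← hA, ← hB, ← hD, ← hT]
  have hApos : 0 < A := by
    rw [hA, integral_pos_iff_support_of_nonneg (fun x => (rpow_pos_of_pos (hVpos _) _).le) iρ]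
    have : (Function.support fun x => V (L x) ^ (-β)) = Set.univ := by
      ext x; simp [(rpow_pos_of_pos (hVpos (L x)) (-β)).ne']
    rw [this, wpCube, Measure.pi_univ]
    exact pos_iff_ne_zero.2 (Finset.prod_ne_zero_iff.2 fun i _ => by simp [hab])
  have H := (wp_local hβ hV hVpos hVconv hVinv hCV0 hCVβ hCV hφ (B / A)).comp L
  have h0 : ∫ x, (φ (L x) - B / A) * V (L x) ^ (-β) ∂(wpCube d a b) = 0 := by
    have : (fun x => (φ (L x) - B / A) * V (L x) ^ (-β)) =
        fun x => φ (L x) * V (L x) ^ (-β) - B / A * V (L x) ^ (-β) := by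
      funext x; ring
    rw [this, integral_sub iφ (iρ.const_mul _), integral_const_mul, ← hA, ← hB]
    field_simp; ring
  have hmain := WPCond.main d hab hd H h0
  rw [integral_const_mul] at hmain
  have hus : 0 < √(β + 1) - √CV := sub_pos.2 (sqrt_lt_sqrt hCV0.le hCVβ)
  have hk : 0 < (β + 1) * √(β + 1) / (β * (√(β + 1) - √CV)) := by
    have : 0 < √(β + 1) := sqrt_pos.2 (by linarith)
    positivity
  have hmain' := nonneg_of_mul_nonneg_right hmain hk
  have e : ∀ x, ((V (L x) • (hessianMatrix V (L x))⁻¹).mulVec (fun i => gradient φ (L x) i) ⬝ᵥ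
        fun i => gradient φ (L x) i) * V (L x) ^ (-β) -
          (√(β + 1) - √CV) ^ 2 * ((φ (L x) - B / A) ^ 2 * V (L x) ^ (-β)) =
        S (L x) - (√(β + 1) - √CV) ^ 2 * (φ (L x) ^ 2 * V (L x) ^ (-β)
          - 2 * (B / A) * (φ (L x) * V (L x) ^ (-β)) + (B / A) ^ 2 * V (L x) ^ (-β)) := fun x => by
    rw [hS]; ring
  simp_rw [e] at hmain'
  have i1 : Integrable (fun x => φ (L x) ^ 2 * V (L x) ^ (-β)
      - 2 * (B / A) * (φ (L x) * V (L x) ^ (-β))) (wpCube d a b) := iφ2.sub (iφ.const_mul _)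
  have i2 : Integrable (fun x => φ (L x) ^ 2 * V (L x) ^ (-β)
      - 2 * (B / A) * (φ (L x) * V (L x) ^ (-β)) + (B / A) ^ 2 * V (L x) ^ (-β))
      (wpCube d a b) := i1.add (iρ.const_mul _)
  rw [integral_sub iS (i2.const_mul _),
    integral_const_mul, integral_add i1 (iρ.const_mul _),
    integral_sub iφ2 (iφ.const_mul _), integral_const_mul, integral_const_mul,
    ← hA, ← hB, ← hD, ← hT] at hmain'
  have := mul_nonneg hmain' hApos.le
  have e2 : (T - (√(β + 1) - √CV) ^ 2 * (D - 2 * (B / A) * B + (B / A) ^ 2 * A)) * A =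
      T * A - (√(β + 1) - √CV) ^ 2 * (D * A - B ^ 2) := by
    field_simp; ring
  linarith

lemma wp_limit {d : ℕ} {f : EuclideanSpace ℝ (Fin d) → ℝ} (hf : Integrable f) :
    Filter.Tendsto (fun N : ℕ => ∫ x, f (WithLp.toLp 2 x) ∂(wpCube d (-(N + 1 : ℝ)) (N + 1)))
      Filter.atTop (nhds (∫ x, f x)) := by
  have hm := (EuclideanSpace.volume_preserving_symm_measurableEquiv_toLp (Fin d)).symm
  have hi : Integrable (fun x : Fin d → ℝ => f (WithLp.toLp 2 x)) := by
    have := (hm.integrable_comp_emb (MeasurableEquiv.measurableEmbedding _)).2 hf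
    exact this
  have he : ∫ x, f x = ∫ x : Fin d → ℝ, f (WithLp.toLp 2 x) :=
    (hm.integral_comp' f).symm
  rw [he]
  simp_rw [wpCube_eq]
  have hU : (⋃ N : ℕ, Set.univ.pi fun _ : Fin d => Set.Ioc (-(N + 1 : ℝ)) (N + 1)) = Set.univ := by
    refine Set.eq_univ_of_forall fun x => ?_
    obtain ⟨N, hN⟩ := exists_nat_ge ‖x‖
    refine Set.mem_iUnion.2 ⟨N, fun i _ => ?_⟩
    have h1 : |x i| ≤ N := (norm_le_pi_norm x i).trans hN
    have h2 := abs_le.1 h1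
    exact ⟨by linarith, by linarith⟩
  have := tendsto_setIntegral_of_monotone (μ := (volume : Measure (Fin d → ℝ)))
    (s := fun N : ℕ => Set.univ.pi fun _ : Fin d => Set.Ioc (-(N + 1 : ℝ)) (N + 1))
    (f := fun x : Fin d → ℝ => f (WithLp.toLp 2 x))
    (fun N => MeasurableSet.univ_pi fun _ => measurableSet_Ioc)
    (fun M N h => by
      have h' : (M : ℝ) ≤ N := by exact_mod_cast h
      exact Set.pi_mono fun _ _ => Set.Ioc_subset_Ioc (by linarith) (by linarith))
    hi.integrableOn
  rw [hU, Measure.restrict_univ] at this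
  exact this

/-- Corollary: if moreover `⟨(∇²V)⁻¹ ∇V, ∇V⟩/V ≤ C_V` with `C_V ∈ (0, β+1)`, then
`Var_{π_β}(φ) ≤ (√(β+1) − √C_V)⁻² ∫ ⟨V (∇²V)⁻¹ ∇φ, ∇φ⟩ dπ_β`. -/
theorem weighted_poincare_corollary
    (d : ℕ) (hd : 1 ≤ d) (β : ℝ) (hβ : (d : ℝ) < β)
    (V : EuclideanSpace ℝ (Fin d) → ℝ)
    (hV : ContDiff ℝ 2 V) (hVpos : ∀ x, 0 < V x)
    (hVconv : ConvexOn ℝ Set.univ V)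
    (hVinv : ∀ x, IsUnit (hessianMatrix V x))
    (Zβ : ℝ) (hZβ : Zβ = ∫ x, V x ^ (-β))
    (hZint : Integrable fun x : EuclideanSpace ℝ (Fin d) => V x ^ (-β))
    (πβ : EuclideanSpace ℝ (Fin d) → ℝ)
    (hπβ : ∀ x, πβ x = Zβ⁻¹ * V x ^ (-β))
    (CV : ℝ) (hCV0 : 0 < CV) (hCVβ : CV < β + 1)
    (hCV : ∀ x,
      ((fun i => gradient V x i) ⬝ᵥ (hessianMatrix V x)⁻¹.mulVec fun i => gradient V x i)
        / V x ≤ CV)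
    (φ : EuclideanSpace ℝ (Fin d) → ℝ) (hφ : ContDiff ℝ (⊤ : ℕ∞) φ)
    (hφ2 : Integrable fun x => φ x ^ 2 * πβ x)
    (hφ1 : Integrable fun x => φ x * πβ x)
    (hRHS : Integrable fun x =>
      ((V x • (hessianMatrix V x)⁻¹).mulVec (fun i => gradient φ x i) ⬝ᵥ
        fun i => gradient φ x i) * πβ x) :
    (∫ x, φ x ^ 2 * πβ x) - (∫ x, φ x * πβ x) ^ 2 ≤
      ((Real.sqrt (β + 1) - Real.sqrt CV)⁻¹) ^ 2 *
        ∫ x, ((V x • (hessianMatrix V x)⁻¹).mulVec (fun i => gradient φ x i) ⬝ᵥ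
          fun i => gradient φ x i) * πβ x := by
  have hβ0 : 0 < β := lt_of_le_of_lt (Nat.cast_nonneg d) hβ
  have hZ : 0 < Zβ := by
    rw [hZβ, integral_pos_iff_support_of_nonneg (fun x => (rpow_pos_of_pos (hVpos _) _).le) hZint]
    have : (Function.support fun x => V x ^ (-β)) = Set.univ := by
      ext x; simp [(rpow_pos_of_pos (hVpos x) (-β)).ne']
    rw [this]
    exact isOpen_univ.measure_pos volume Set.univ_nonempty
  obtain ⟨S, hS⟩ : ∃ S : EuclideanSpace ℝ (Fin d) → ℝ, S = fun x =>
      ((V x • (hessianMatrix V x)⁻¹).mulVec (fun i => gradient φ x i) ⬝ᵥ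
        fun i => gradient φ x i) * V x ^ (-β) := ⟨_, rfl⟩
  have e2 : (fun x => φ x ^ 2 * πβ x) = fun x => Zβ⁻¹ * (φ x ^ 2 * V x ^ (-β)) := by
    funext x; rw [hπβ]; ring
  have e1 : (fun x => φ x * πβ x) = fun x => Zβ⁻¹ * (φ x * V x ^ (-β)) := by
    funext x; rw [hπβ]; ring
  have eS : (fun x => ((V x • (hessianMatrix V x)⁻¹).mulVec (fun i => gradient φ x i) ⬝ᵥ
        fun i => gradient φ x i) * πβ x) = fun x => Zβ⁻¹ * S x := by
    funext x; rw [hπβ, hS]; ring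
  have hu : IsUnit Zβ⁻¹ := (inv_ne_zero hZ.ne').isUnit
  rw [e2, integrable_const_mul_iff hu] at hφ2
  rw [e1, integrable_const_mul_iff hu] at hφ1
  rw [eS, integrable_const_mul_iff hu] at hRHS
  rw [e2, e1, eS, integral_const_mul, integral_const_mul, integral_const_mul]
  have lA := wp_limit hZint
  have lB := wp_limit hφ1
  have lD := wp_limit hφ2
  have lT := wp_limit hRHS
  have hlim := le_of_tendsto_of_tendsto'
    (((lD.mul lA).sub (lB.pow 2)).const_mul ((√(β + 1) - √CV) ^ 2)) (lT.mul lA)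
    (fun N => wp_box hβ hV hVpos hVconv hVinv hCV0 hCVβ hCV
      (hφ.of_le (by exact_mod_cast le_top)) S hS (by
        have : (0 : ℝ) ≤ N := Nat.cast_nonneg N
        linarith))
  rw [← hZβ] at hlim
  have hus : 0 < √(β + 1) - √CV := sub_pos.2 (sqrt_lt_sqrt hCV0.le hCVβ)
  generalize √(β + 1) - √CV = k at *
  generalize (∫ x, φ x ^ 2 * V x ^ (-β)) = D at *
  generalize (∫ x, φ x * V x ^ (-β)) = B at *
  generalize (∫ x, S x) = T at *
  have f1 : Zβ⁻¹ * D - (Zβ⁻¹ * B) ^ 2 = (k ^ 2 * (D * Zβ - B ^ 2)) / (k ^ 2 * Zβ ^ 2) := by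
    field_simp
  have f2 : k⁻¹ ^ 2 * (Zβ⁻¹ * T) = (T * Zβ) / (k ^ 2 * Zβ ^ 2) := by
    field_simp
  rw [f1, f2]
  exact div_le_div_of_nonneg_right hlim (by positivity)
end

section
/- Let d ≥ 1 be an integer and β > d. Let V : ℝ^d → (0,∞) be twice continuously differentiable, α-strongly convex (∇²V(x) ⪰ α I_d for all x, with α > 0), and satisfy |∇V(x)|² ≤ α C_V V(x) for all x ∈ ℝ^d, for some constant C_V ∈ (0, β+1); assume Z_β := ∫ V^{-β} dx < ∞. Then for every smooth, π_β-square-integrable function φ on ℝ^d: Var_{π_β}(φ) ≤ α^{-1} (√(β+1) − √(C_V))^{-2} ∫_{ℝ^d} V(x) |∇φ(x)|² π_β(x) dx. -/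
open MeasureTheory Real Matrix

section Helpers
open Filter Topology Set

lemma bbl_cdf (p : ℝ → ℝ) (hc : Continuous p) (hp : ∀ x, 0 < p x) (hi : Integrable p) :
    (∀ x, HasDerivAt (fun x => ∫ t in Iic x, p t) (p x) x) ∧
    StrictMono (fun x => ∫ t in Iic x, p t) ∧
    (∀ x, (∫ t in Iic x, p t) ∈ Ioo 0 (∫ t, p t)) ∧
    (∀ y ∈ Ioo 0 (∫ t, p t), ∃ x, (∫ t in Iic x, p t) = y) := by
  have hd : ∀ x, HasDerivAt (fun x => ∫ t in Iic x, p t) (p x) x := by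
    intro x
    have h1 : (fun x => ∫ t in Iic x, p t) =
        fun x => (∫ t in Iic (0:ℝ), p t) + ∫ t in (0:ℝ)..x, p t := by
      funext y
      rw [← intervalIntegral.integral_Iic_sub_Iic hi.integrableOn hi.integrableOn]
      ring
    rw [h1]
    exact (intervalIntegral.integral_hasDerivAt_right (hc.intervalIntegrable _ _)
      (hc.stronglyMeasurableAtFilter _ _) hc.continuousAt).const_add _
  have hm : StrictMono (fun x => ∫ t in Iic x, p t) :=
    strictMono_of_hasDerivAt_pos hd hp
  have hbot : Tendsto (fun x => ∫ t in Iic x, p t) atBot (𝓝 0) :=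
    tendsto_integral_Iic_zero tendsto_id
  have htop : Tendsto (fun x => ∫ t in Iic x, p t) atTop (𝓝 (∫ t, p t)) :=
    (aecover_Iic tendsto_id).integral_tendsto_of_countably_generated hi
  have hcont : Continuous (fun x => ∫ t in Iic x, p t) :=
    continuous_iff_continuousAt.2 fun x => (hd x).continuousAt
  refine ⟨hd, hm, fun x => ⟨?_, ?_⟩, ?_⟩
  · have := hm.monotone.le_of_tendsto hbot (x - 1)
    exact this.trans_lt (hm (by linarith))
  · have := hm.monotone.ge_of_tendsto htop (x + 1)
    exact lt_of_lt_of_le (hm (show x < x + 1 by linarith)) this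
  · intro y hy
    obtain ⟨a, ha⟩ := (hbot.eventually (gt_mem_nhds hy.1)).exists
    obtain ⟨b, hb⟩ := (htop.eventually (lt_mem_nhds hy.2)).exists
    exact mem_range_of_exists_le_of_exists_ge hcont ⟨a, ha.le⟩ ⟨b, hb.le⟩

lemma bbl_transport (p q : ℝ → ℝ) (hpc : Continuous p) (hp : ∀ x, 0 < p x) (hpi : Integrable p)
    (hqc : Continuous q) (hq : ∀ x, 0 < q x) (hqi : Integrable q) :
    ∃ T : ℝ → ℝ, ∀ x, HasDerivAt T ((∫ t, q t) / (∫ t, p t) * (p x / q (T x))) x := by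
  obtain ⟨hpd, hpm, hpr, -⟩ := bbl_cdf p hpc hp hpi
  obtain ⟨hqd, hqm, hqr, hqs⟩ := bbl_cdf q hqc hq hqi
  set A := ∫ t, p t with hA
  set B := ∫ t, q t with hB
  have hA0 : 0 < A := (hpr 0).1.trans (hpr 0).2
  have hB0 : 0 < B := (hqr 0).1.trans (hqr 0).2
  set Φ := fun x => ∫ t in Iic x, p t
  set Ψ := fun x => ∫ t in Iic x, q t
  choose! g hg using hqs
  have hgm : StrictMonoOn g (Ioo 0 B) := by
    intro a ha b hb hab
    by_contra hcon
    have := hqm.monotone (not_lt.1 hcon)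
    have h1 : Ψ (g a) = a := hg a ha
    have h2 : Ψ (g b) = b := hg b hb
    linarith
  have him : g '' (Ioo 0 B) = univ := by
    ext x
    simp only [mem_univ, iff_true]
    exact ⟨Ψ x, hqr x, hqm.injective (hg _ (hqr x))⟩
  have hgc : ∀ a ∈ Ioo 0 B, HasDerivAt g (q (g a))⁻¹ a := by
    intro a ha
    have hn : Ioo 0 B ∈ 𝓝 a := isOpen_Ioo.mem_nhds ha
    have hc : ContinuousAt g a :=
      continuousAt_of_monotoneOn_of_image_mem_nhds hgm.monotoneOn hn (by rw [him]; exact univ_mem)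
    exact HasDerivAt.of_local_left_inverse hc (hqd (g a)) (hq _).ne'
      (by filter_upwards [hn] with y hy using hg y hy)
  refine ⟨fun x => g (B / A * Φ x), fun x => ?_⟩
  have hmem : B / A * Φ x ∈ Ioo 0 B := by
    have := hpr x
    refine ⟨mul_pos (div_pos hB0 hA0) this.1, ?_⟩
    calc B / A * Φ x < B / A * A := by
          have := this.2
          gcongr
      _ = B := by field_simp
  have := (hgc _ hmem).comp x ((hpd x).const_mul (B / A))
  refine this.congr_deriv ?_
  ring

lemma bbl_hoelder {a b p q γ : ℝ} (ha : 0 < a) (hb : 0 < b) (hp : 0 < p) (hq : 0 < q)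
    (hγ : 1 < γ) :
    ((a + b) / 2) ^ γ * ((p + q) / 2) ^ (1 - γ) ≤
      (a ^ γ * p ^ (1 - γ) + b ^ γ * q ^ (1 - γ)) / 2 := by
  have m1 : a / p ∈ Ici (0:ℝ) := mem_Ici.2 (by positivity)
  have m2 : b / q ∈ Ici (0:ℝ) := mem_Ici.2 (by positivity)
  have n1 : 0 ≤ p / (p + q) := by positivity
  have n2 : 0 ≤ q / (p + q) := by positivity
  have n3 : p / (p + q) + q / (p + q) = 1 := by field_simp
  have h := (convexOn_rpow hγ.le).2 m1 m2 n1 n2 n3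
  simp only [smul_eq_mul] at h
  have e1 : p / (p + q) * (a / p) + q / (p + q) * (b / q) = ((a + b) / 2) / ((p + q) / 2) := by
    field_simp
  rw [e1, div_rpow (by positivity) (by positivity), div_rpow ha.le hp.le, div_rpow hb.le hq.le] at h
  rw [rpow_sub hp, rpow_sub hq, rpow_sub (by positivity), rpow_one, rpow_one, rpow_one]
  have := mul_le_mul_of_nonneg_left h (show 0 ≤ (p + q) / 2 by positivity)
  calc _ = (p + q) / 2 * (((a + b) / 2) ^ γ / ((p + q) / 2) ^ γ) := by ring
    _ ≤ _ := this
    _ = _ := by field_simp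

lemma bbl_one (γ : ℝ) (hγ : 1 < γ) (f g w : ℝ → ℝ)
    (hfc : Continuous f) (hf : ∀ x, 0 < f x) (hfi : Integrable fun x => f x ^ (-γ))
    (hgc : Continuous g) (hg : ∀ x, 0 < g x) (hgi : Integrable fun x => g x ^ (-γ))
    (hw : ∀ x, 0 < w x) (hwi : Integrable fun x => w x ^ (-γ))
    (hmid : ∀ x y, w ((1 / 2 : ℝ) • (x + y)) ≤ (f x + g y) / 2) :
    (∫ x, w x ^ (-γ)) ^ (-(1 / (γ - 1))) ≤
      ((∫ x, f x ^ (-γ)) ^ (-(1 / (γ - 1))) + (∫ x, g x ^ (-γ)) ^ (-(1 / (γ - 1)))) / 2 := by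
  have hpc : Continuous fun x => f x ^ (-γ) := hfc.rpow_const fun x => Or.inl (hf x).ne'
  have hqc : Continuous fun x => g x ^ (-γ) := hgc.rpow_const fun x => Or.inl (hg x).ne'
  have hp : ∀ x, 0 < f x ^ (-γ) := fun x => rpow_pos_of_pos (hf x) _
  have hq : ∀ x, 0 < g x ^ (-γ) := fun x => rpow_pos_of_pos (hg x) _
  obtain ⟨T, hT⟩ := bbl_transport _ _ hpc hp hfi hqc hq hgi
  have hA0 : 0 < ∫ x, f x ^ (-γ) := by
    have := (bbl_cdf _ hpc hp hfi).2.2.1 0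
    exact this.1.trans this.2
  have hB0 : 0 < ∫ x, g x ^ (-γ) := by
    have := (bbl_cdf _ hqc hq hgi).2.2.1 0
    exact this.1.trans this.2
  set A := ∫ x, f x ^ (-γ) with hA
  set B := ∫ x, g x ^ (-γ) with hB
  have hγ1 : 0 < γ - 1 := by linarith
  set P := A ^ (-(1 / (γ - 1))) with hP
  set Q := B ^ (-(1 / (γ - 1))) with hQ
  have hP0 : 0 < P := rpow_pos_of_pos hA0 _
  have hQ0 : 0 < Q := rpow_pos_of_pos hB0 _
  have hAP : P ^ (1 - γ) = A := by
    rw [hP, ← rpow_mul hA0.le]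
    convert rpow_one A using 2
    field_simp
    ring
  have hBQ : Q ^ (1 - γ) = B := by
    rw [hQ, ← rpow_mul hB0.le]
    convert rpow_one B using 2
    field_simp
    ring
  set T' := fun x => B / A * (f x ^ (-γ) / g (T x) ^ (-γ)) with hT'
  have hT'0 : ∀ x, 0 < T' x := fun x => by
    have := hp x; have := hq (T x); simp only [hT']; positivity
  set z := fun x => (1 / 2 : ℝ) • (x + T x) with hz
  have hzd : ∀ x, HasDerivAt z ((1 + T' x) / 2) x := fun x => by
    refine (((hasDerivAt_id x).add (hT x)).const_mul (1 / 2 : ℝ)).congr_deriv ?_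
    simp only [hT']; ring
  have hzm : StrictMono z := strictMono_of_hasDerivAt_pos hzd
    (fun x => by have := hT'0 x; positivity)
  have hM : ∀ x, ((P + Q) / 2) ^ (1 - γ) / A * f x ^ (-γ) ≤
      |(1 + T' x) / 2| • (w (z x) ^ (-γ)) := by
    intro x
    have hx := hT'0 x
    rw [abs_of_pos (by positivity), smul_eq_mul]
    have h1 : ((f x + g (T x)) / 2) ^ (-γ) ≤ w (z x) ^ (-γ) :=
      rpow_le_rpow_of_nonpos (hw _) (hmid _ _) (by linarith)
    refine le_trans ?_ (mul_le_mul_of_nonneg_left h1 (by positivity))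
    have h2 := bbl_hoelder (hf x) (hg (T x)) hP0 hQ0 hγ
    rw [hAP, hBQ] at h2
    have ha := hf x
    have hb := hg (T x)
    simp only [hT']
    rw [rpow_neg ha.le, rpow_neg hb.le, rpow_neg (by positivity)]
    have e1 : 0 < f x ^ γ := rpow_pos_of_pos ha _
    have e2 : 0 < g (T x) ^ γ := rpow_pos_of_pos hb _
    have e3 : 0 < ((f x + g (T x)) / 2) ^ γ := rpow_pos_of_pos (by positivity) _
    calc _ = (((f x + g (T x)) / 2) ^ γ * ((P + Q) / 2) ^ (1 - γ)) *
          (A⁻¹ * (f x ^ γ)⁻¹ * (((f x + g (T x)) / 2) ^ γ)⁻¹) := by field_simp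
      _ ≤ _ := mul_le_mul_of_nonneg_right h2 (by positivity)
      _ = _ := by field_simp
  have hwi' : IntegrableOn (fun x => w x ^ (-γ)) (z '' univ) := hwi.integrableOn
  rw [integrableOn_image_iff_integrableOn_abs_deriv_smul MeasurableSet.univ
    (fun x _ => (hzd x).hasDerivWithinAt) hzm.injective.injOn, integrableOn_univ] at hwi'
  have hI : ((P + Q) / 2) ^ (1 - γ) ≤ ∫ x, w x ^ (-γ) := by
    calc _ = ∫ x, ((P + Q) / 2) ^ (1 - γ) / A * f x ^ (-γ) := by
          rw [integral_const_mul, ← hA]; field_simp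
      _ ≤ ∫ x, |(1 + T' x) / 2| • (w (z x) ^ (-γ)) :=
          integral_mono (hfi.const_mul _) hwi' hM
      _ = ∫ x in z '' univ, w x ^ (-γ) := by
          rw [integral_image_eq_integral_abs_deriv_smul MeasurableSet.univ
            (fun x _ => (hzd x).hasDerivWithinAt) hzm.injective.injOn, setIntegral_univ]
      _ ≤ _ := setIntegral_le_integral hwi
          (Eventually.of_forall fun x => (rpow_pos_of_pos (hw x) _).le)
  have hPQ : 0 < (P + Q) / 2 := by positivity
  calc _ ≤ (((P + Q) / 2) ^ (1 - γ)) ^ (-(1 / (γ - 1))) :=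
        rpow_le_rpow_of_nonpos (rpow_pos_of_pos hPQ _) hI (by
          have : 0 < 1 / (γ - 1) := by positivity
          linarith)
    _ = (P + Q) / 2 := by
        rw [← rpow_mul hPQ.le]
        convert rpow_one _ using 2
        field_simp
        ring

/-- continuous functions bounded below by a multiple of `1 + ‖x‖`. -/
def BblNice {E : Type*} [NormedAddCommGroup E] (f : E → ℝ) : Prop :=
  Continuous f ∧ ∃ c : ℝ, 0 < c ∧ ∀ x, c * (1 + ‖x‖) ≤ f x

lemma BblNice.pos {E : Type*} [NormedAddCommGroup E] {f : E → ℝ} (h : BblNice f) (x : E) :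
    0 < f x := by
  obtain ⟨-, c, hc, h⟩ := h
  exact lt_of_lt_of_le (by positivity) (h x)

lemma BblNice.cont_rpow {E : Type*} [NormedAddCommGroup E] {f : E → ℝ} (h : BblNice f) (r : ℝ) :
    Continuous fun x => f x ^ r :=
  h.1.rpow_const fun x => Or.inl (h.pos x).ne'

lemma BblNice.integrable {E : Type*} [NormedAddCommGroup E] [NormedSpace ℝ E]
    [FiniteDimensional ℝ E] [MeasureSpace E] [BorelSpace E]
    [(volume : Measure E).IsAddHaarMeasure] {f : E → ℝ} (h : BblNice f) {γ : ℝ}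
    (hγ : (Module.finrank ℝ E : ℝ) < γ) :
    Integrable (fun x => f x ^ (-γ)) := by
  obtain ⟨c, hc, hb⟩ := h.2
  have hγ0 : 0 < γ := lt_of_le_of_lt (by positivity) hγ
  refine ((integrable_one_add_norm (μ := volume) hγ).const_mul (c ^ (-γ))).mono'
    (h.cont_rpow _).aestronglyMeasurable (Eventually.of_forall fun x => ?_)
  rw [norm_of_nonneg (rpow_pos_of_pos (h.pos x) _).le, ← mul_rpow hc.le (by positivity)]
  exact rpow_le_rpow_of_nonpos (by positivity) (hb x) (by linarith)

lemma bbl_norm_cons_left {n : ℕ} (x : ℝ) (y : Fin n → ℝ) : ‖x‖ ≤ ‖vecCons x y‖ := by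
  simpa using norm_le_pi_norm (vecCons x y) 0

lemma bbl_norm_cons_right {n : ℕ} (x : ℝ) (y : Fin n → ℝ) : ‖y‖ ≤ ‖vecCons x y‖ := by
  rw [pi_norm_le_iff_of_nonneg (norm_nonneg _)]
  intro i
  simpa using norm_le_pi_norm (vecCons x y) i.succ

lemma BblNice.slice {n : ℕ} {f : (Fin (n + 1) → ℝ) → ℝ} (h : BblNice f) (y : Fin n → ℝ) :
    BblNice (fun x => f (vecCons x y)) := by
  obtain ⟨hc, c, hc0, hb⟩ := h
  refine ⟨by fun_prop, c, hc0, fun x => ?_⟩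
  refine le_trans ?_ (hb _)
  have := bbl_norm_cons_left x y
  gcongr

lemma BblNice.marginal {n : ℕ} {f : (Fin (n + 1) → ℝ) → ℝ} (h : BblNice f) {γ : ℝ}
    (hγ : 1 < γ) :
    BblNice (fun y => (∫ x, f (vecCons x y) ^ (-γ)) ^ (-(1 / (γ - 1)))) := by
  obtain ⟨c, hc, hb⟩ := h.2
  have hfin : (Module.finrank ℝ ℝ : ℝ) < γ := by simpa using hγ
  have hIntg : Integrable fun x : ℝ => (1 + ‖x‖) ^ (-γ) := integrable_one_add_norm hfin
  have hpos : ∀ y, 0 < ∫ x, f (vecCons x y) ^ (-γ) := fun y => by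
    have := (bbl_cdf _ ((h.slice y).cont_rpow (-γ)) (fun x => rpow_pos_of_pos (h.pos _) _)
      ((h.slice y).integrable hfin)).2.2.1 0
    exact this.1.trans this.2
  constructor
  · refine Continuous.rpow_const ?_ (fun y => Or.inl (hpos y).ne')
    refine continuous_of_dominated (bound := fun x : ℝ => c ^ (-γ) * (1 + ‖x‖) ^ (-γ)) ?_ ?_
      (hIntg.const_mul _) ?_
    · intro y
      exact ((h.slice y).cont_rpow _).aestronglyMeasurable
    · intro y
      refine Eventually.of_forall fun x => ?_
      rw [norm_of_nonneg (rpow_pos_of_pos (h.pos _) _).le, ← mul_rpow hc.le (by positivity)]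
      refine rpow_le_rpow_of_nonpos (by positivity) (le_trans ?_ (hb _)) (by linarith)
      have := bbl_norm_cons_left x y
      gcongr
    · refine Eventually.of_forall fun x => ?_
      have h1 := h.cont_rpow (-γ)
      have h2 : Continuous fun y : Fin n → ℝ => vecCons x y := by fun_prop
      exact h1.comp h2
  · set J := ∫ x : ℝ, (1 + ‖x‖) ^ (-γ) with hJ
    have hJ0 : 0 < J := by
      have := (bbl_cdf (fun x : ℝ => (1 + ‖x‖) ^ (-γ))
        (Continuous.rpow_const (by fun_prop) (fun x => Or.inl (by positivity)))
        (fun x => by positivity) hIntg).2.2.1 0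
      exact this.1.trans this.2
    have hγ1 : 0 < γ - 1 := by linarith
    refine ⟨((c / 2) ^ (-γ) * J) ^ (-(1 / (γ - 1))), by positivity, fun y => ?_⟩
    set R := 1 + ‖y‖ with hR
    have hR0 : 0 < R := by positivity
    have key : ∫ x, f (vecCons x y) ^ (-γ) ≤ (c / 2) ^ (-γ) * J * R ^ (1 - γ) := by
      have e1 : (c / 2) ^ (-γ) * J * R ^ (1 - γ) =
          ∫ x : ℝ, (c / 2) ^ (-γ) * R ^ (-γ) * (1 + ‖x / R‖) ^ (-γ) := by
        rw [integral_const_mul, Measure.integral_comp_div (fun u : ℝ => (1 + ‖u‖) ^ (-γ)) R,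
          ← hJ, abs_of_pos hR0, smul_eq_mul, sub_eq_add_neg, rpow_add hR0, rpow_one]
        ring
      rw [e1]
      refine integral_mono ((h.slice y).integrable hfin)
        ((hIntg.comp_div hR0.ne').const_mul _) fun x => ?_
      dsimp only
      rw [← mul_rpow (by positivity) (by positivity), ← mul_rpow (by positivity) (by positivity)]
      refine rpow_le_rpow_of_nonpos (by positivity) (le_trans ?_ (hb _)) (by linarith)
      have h1 := bbl_norm_cons_left x y
      have h2 := bbl_norm_cons_right x y
      have e2 : c / 2 * R * (1 + ‖x / R‖) = c * ((R + ‖x‖) / 2) := by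
        rw [norm_div, norm_of_nonneg hR0.le]; field_simp
      rw [e2]
      gcongr
      linarith
    calc _ = ((c / 2) ^ (-γ) * J * R ^ (1 - γ)) ^ (-(1 / (γ - 1))) := by
          rw [mul_rpow (y := R ^ (1 - γ)) (by positivity) (by positivity), ← rpow_mul hR0.le]
          congr 1
          symm
          convert rpow_one R using 2
          field_simp
          ring
      _ ≤ _ := rpow_le_rpow_of_nonpos (hpos y) key (by
          have : 0 < 1 / (γ - 1) := by positivity
          linarith)

lemma bbl_pi (n : ℕ) : ∀ (γ : ℝ), (n : ℝ) < γ → ∀ (f g w : (Fin n → ℝ) → ℝ),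
    BblNice f → BblNice g → BblNice w →
    (∀ x y, w ((1 / 2 : ℝ) • (x + y)) ≤ (f x + g y) / 2) →
    (∫ x, w x ^ (-γ)) ^ (-(1 / (γ - n))) ≤
      ((∫ x, f x ^ (-γ)) ^ (-(1 / (γ - n))) + (∫ x, g x ^ (-γ)) ^ (-(1 / (γ - n)))) / 2 := by
  induction n with
  | zero =>
    intro γ hγ f g w hf hg hw hmid
    have hγ0 : 0 < γ := by simpa using hγ
    have key : ∀ f : (Fin 0 → ℝ) → ℝ, BblNice f →
        (∫ x, f x ^ (-γ)) ^ (-(1 / (γ - (0 : ℕ)))) = f default := by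
      intro f hf
      rw [integral_unique]
      have h1 : (volume : Measure (Fin 0 → ℝ)).real univ = 1 := by
        rw [measureReal_def, volume_pi, Measure.pi_of_empty _ default]; simp
      rw [h1, one_smul, ← rpow_mul (hf.pos _).le]
      convert rpow_one _ using 2
      rw [Nat.cast_zero, sub_zero]
      field_simp
    rw [key f hf, key g hg, key w hw]
    convert hmid default default
  | succ n ih =>
    intro γ hγ f g w hf hg hw hmid
    push_cast at hγ
    have hn : (0:ℝ) ≤ n := by positivity
    have hγ1 : 1 < γ := by linarith
    have hfin : (Module.finrank ℝ ℝ : ℝ) < γ := by simpa using hγ1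
    have hfin' : (Module.finrank ℝ (Fin (n + 1) → ℝ) : ℝ) < γ := by simpa using hγ
    have := ih (γ - 1) (by linarith) _ _ _ (hf.marginal hγ1) (hg.marginal hγ1) (hw.marginal hγ1)
      (fun x y => by
        refine bbl_one γ hγ1 _ _ _ (hf.slice x).1 (hf.slice x).pos ((hf.slice x).integrable hfin)
          (hg.slice y).1 (hg.slice y).pos ((hg.slice y).integrable hfin)
          (hw.slice _).pos ((hw.slice _).integrable hfin) (fun a b => ?_)
        have := hmid (vecCons a x) (vecCons b y)
        rwa [cons_add_cons, smul_cons] at this)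
    have key : ∀ f : (Fin (n + 1) → ℝ) → ℝ, BblNice f →
        ∫ y : Fin n → ℝ, ((∫ x, f (vecCons x y) ^ (-γ)) ^ (-(1 / (γ - 1)))) ^ (-(γ - 1)) =
        ∫ x, f x ^ (-γ) := by
      intro f hf
      have mp := (volume_preserving_piFinSuccAbove (fun _ : Fin (n + 1) => ℝ) 0).symm
      have e : ∀ z : ℝ × (Fin n → ℝ),
          (MeasurableEquiv.piFinSuccAbove (fun _ : Fin (n + 1) => ℝ) 0).symm z =
            vecCons z.1 z.2 := by
        intro z
        simp [MeasurableEquiv.piFinSuccAbove, Fin.insertNthEquiv, vecCons]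
      have hI := (mp.integrable_comp_emb (MeasurableEquiv.measurableEmbedding _)).2
        (hf.integrable hfin')
      rw [← mp.integral_comp (MeasurableEquiv.measurableEmbedding _)]
      simp only [Function.comp_def, e] at hI ⊢
      rw [Measure.volume_eq_prod] at hI ⊢
      rw [integral_prod_symm _ hI]
      congr 1
      funext y
      rw [← rpow_mul (integral_nonneg fun x => (rpow_pos_of_pos (hf.pos _) _).le)]
      convert rpow_one _ using 2
      have : γ - 1 ≠ 0 := by linarith
      field_simp
    rw [key f hf, key g hg, key w hw] at this
    have e : γ - 1 - (n : ℝ) = γ - ((n + 1 : ℕ) : ℝ) := by push_cast; ring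
    rwa [e] at this

lemma bbl_euclid (n : ℕ) (γ : ℝ) (hγ : (n : ℝ) < γ) (f g w : EuclideanSpace ℝ (Fin n) → ℝ)
    (hf : BblNice f) (hg : BblNice g) (hw : BblNice w)
    (hmid : ∀ x y, w ((1 / 2 : ℝ) • (x + y)) ≤ (f x + g y) / 2) :
    (∫ x, w x ^ (-γ)) ^ (-(1 / (γ - n))) ≤
      ((∫ x, f x ^ (-γ)) ^ (-(1 / (γ - n))) + (∫ x, g x ^ (-γ)) ^ (-(1 / (γ - n)))) / 2 := by
  have key : ∀ f : EuclideanSpace ℝ (Fin n) → ℝ, ∫ x, f x ^ (-γ) =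
      ∫ x : Fin n → ℝ, f (WithLp.toLp 2 x) ^ (-γ) := by
    intro f
    exact ((PiLp.volume_preserving_toLp (Fin n)).integral_comp
      (MeasurableEquiv.toLp 2 (Fin n → ℝ)).measurableEmbedding (fun x => f x ^ (-γ))).symm
  have nice : ∀ f : EuclideanSpace ℝ (Fin n) → ℝ, BblNice f →
      BblNice (fun x : Fin n → ℝ => f (WithLp.toLp 2 x)) := by
    intro f hf
    obtain ⟨hc, c, hc0, hb⟩ := hf
    refine ⟨by fun_prop, c, hc0, fun x => le_trans ?_ (hb _)⟩
    have : ‖x‖ ≤ ‖WithLp.toLp 2 x‖ := by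
      rw [pi_norm_le_iff_of_nonneg (norm_nonneg _)]
      intro i
      exact PiLp.norm_apply_le (WithLp.toLp 2 x) i
    gcongr
  rw [key f, key g, key w]
  exact bbl_pi n γ hγ _ _ _ (nice f hf) (nice g hg) (nice w hw) (fun x y => hmid _ _)

lemma bbl_deriv {E : Type*} [TopologicalSpace E] [MeasurableSpace E] [BorelSpace E]
    (μ : Measure E) (V G h : E → ℝ) (hV : Continuous V) (hG : Continuous G) (hh : Continuous h)
    (hVpos : ∀ x, 0 < V x) (M : ℝ) (hM : 0 < M) (hGM : ∀ x, |G x| ≤ M * V x) (p : ℝ) (hp : 0 < p)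
    (hIntg : Integrable (fun x => h x * V x ^ (-p)) μ) (s : ℝ) (hs : |s| < 1 / (2 * M)) :
    HasDerivAt (fun s => ∫ x, h x * (V x + s * G x) ^ (-p) ∂μ)
      (∫ x, (-p * (h x * G x)) * (V x + s * G x) ^ (-(p + 1)) ∂μ) s := by
  have hlow : ∀ r : ℝ, |r| < 1 / (2 * M) → ∀ x, V x / 2 ≤ V x + r * G x := by
    intro r hr x
    have h1 : |r * G x| ≤ 1 / (2 * M) * (M * V x) := by
      rw [abs_mul]
      have := hGM x
      gcongr
    have h2 : 1 / (2 * M) * (M * V x) = V x / 2 := by field_simp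
    rw [h2] at h1
    have := neg_le_of_abs_le h1
    linarith
  have hVm := hV.measurable
  have hGm := hG.measurable
  have hhm := hh.measurable
  set S : Set ℝ := {r | |r| < 1 / (2 * M)} with hS
  have hSo : IsOpen S := isOpen_lt (by fun_prop) (by fun_prop)
  have hSn : S ∈ 𝓝 s := hSo.mem_nhds hs
  refine (hasDerivAt_integral_of_dominated_loc_of_deriv_le (s := S)
    (F := fun r x => h x * (V x + r * G x) ^ (-p))
    (F' := fun r x => (-p * (h x * G x)) * (V x + r * G x) ^ (-(p + 1)))
    (bound := fun x => p * M * 2 ^ (p + 1) * ‖h x * V x ^ (-p)‖)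
    hSn ?_ ?_ ?_ ?_ ?_ ?_).2
  · refine Eventually.of_forall fun r => Measurable.aestronglyMeasurable ?_
    fun_prop
  · refine (hIntg.norm.const_mul (2 ^ p)).mono' (Measurable.aestronglyMeasurable (by fun_prop))
      (Eventually.of_forall fun x => ?_)
    have hx := hlow s hs x
    have hv := hVpos x
    rw [norm_mul, norm_mul, norm_of_nonneg (rpow_nonneg (by linarith) _),
      norm_of_nonneg (rpow_nonneg hv.le _)]
    have h1 : (V x + s * G x) ^ (-p) ≤ (V x / 2) ^ (-p) :=
      rpow_le_rpow_of_nonpos (by positivity) hx (by linarith)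
    have h2 : (V x / 2) ^ (-p) = 2 ^ p * V x ^ (-p) := by
      rw [div_rpow hv.le (by norm_num), rpow_neg (x := 2) (by norm_num)]
      field_simp
    calc _ ≤ ‖h x‖ * (2 ^ p * V x ^ (-p)) := by rw [← h2]; gcongr
      _ = _ := by ring
  · exact Measurable.aestronglyMeasurable (by fun_prop)
  · refine Eventually.of_forall fun x r hr => ?_
    have hx := hlow r hr x
    have hv := hVpos x
    have h1 : (V x + r * G x) ^ (-(p + 1)) ≤ (V x / 2) ^ (-(p + 1)) :=
      rpow_le_rpow_of_nonpos (by positivity) hx (by linarith)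
    have h2 : (V x / 2) ^ (-(p + 1)) * V x = 2 ^ (p + 1) * V x ^ (-p) := by
      rw [div_rpow hv.le (by norm_num), rpow_neg (x := 2) (by norm_num),
        show -p = -(p + 1) + 1 by ring, rpow_add hv, rpow_one]
      field_simp
    rw [norm_mul, norm_mul, norm_mul, norm_mul, norm_of_nonneg (rpow_nonneg (by linarith) _),
      norm_of_nonneg (rpow_nonneg hv.le _), norm_neg, norm_of_nonneg hp.le]
    have h3 : ‖G x‖ ≤ M * V x := hGM x
    calc _ ≤ p * (‖h x‖ * (M * V x)) * (V x / 2) ^ (-(p + 1)) := by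
          gcongr
          exact rpow_nonneg (by linarith) _
      _ = p * ‖h x‖ * M * ((V x / 2) ^ (-(p + 1)) * V x) := by ring
      _ = _ := by rw [h2]; ring
  · exact hIntg.norm.const_mul _
  · refine Eventually.of_forall fun x r hr => ?_
    have hx := hlow r hr x
    have hv := hVpos x
    have h0 : HasDerivAt (fun r => V x + r * G x) (G x) r := by
      simpa using ((hasDerivAt_id r).mul_const (G x)).const_add (V x)
    have h1 := (h0.rpow_const (p := -p) (Or.inl (by linarith))).const_mul (h x)
    refine h1.congr_deriv ?_
    rw [show -p - 1 = -(p + 1) by ring]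
    ring

lemma bbl_second_aux (F F1 k : ℝ → ℝ) (F2 m : ℝ)
    (hF : ∀ᶠ s in 𝓝 0, HasDerivAt F (F1 s) s) (hF1 : HasDerivAt F1 F2 0)
    (hk : HasDerivAt k m 0) (hk0 : k 0 = F 0)
    (hle : ∀ᶠ t in 𝓝[>] 0, 2 * k (t ^ 2) ≤ F t + F (-t)) : 2 * m ≤ F2 := by
  have hneg : Tendsto (fun t : ℝ => -t) (𝓝 0) (𝓝 0) := by
    simpa using (continuous_neg (G := ℝ)).tendsto 0
  have l1 : Tendsto (fun t => (F t + F (-t) - 2 * F 0) / t ^ 2) (𝓝[>] 0) (𝓝 F2) := by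
    refine HasDerivAt.lhopital_zero_nhdsGT (f' := fun t => F1 t - F1 (-t))
      (g' := fun t => 2 * t) ?_ ?_ ?_ ?_ ?_ ?_
    · refine (nhdsWithin_le_nhds : 𝓝[>] (0:ℝ) ≤ 𝓝 0) ?_
      filter_upwards [hF, hneg.eventually hF] with t h1 h2
      have h3 := h2.comp t (hasDerivAt_neg t)
      refine ((h1.add h3).sub_const (2 * F 0)).congr_deriv ?_
      ring
    · refine Eventually.of_forall fun t => ?_
      simpa using hasDerivAt_pow 2 t
    · filter_upwards [self_mem_nhdsWithin] with t ht
      have : (0:ℝ) < t := ht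
      positivity
    · have hc : ContinuousAt F 0 := hF.self_of_nhds.continuousAt
      have h1 : Tendsto (fun t => F t + F (-t) - 2 * F 0) (𝓝 0) (𝓝 (F 0 + F 0 - 2 * F 0)) :=
        (hc.tendsto.add (hc.tendsto.comp hneg)).sub_const _
      rw [show F 0 + F 0 - 2 * F 0 = 0 by ring] at h1
      exact h1.mono_left nhdsWithin_le_nhds
    · have : Tendsto (fun t : ℝ => t ^ 2) (𝓝 0) (𝓝 (0 ^ 2)) := (continuous_pow 2).tendsto 0
      rw [show (0:ℝ) ^ 2 = 0 by norm_num] at this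
      exact this.mono_left nhdsWithin_le_nhds
    · have h1 : HasDerivAt (fun t => F1 t - F1 (-t)) (2 * F2) 0 := by
        have h2 : HasDerivAt F1 F2 (-0) := by simpa using hF1
        have h3 := h2.comp (0:ℝ) (hasDerivAt_neg (0:ℝ))
        refine (hF1.sub h3).congr_deriv ?_
        ring
      have h4 := (hasDerivAt_iff_tendsto_slope.1 h1).mono_left
        (nhdsWithin_mono 0 (fun t (ht : t ∈ Ioi (0:ℝ)) => (ne_of_gt ht : t ≠ 0)))
      have h5 := h4.div_const 2
      rw [show 2 * F2 / 2 = F2 by ring] at h5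
      refine h5.congr' ?_
      filter_upwards [self_mem_nhdsWithin] with t ht
      have : (0:ℝ) < t := ht
      simp only [slope_def_field, neg_zero, sub_self, sub_zero]
      field_simp
  have l2 : Tendsto (fun t => 2 * ((k (t ^ 2) - k 0) / t ^ 2)) (𝓝[>] 0) (𝓝 (2 * m)) := by
    refine Tendsto.const_mul 2 ?_
    have h1 := hasDerivAt_iff_tendsto_slope.1 hk
    have h2 : Tendsto (fun t : ℝ => t ^ 2) (𝓝[>] 0) (𝓝[≠] 0) := by
      refine tendsto_nhdsWithin_iff.2 ⟨?_, ?_⟩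
      · have : Tendsto (fun t : ℝ => t ^ 2) (𝓝 0) (𝓝 (0 ^ 2)) := (continuous_pow 2).tendsto 0
        rw [show (0:ℝ) ^ 2 = 0 by norm_num] at this
        exact this.mono_left nhdsWithin_le_nhds
      · filter_upwards [self_mem_nhdsWithin] with t ht
        have : (0:ℝ) < t := ht
        exact (by positivity : t ^ 2 ≠ 0)
    refine (h1.comp h2).congr fun t => ?_
    simp [slope_def_field]
  refine le_of_tendsto_of_tendsto l2 l1 ?_
  filter_upwards [hle, self_mem_nhdsWithin] with t h1 ht
  have ht' : (0:ℝ) < t := ht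
  rw [← mul_div_assoc]
  gcongr
  rw [hk0]
  linarith

lemma bbl_second (I I1 K : ℝ → ℝ) (I2 K1 Z κ : ℝ) (hZ : 0 < Z) (hκ : 0 < κ)
    (hI0 : I 0 = Z) (hK0 : K 0 = Z)
    (hI : ∀ᶠ s in 𝓝 0, HasDerivAt I (I1 s) s) (hI1 : HasDerivAt I1 I2 0)
    (hK : HasDerivAt K K1 0)
    (hle : ∀ᶠ t in 𝓝[>] 0, K (t ^ 2) ^ (-κ) ≤ (I t ^ (-κ) + I (-t) ^ (-κ)) / 2) :
    I2 * Z ≤ (κ + 1) * I1 0 ^ 2 + 2 * K1 * Z := by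
  have hIc : ContinuousAt I 0 := hI.self_of_nhds.continuousAt
  have hpos : ∀ᶠ s in 𝓝 0, 0 < I s := hIc.eventually (lt_mem_nhds (by rw [hI0]; exact hZ))
  have h := bbl_second_aux (fun s => I s ^ (-κ)) (fun s => I1 s * (-κ) * I s ^ (-κ - 1))
    (fun s => K s ^ (-κ)) (I2 * (-κ) * I 0 ^ (-κ - 1) +
      I1 0 * (-κ) * (I1 0 * (-κ - 1) * I 0 ^ (-κ - 1 - 1)))
    (K1 * (-κ) * K 0 ^ (-κ - 1)) ?_ ?_ ?_ ?_ ?_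
  · rw [hI0, hK0] at h
    have e1 : Z ^ (-κ - 1) = Z ^ (-κ - 1 - 1) * Z := by
      conv_lhs => rw [show -κ - 1 = (-κ - 1 - 1) + 1 by ring, rpow_add hZ, rpow_one]
    rw [e1] at h
    have hw : 0 < κ * Z ^ (-κ - 1 - 1) := by positivity
    refine le_of_mul_le_mul_left ?_ hw
    linarith
  · filter_upwards [hI, hpos] with s h1 h2
    exact h1.rpow_const (Or.inl h2.ne')
  · have h1 := (hI.self_of_nhds.rpow_const (p := -κ - 1) (Or.inl (by rw [hI0]; exact hZ.ne')))
    exact (hI1.mul_const (-κ)).mul h1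
  · exact hK.rpow_const (Or.inl (by rw [hK0]; exact hZ.ne'))
  · simp only [hI0, hK0]
  · filter_upwards [hle] with t ht
    linarith

lemma bbl_hess {d : ℕ} (V : EuclideanSpace ℝ (Fin d) → ℝ) (α : ℝ)
    (x : EuclideanSpace ℝ (Fin d))
    (hstrong : (hessianMatrix V x - α • 1).PosSemidef) (h : EuclideanSpace ℝ (Fin d)) :
    α * ‖h‖ ^ 2 ≤ fderiv ℝ (fderiv ℝ V) x h h := by
  have h0 := hstrong.dotProduct_mulVec_nonneg (fun i => h i)
  rw [Matrix.sub_mulVec, dotProduct_sub, sub_nonneg, Matrix.smul_mulVec, Matrix.one_mulVec,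
    dotProduct_smul] at h0
  have e1 : star (fun i => h i) ⬝ᵥ (fun i => h i) = ‖h‖ ^ 2 := by
    rw [EuclideanSpace.norm_sq_eq]
    simp [dotProduct, sq]
  rw [e1, smul_eq_mul] at h0
  refine h0.trans (le_of_eq ?_)
  have e2 : h = ∑ i, h i • EuclideanSpace.single i (1:ℝ) := by
    ext j
    simp [Finset.sum_apply, Pi.single_apply]
  conv_rhs => rw [e2]
  simp only [map_sum, map_smul, _root_.sum_apply, _root_.smul_apply,
    smul_eq_mul, dotProduct, Matrix.mulVec, hessianMatrix, Matrix.of_apply,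
    iteratedFDeriv_two_apply, Finset.mul_sum]
  rw [Finset.sum_comm]
  refine Finset.sum_congr rfl fun i _ => Finset.sum_congr rfl fun j _ => ?_
  simp only [Pi.star_apply, star_trivial, Matrix.cons_val_zero, Matrix.cons_val_one]
  ring

lemma bbl_line {E : Type*} [NormedAddCommGroup E] [NormedSpace ℝ E] (V : E → ℝ)
    (hV : ContDiff ℝ 2 V) (α : ℝ)
    (hH : ∀ x h, α * ‖h‖ ^ 2 ≤ fderiv ℝ (fderiv ℝ V) x h h) (z h : E) :
    V z + α / 2 * ‖h‖ ^ 2 ≤ (V (z + h) + V (z - h)) / 2 ∧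
    V z + fderiv ℝ V z h + α / 2 * ‖h‖ ^ 2 ≤ V (z + h) := by
  have hl : ∀ s : ℝ, HasDerivAt (fun s : ℝ => z + s • h) h s := fun s => by
    simpa using ((hasDerivAt_id s).smul_const h).const_add z
  have hd : ∀ s : ℝ, HasDerivAt (fun s : ℝ => V (z + s • h) - α / 2 * ‖h‖ ^ 2 * s ^ 2)
      (fderiv ℝ V (z + s • h) h - α * ‖h‖ ^ 2 * s) s := by
    intro s
    have h1 : HasFDerivAt V (fderiv ℝ V (z + s • h)) (z + s • h) :=
      (hV.differentiable (by norm_num) _).hasFDerivAt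
    have h2 := h1.comp_hasDerivAt s (hl s)
    refine (h2.sub ((hasDerivAt_pow 2 s).const_mul (α / 2 * ‖h‖ ^ 2))).congr_deriv ?_
    simp
    ring
  have hd2 : ∀ s : ℝ, HasDerivAt (fun s : ℝ => fderiv ℝ V (z + s • h) h - α * ‖h‖ ^ 2 * s)
      (fderiv ℝ (fderiv ℝ V) (z + s • h) h h - α * ‖h‖ ^ 2) s := by
    intro s
    have h0 : ContDiff ℝ 1 (fderiv ℝ V) := hV.fderiv_right (by norm_num)
    have h1 : HasFDerivAt (fderiv ℝ V) (fderiv ℝ (fderiv ℝ V) (z + s • h)) (z + s • h) :=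
      (h0.differentiable (by norm_num) _).hasFDerivAt
    have h2 := h1.comp_hasDerivAt s (hl s)
    have h3 := h2.clm_apply (hasDerivAt_const s h)
    refine (h3.sub ((hasDerivAt_id s).const_mul (α * ‖h‖ ^ 2))).congr_deriv ?_
    simp
  have hconv : ConvexOn ℝ univ (fun s : ℝ => V (z + s • h) - α / 2 * ‖h‖ ^ 2 * s ^ 2) := by
    refine convexOn_of_hasDerivWithinAt2_nonneg convex_univ
      (continuous_iff_continuousAt.2 fun s => (hd s).continuousAt).continuousOn
      (fun s _ => (hd s).hasDerivWithinAt) (fun s _ => (hd2 s).hasDerivWithinAt)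
      (fun s _ => sub_nonneg.2 (hH _ _))
  constructor
  · have := hconv.2 (mem_univ (1:ℝ)) (mem_univ (-1:ℝ)) (show (0:ℝ) ≤ 1/2 by norm_num)
      (show (0:ℝ) ≤ 1/2 by norm_num) (by norm_num)
    simp only [smul_eq_mul] at this
    norm_num at this
    rw [← sub_eq_add_neg] at this
    linarith
  · have := hconv.le_slope_of_hasDerivAt (mem_univ 0) (mem_univ 1) one_pos (hd 0)
    simp [slope_def_field] at this
    linarith

lemma bbl_nice {d : ℕ} (V : EuclideanSpace ℝ (Fin d) → ℝ)
    (hV : ContDiff ℝ 2 V) (hVpos : ∀ x, 0 < V x) (α : ℝ) (hα : 0 < α)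
    (hH : ∀ x h, α * ‖h‖ ^ 2 ≤ fderiv ℝ (fderiv ℝ V) x h h) : BblNice V := by
  refine ⟨hV.continuous, ?_⟩
  set K := ‖fderiv ℝ V 0‖ with hK
  have hK0 : 0 ≤ K := norm_nonneg _
  set R := 1 + 2 * (K + 2) / α with hR
  have hR1 : 1 ≤ R := by
    have : 0 ≤ 2 * (K + 2) / α := by positivity
    linarith
  obtain ⟨x0, -, hx0⟩ := (isCompact_closedBall (0 : EuclideanSpace ℝ (Fin d)) R).exists_isMinOn
    ⟨0, by simp; linarith⟩ hV.continuous.continuousOn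
  have hm := hVpos x0
  refine ⟨min 1 (V x0 / (1 + R)), lt_min one_pos (by positivity), fun x => ?_⟩
  by_cases hx : ‖x‖ ≤ R
  · have h1 : V x0 ≤ V x := hx0 (by simpa using hx)
    calc _ ≤ V x0 / (1 + R) * (1 + R) := by
          gcongr
          exact min_le_right _ _
      _ = V x0 := by field_simp
      _ ≤ _ := h1
  · push Not at hx
    have h1 := (bbl_line V hV α hH 0 x).2
    rw [zero_add] at h1
    have h2 : -(K * ‖x‖) ≤ fderiv ℝ V 0 x := neg_le_of_abs_le ((fderiv ℝ V 0).le_opNorm x)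
    have h3 := hVpos 0
    have h4 : α / 2 * R * ‖x‖ ≤ α / 2 * ‖x‖ ^ 2 := by
      rw [sq, ← mul_assoc]
      gcongr
    have h5 : α / 2 * R = α / 2 + (K + 2) := by rw [hR]; field_simp
    rw [h5] at h4
    have h6 : min 1 (V x0 / (1 + R)) * (1 + ‖x‖) ≤ 1 * (1 + ‖x‖) := by
      gcongr
      exact min_le_left _ _
    have h7 : 0 ≤ α / 2 * ‖x‖ := by positivity
    nlinarith

lemma BblNice.of_le {E : Type*} [NormedAddCommGroup E] {f g : E → ℝ} (h : BblNice f)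
    (hg : Continuous g) {a : ℝ} (ha : 0 < a) (hle : ∀ x, a * f x ≤ g x) : BblNice g := by
  obtain ⟨-, c, hc, hb⟩ := h
  refine ⟨hg, a * c, by positivity, fun x => le_trans ?_ (hle x)⟩
  rw [mul_assoc]
  have := hb x
  gcongr

lemma bbl_growth {E : Type*} [NormedAddCommGroup E] [NormedSpace ℝ E] (V : E → ℝ)
    (hV : ContDiff ℝ 2 V) (hVpos : ∀ x, 0 < V x) (C : ℝ) (hC : 0 < C)
    (hb : ∀ x, ‖fderiv ℝ V x‖ ^ 2 ≤ C * V x) :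
    ∃ B : ℝ, 0 < B ∧ ∀ x, V x ≤ B * (1 + ‖x‖) ^ 2 := by
  have hd : ∀ x, HasFDerivAt (fun x => √(V x)) ((1 / (2 * √(V x))) • fderiv ℝ V x) x := fun x =>
    (hV.differentiable (by norm_num) x).hasFDerivAt.sqrt (hVpos x).ne'
  have hn : ∀ x, ‖(1 / (2 * √(V x))) • fderiv ℝ V x‖ ≤ √C := by
    intro x
    have hs : 0 < √(V x) := sqrt_pos.2 (hVpos x)
    rw [norm_smul, norm_of_nonneg (by positivity), div_mul_eq_mul_div, one_mul,
      div_le_iff₀ (by positivity)]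
    have h1 : ‖fderiv ℝ V x‖ ≤ √(C * V x) := le_sqrt_of_sq_le (hb x)
    rw [sqrt_mul hC.le] at h1
    have h2 : 0 ≤ √C * √(V x) := by positivity
    linarith
  set b := √(V 0) + √C with hbdef
  have hb0 : 0 < b := add_pos (sqrt_pos.2 (hVpos 0)) (sqrt_pos.2 hC)
  refine ⟨b ^ 2, by positivity, fun x => ?_⟩
  have h1 := convex_univ.norm_image_sub_le_of_norm_hasFDerivWithin_le
    (fun y _ => (hd y).hasFDerivWithinAt) (fun y _ => hn y) (mem_univ (0:E)) (mem_univ x)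
  rw [sub_zero] at h1
  have h2 := (le_abs_self _).trans h1
  have h3 : √(V x) ≤ b * (1 + ‖x‖) := by
    have := mul_nonneg (sqrt_nonneg (V 0)) (norm_nonneg x)
    have := sqrt_nonneg C
    rw [hbdef]
    nlinarith
  calc V x = √(V x) ^ 2 := (sq_sqrt (hVpos x).le).symm
    _ ≤ (b * (1 + ‖x‖)) ^ 2 := by gcongr
    _ = _ := by ring

lemma bbl_taylor {E : Type*} [NormedAddCommGroup E] [NormedSpace ℝ E] [FiniteDimensional ℝ E]
    (G : E → ℝ) (hG : ContDiff ℝ 2 G) (hGs : HasCompactSupport G) :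
    ∃ L : ℝ, 0 < L ∧ ∀ z h, 2 * fderiv ℝ G z h - L * ‖h‖ ^ 2 ≤ G (z + h) - G (z - h) := by
  have h0 : ContDiff ℝ 1 (fderiv ℝ G) := hG.fderiv_right (by norm_num)
  obtain ⟨C, hC⟩ := h0.lipschitzWith_of_hasCompactSupport (hGs.fderiv ℝ) (by norm_num)
  refine ⟨2 * C + 1, by positivity, fun z h => ?_⟩
  have key := (convex_closedBall z ‖h‖).norm_image_sub_le_of_norm_fderiv_le' (𝕜 := ℝ) (f := G)
    (φ := fderiv ℝ G z) (C := C * ‖h‖) (x := z - h) (y := z + h)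
    (fun x _ => hG.differentiable (by norm_num) x)
    (fun x hx => by
      have := hC.dist_le_mul x z
      rw [dist_eq_norm, dist_eq_norm] at this
      refine this.trans ?_
      have h2 : ‖x - z‖ ≤ ‖h‖ := by simpa [dist_eq_norm] using hx
      gcongr) (by simp) (by simp)
  have e : z + h - (z - h) = (2:ℝ) • h := by rw [two_smul]; abel
  rw [e, norm_smul, map_smul, smul_eq_mul] at key
  have := neg_le_of_abs_le key
  have h2 : ‖(2:ℝ)‖ = 2 := by norm_num
  rw [h2] at this
  nlinarith [sq_nonneg ‖h‖]

lemma bbl_three {E : Type*} [NormedAddCommGroup E] [NormedSpace ℝ E] (V G : E → ℝ)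
    (hV : ContDiff ℝ 2 V) (α : ℝ)
    (hH : ∀ x h, α * ‖h‖ ^ 2 ≤ fderiv ℝ (fderiv ℝ V) x h h) (L : ℝ)
    (hL : ∀ z h, 2 * fderiv ℝ G z h - L * ‖h‖ ^ 2 ≤ G (z + h) - G (z - h))
    (α' t : ℝ) (hα' : 0 < α') (ht : 0 < t) (htL : t * L ≤ α - α') (x y : E) :
    V ((1 / 2 : ℝ) • (x + y)) +
        t ^ 2 * (-(‖fderiv ℝ G ((1 / 2 : ℝ) • (x + y))‖ ^ 2 / (2 * α'))) ≤
      ((V x + t * G x) + (V y + -t * G y)) / 2 := by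
  set z := (1 / 2 : ℝ) • (x + y) with hz
  set h := (1 / 2 : ℝ) • (x - y) with hh
  have e1 : z + h = x := by rw [hz, hh]; module
  have e2 : z - h = y := by rw [hz, hh]; module
  have h1 := (bbl_line V hV α hH z h).1
  have h2 := hL z h
  rw [e1, e2] at h1 h2
  have h3 : -(‖fderiv ℝ G z‖ * ‖h‖) ≤ fderiv ℝ G z h :=
    neg_le_of_abs_le ((fderiv ℝ G z).le_opNorm h)
  set D := ‖fderiv ℝ G z‖
  set n := ‖h‖
  have h4 : t * (2 * -(D * n) - L * n ^ 2) ≤ t * (G x - G y) := by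
    exact mul_le_mul_of_nonneg_left (by linarith) ht.le
  have h5 : t * L * n ^ 2 ≤ (α - α') * n ^ 2 := by gcongr
  have h6 : 0 ≤ (α' * n - t * D) ^ 2 / (2 * α') := by positivity
  have h7 : (α' * n - t * D) ^ 2 / (2 * α') = α' / 2 * n ^ 2 - t * D * n
      + t ^ 2 * (D ^ 2 / (2 * α')) := by field_simp; ring
  rw [h7] at h6
  nlinarith

lemma bbl_bound {E : Type*} [TopologicalSpace E] (V H : E → ℝ) (hV : Continuous V)
    (hVpos : ∀ x, 0 < V x) (hH : Continuous H) (hs : HasCompactSupport H) :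
    ∃ M : ℝ, 0 < M ∧ ∀ x, |H x| ≤ M * V x := by
  have hc : Continuous fun x => H x * (V x)⁻¹ := hH.mul (hV.inv₀ fun x => (hVpos x).ne')
  have hs' : HasCompactSupport fun x => H x * (V x)⁻¹ := hs.mul_right
  obtain ⟨C, hC⟩ := hs'.exists_bound_of_continuous hc
  refine ⟨max C 1, lt_max_of_lt_right one_pos, fun x => ?_⟩
  have h1 := (hC x).trans (le_max_left C 1)
  have hv := hVpos x
  rw [norm_mul, norm_inv, norm_of_nonneg hv.le, ← div_eq_mul_inv, div_le_iff₀ hv] at h1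
  exact h1

/-- Bobkov–Ledoux inequality, compactly supported case, before passing to the limit. -/
lemma bbl_compact_aux {d : ℕ} (β : ℝ) (hβ : (d : ℝ) < β)
    (V : EuclideanSpace ℝ (Fin d) → ℝ)
    (hV : ContDiff ℝ 2 V) (hVpos : ∀ x, 0 < V x) (α : ℝ) (hα : 0 < α)
    (hH : ∀ x h, α * ‖h‖ ^ 2 ≤ fderiv ℝ (fderiv ℝ V) x h h)
    (g : EuclideanSpace ℝ (Fin d) → ℝ) (hg : ContDiff ℝ 2 g) (hgs : HasCompactSupport g)
    (Z : ℝ) (hZ : Z = ∫ x, V x ^ (-β)) (hZ0 : 0 < Z) (α' : ℝ) (hα' : 0 < α') (hαα : α' < α) :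
    β * (β + 1) * (∫ x, g x ^ 2 * V x ^ (-β)) * Z ≤
      (1 / (β - d) + 1) * β ^ 2 * (∫ x, g x * V x ^ (-β)) ^ 2 +
      β / α' * (∫ x, ‖fderiv ℝ (fun y => g y * V y) x‖ ^ 2 * V x ^ (-(β + 1))) * Z := by
  have hd0 : (0:ℝ) ≤ d := by positivity
  have hβ0 : 0 < β := by linarith
  have hVn : BblNice V := bbl_nice V hV hVpos α hα hH
  have hVc := hV.continuous
  have hfin : (Module.finrank ℝ (EuclideanSpace ℝ (Fin d)) : ℝ) < β := by simpa using hβ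
  have hVi : Integrable fun x => V x ^ (-β) := hVn.integrable hfin
  set G := fun y => g y * V y with hGdef
  have hG : ContDiff ℝ 2 G := hg.mul hV
  have hGc := hG.continuous
  have hGs : HasCompactSupport G := hgs.mul_right
  obtain ⟨L, hL0, hL⟩ := bbl_taylor G hG hGs
  obtain ⟨M, hM0, hM⟩ := bbl_bound V G hVc hVpos hGc hGs
  set H := fun x => -(‖fderiv ℝ G x‖ ^ 2 / (2 * α')) with hHdef
  have hdc : Continuous (fderiv ℝ G) := hG.continuous_fderiv (by norm_num)
  have hHc : Continuous H := by fun_prop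
  have hHs : HasCompactSupport H := by
    have := (hGs.fderiv ℝ).comp_left (g := fun l => -(‖l‖ ^ 2 / (2 * α'))) (by simp)
    exact this
  obtain ⟨N, hN0, hN⟩ := bbl_bound V H hVc hVpos hHc hHs
  have hone : Integrable (fun x => (1:ℝ) * V x ^ (-β)) := by simpa using hVi
  have low : ∀ (A : EuclideanSpace ℝ (Fin d) → ℝ) (m s : ℝ), 0 < m → (∀ x, |A x| ≤ m * V x) →
      |s| < 1 / (2 * m) → ∀ x, 1 / 2 * V x ≤ V x + s * A x := by
    intro A m s hm hA hs x
    have h1 : |s * A x| ≤ 1 / (2 * m) * (m * V x) := by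
      rw [abs_mul]
      have := hA x
      gcongr
    have h2 : 1 / (2 * m) * (m * V x) = V x / 2 := by field_simp
    rw [h2] at h1
    have := neg_le_of_abs_le h1
    linarith
  have nI : ∀ s : ℝ, |s| < 1 / (2 * M) → BblNice (fun x => V x + s * G x) := fun s hs =>
    hVn.of_le (by fun_prop) (show (0:ℝ) < 1 / 2 by norm_num) (low G M s hM0 hM hs)
  have nK : ∀ s : ℝ, |s| < 1 / (2 * N) → BblNice (fun x => V x + s * H x) := fun s hs =>
    hVn.of_le (by fun_prop) (show (0:ℝ) < 1 / 2 by norm_num) (low H N s hN0 hN hs)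
  have evM : ∀ᶠ s : ℝ in 𝓝 0, |s| < 1 / (2 * M) :=
    (continuous_abs.tendsto' (0:ℝ) 0 abs_zero).eventually (gt_mem_nhds (by positivity))
  have hGV : Integrable (fun x => (-β * (1 * G x)) * V x ^ (-(β + 1))) := by
    refine (hVi.const_mul (β * M)).mono' ?_ (Eventually.of_forall fun x => ?_)
    · exact Continuous.aestronglyMeasurable (by
        have := hVn.cont_rpow (-(β + 1))
        fun_prop)
    · have hv := hVpos x
      have h1 : ‖G x‖ ≤ M * V x := hM x
      have h2 : V x ^ (-β) = V x ^ (-(β + 1)) * V x := by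
        conv_lhs => rw [show -β = -(β + 1) + 1 by ring, rpow_add hv, rpow_one]
      rw [norm_mul, norm_mul, norm_neg, norm_of_nonneg hβ0.le, one_mul,
        norm_of_nonneg (rpow_nonneg hv.le _), h2]
      calc _ ≤ β * (M * V x) * V x ^ (-(β + 1)) := by gcongr
        _ = _ := by ring
  have main := bbl_second
    (fun s => ∫ x, 1 * (V x + s * G x) ^ (-β))
    (fun s => ∫ x, (-β * (1 * G x)) * (V x + s * G x) ^ (-(β + 1)))
    (fun s => ∫ x, 1 * (V x + s * H x) ^ (-β))
    (∫ x, (-(β + 1) * ((-β * (1 * G x)) * G x)) * (V x + 0 * G x) ^ (-(β + 1 + 1)))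
    (∫ x, (-β * (1 * H x)) * (V x + 0 * H x) ^ (-(β + 1)))
    Z (1 / (β - d)) hZ0 (by
      have : 0 < β - d := by linarith
      positivity) (by simp [hZ]) (by simp [hZ])
    (by
      filter_upwards [evM] with s hs
      exact bbl_deriv volume V G (fun _ => 1) hVc hGc continuous_const hVpos M hM0 hM β hβ0
        hone s hs)
    (bbl_deriv volume V G (fun x => -β * (1 * G x)) hVc hGc (by fun_prop) hVpos M hM0 hM
        (β + 1) (by linarith) hGV 0 (by rw [abs_zero]; positivity))
    (bbl_deriv volume V H (fun _ => 1) hVc hHc continuous_const hVpos N hN0 hN β hβ0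
        hone 0 (by rw [abs_zero]; positivity))
    (by
      have ev2 : ∀ᶠ t : ℝ in 𝓝 0, |t ^ 2| < 1 / (2 * N) := by
        have : Continuous fun t : ℝ => |t ^ 2| := by fun_prop
        exact (this.tendsto' (0:ℝ) 0 (by simp)).eventually (gt_mem_nhds (by positivity))
      have ev3 : ∀ᶠ t : ℝ in 𝓝 0, t * L < α - α' := by
        have : Continuous fun t : ℝ => t * L := by fun_prop
        exact (this.tendsto' (0:ℝ) 0 (by simp)).eventually (gt_mem_nhds (by linarith))
      filter_upwards [nhdsWithin_le_nhds evM, nhdsWithin_le_nhds ev2, nhdsWithin_le_nhds ev3,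
        self_mem_nhdsWithin] with t h1 h2 h3 h4
      simp only [one_mul]
      exact bbl_euclid d β hβ _ _ _ (nI t h1) (nI (-t) (by rwa [abs_neg])) (nK (t ^ 2) h2)
        (fun x y => bbl_three V G hV α hH L hL α' t hα' h4 h3.le x y))
  have e2 : (∫ x, (-(β + 1) * ((-β * (1 * G x)) * G x)) * (V x + 0 * G x) ^ (-(β + 1 + 1))) =
      β * (β + 1) * ∫ x, g x ^ 2 * V x ^ (-β) := by
    rw [← integral_const_mul]
    congr 1
    funext x
    have hv := hVpos x
    have h2 : V x ^ (-β) = V x ^ (-(β + 1 + 1)) * V x ^ 2 := by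
      conv_lhs => rw [show -β = -(β + 1 + 1) + (2:ℕ) by push_cast; ring, rpow_add hv, rpow_natCast]
    rw [h2, hGdef, zero_mul, add_zero]
    ring
  have e1 : (∫ x, (-β * (1 * G x)) * (V x + 0 * G x) ^ (-(β + 1))) =
      -β * ∫ x, g x * V x ^ (-β) := by
    rw [← integral_const_mul]
    congr 1
    funext x
    have hv := hVpos x
    have h2 : V x ^ (-β) = V x ^ (-(β + 1)) * V x := by
      conv_lhs => rw [show -β = -(β + 1) + 1 by ring, rpow_add hv, rpow_one]
    rw [h2, hGdef, zero_mul, add_zero]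
    ring
  have e3 : (∫ x, (-β * (1 * H x)) * (V x + 0 * H x) ^ (-(β + 1))) =
      β / (2 * α') * ∫ x, ‖fderiv ℝ G x‖ ^ 2 * V x ^ (-(β + 1)) := by
    rw [← integral_const_mul]
    congr 1
    funext x
    rw [hHdef, zero_mul, add_zero]
    ring
  rw [e1, e2, e3] at main
  refine main.trans (le_of_eq ?_)
  field_simp

lemma bbl_compact {d : ℕ} (β : ℝ) (hβ : (d : ℝ) < β)
    (V : EuclideanSpace ℝ (Fin d) → ℝ)
    (hV : ContDiff ℝ 2 V) (hVpos : ∀ x, 0 < V x) (α : ℝ) (hα : 0 < α)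
    (hH : ∀ x h, α * ‖h‖ ^ 2 ≤ fderiv ℝ (fderiv ℝ V) x h h)
    (g : EuclideanSpace ℝ (Fin d) → ℝ) (hg : ContDiff ℝ 2 g) (hgs : HasCompactSupport g)
    (Z : ℝ) (hZ : Z = ∫ x, V x ^ (-β)) (hZ0 : 0 < Z) :
    β * (β + 1) * (∫ x, g x ^ 2 * V x ^ (-β)) * Z ≤
      (1 / (β - d) + 1) * β ^ 2 * (∫ x, g x * V x ^ (-β)) ^ 2 +
      β / α * (∫ x, ‖fderiv ℝ (fun y => g y * V y) x‖ ^ 2 * V x ^ (-(β + 1))) * Z := by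
  set J := ∫ x, ‖fderiv ℝ (fun y => g y * V y) x‖ ^ 2 * V x ^ (-(β + 1))
  have ht : Tendsto (fun a : ℝ => (1 / (β - d) + 1) * β ^ 2 * (∫ x, g x * V x ^ (-β)) ^ 2 +
      β / a * J * Z) (𝓝[<] α) (𝓝 ((1 / (β - d) + 1) * β ^ 2 * (∫ x, g x * V x ^ (-β)) ^ 2 +
      β / α * J * Z)) := by
    have : ContinuousAt (fun a : ℝ => (1 / (β - d) + 1) * β ^ 2 * (∫ x, g x * V x ^ (-β)) ^ 2 +
      β / a * J * Z) α := by
      have := hα.ne'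
      fun_prop (disch := assumption)
    exact this.tendsto.mono_left nhdsWithin_le_nhds
  refine ge_of_tendsto ht ?_
  filter_upwards [self_mem_nhdsWithin, nhdsWithin_le_nhds (lt_mem_nhds hα)] with a ha ha0
  exact bbl_compact_aux β hβ V hV hVpos α hα hH g hg hgs Z hZ hZ0 a ha0 ha

lemma bbl_weights {s c a b : ℝ} (hc : 0 < c) (hs : c < s) :
    (a + b) ^ 2 ≤ s / (s - c) * a ^ 2 + s / c * b ^ 2 := by
  have h : 0 < s - c := sub_pos.2 hs
  have : s / (s - c) * a ^ 2 + s / c * b ^ 2 - (a + b) ^ 2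
      = (c * a - (s - c) * b) ^ 2 / (c * (s - c)) := by
    field_simp
    ring
  have h2 : 0 ≤ (c * a - (s - c) * b) ^ 2 / (c * (s - c)) := by positivity
  linarith

lemma bbl_compact_weighted {d : ℕ} (β : ℝ) (hβ : (d : ℝ) < β)
    (V : EuclideanSpace ℝ (Fin d) → ℝ)
    (hV : ContDiff ℝ 2 V) (hVpos : ∀ x, 0 < V x) (α : ℝ) (hα : 0 < α)
    (hH : ∀ x h, α * ‖h‖ ^ 2 ≤ fderiv ℝ (fderiv ℝ V) x h h)
    (CV : ℝ) (hCV0 : 0 < CV) (hCVβ : CV < β + 1)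
    (hCV : ∀ x, ‖fderiv ℝ V x‖ ^ 2 ≤ α * CV * V x)
    (Z : ℝ) (hZ : Z = ∫ x, V x ^ (-β)) (hZ0 : 0 < Z) :
    ∃ K : ℝ, ∀ g : EuclideanSpace ℝ (Fin d) → ℝ, ContDiff ℝ 2 g → HasCompactSupport g →
      (∫ x, g x ^ 2 * V x ^ (-β)) ≤ K * (∫ x, g x * V x ^ (-β)) ^ 2 +
        α⁻¹ * ((√(β + 1) - √CV)⁻¹) ^ 2 * ∫ x, V x * ‖fderiv ℝ g x‖ ^ 2 * V x ^ (-β) := by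
  have hd0 : (0:ℝ) ≤ d := by positivity
  have hβ0 : 0 < β := by linarith
  have hc : 0 < √CV := sqrt_pos.2 hCV0
  have hs : √CV < √(β + 1) := sqrt_lt_sqrt hCV0.le hCVβ
  have es : √(β + 1) ^ 2 = β + 1 := sq_sqrt (by linarith)
  have ec : √CV ^ 2 = CV := sq_sqrt hCV0.le
  generalize √(β + 1) = s at *
  generalize √CV = c at *
  have hsc : 0 < s - c := sub_pos.2 hs
  have hs0 : 0 < s := hc.trans hs
  refine ⟨(1 / (β - d) + 1) * β ^ 2 / (β * Z * s * (s - c)), fun g hg hgs => ?_⟩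
  have hmain := bbl_compact β hβ V hV hVpos α hα hH g hg hgs Z hZ hZ0
  have hVr : ∀ r : ℝ, Continuous fun x => V x ^ r := fun r =>
    hV.continuous.rpow_const fun x => Or.inl (hVpos x).ne'
  have hDg : Continuous (fderiv ℝ g) := hg.continuous_fderiv (by norm_num)
  have hDgs : HasCompactSupport (fderiv ℝ g) := hgs.fderiv (𝕜 := ℝ)
  have i1 : Integrable fun x => V x * ‖fderiv ℝ g x‖ ^ 2 * V x ^ (-β) := by
    refine Continuous.integrable_of_hasCompactSupport
      ((hV.continuous.mul (hDg.norm.pow 2)).mul (hVr _)) ?_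
    refine hDgs.mono ?_
    intro x hx hx2
    apply hx
    simp [hx2]
  have i2 : Integrable fun x => g x ^ 2 * V x ^ (-β) := by
    refine Continuous.integrable_of_hasCompactSupport
      ((hg.continuous.pow 2).mul (hVr _)) ?_
    refine hgs.mono ?_
    intro x hx hx2
    apply hx
    simp [hx2]
  have hgV : ContDiff ℝ 2 fun y => g y * V y := hg.mul hV
  have hgVs : HasCompactSupport fun y => g y * V y := hgs.mul_right
  have i3 : Integrable fun x => ‖fderiv ℝ (fun y => g y * V y) x‖ ^ 2 * V x ^ (-(β + 1)) := by
    refine Continuous.integrable_of_hasCompactSupport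
      (((hgV.continuous_fderiv (by norm_num)).norm.pow 2).mul (hVr _)) ?_
    refine (hgVs.fderiv (𝕜 := ℝ)).mono ?_
    intro x hx hx2
    apply hx
    simp [hx2]
  have hpt : ∀ x, ‖fderiv ℝ (fun y => g y * V y) x‖ ^ 2 * V x ^ (-(β + 1)) ≤
      s / (s - c) * (V x * ‖fderiv ℝ g x‖ ^ 2 * V x ^ (-β)) +
      s / c * α * CV * (g x ^ 2 * V x ^ (-β)) := by
    intro x
    have hv := hVpos x
    have e : fderiv ℝ (fun y => g y * V y) x = g x • fderiv ℝ V x + V x • fderiv ℝ g x :=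
      fderiv_fun_mul (hg.differentiable (by norm_num) x) (hV.differentiable (by norm_num) x)
    have e2 : V x ^ (-(β + 1)) = V x ^ (-β) / V x := by
      rw [neg_add, ← sub_eq_add_neg, rpow_sub hv, rpow_one]
    have n1 : ‖fderiv ℝ (fun y => g y * V y) x‖ ≤
        V x * ‖fderiv ℝ g x‖ + |g x| * ‖fderiv ℝ V x‖ := by
      rw [e, add_comm]
      refine (norm_add_le _ _).trans ?_
      rw [norm_smul, norm_smul, norm_of_nonneg hv.le, Real.norm_eq_abs]
    have n2 : ‖fderiv ℝ (fun y => g y * V y) x‖ ^ 2 ≤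
        s / (s - c) * (V x * ‖fderiv ℝ g x‖) ^ 2 + s / c * (|g x| * ‖fderiv ℝ V x‖) ^ 2 :=
      (pow_le_pow_left₀ (norm_nonneg _) n1 2).trans (bbl_weights hc hs)
    have n3 : (|g x| * ‖fderiv ℝ V x‖) ^ 2 ≤ g x ^ 2 * (α * CV * V x) := by
      rw [mul_pow, sq_abs]
      exact mul_le_mul_of_nonneg_left (hCV x) (sq_nonneg _)
    have n4 : ‖fderiv ℝ (fun y => g y * V y) x‖ ^ 2 ≤
        s / (s - c) * (V x * ‖fderiv ℝ g x‖) ^ 2 + s / c * (g x ^ 2 * (α * CV * V x)) :=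
      n2.trans (by gcongr)
    rw [e2]
    have hp : 0 < V x ^ (-β) := rpow_pos_of_pos hv _
    calc _ ≤ (s / (s - c) * (V x * ‖fderiv ℝ g x‖) ^ 2 + s / c * (g x ^ 2 * (α * CV * V x))) *
          (V x ^ (-β) / V x) := by gcongr
      _ = _ := by
          field_simp
  have hIntg := integral_mono i3 ((i1.const_mul (s / (s - c))).add
    (i2.const_mul (s / c * α * CV))) hpt
  simp only [Pi.add_apply] at hIntg
  rw [integral_add (i1.const_mul _) (i2.const_mul _), integral_const_mul,
    integral_const_mul] at hIntg
  generalize (∫ x, ‖fderiv ℝ (fun y => g y * V y) x‖ ^ 2 * V x ^ (-(β + 1))) = J at *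
  generalize (∫ x, V x * ‖fderiv ℝ g x‖ ^ 2 * V x ^ (-β)) = E at *
  generalize (∫ x, g x ^ 2 * V x ^ (-β)) = G at *
  generalize (∫ x, g x * V x ^ (-β)) = M at *
  generalize (1 / (β - d) + 1) * β ^ 2 = C0 at *
  have h3 : β / α * J * Z ≤ β / α * (s / (s - c) * E + s / c * α * CV * G) * Z := by gcongr
  have h4 := hmain.trans (add_le_add_right h3 _)
  rw [← es, ← ec] at h4
  have h5 : G * (β * Z * s * (s - c)) ≤ C0 * M ^ 2 + β / α * (s / (s - c) * E) * Z := by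
    have : β / α * (s / (s - c) * E + s / c * α * c ^ 2 * G) * Z =
      β / α * (s / (s - c) * E) * Z + β * s * c * G * Z := by field_simp
    rw [this] at h4
    nlinarith
  have hD : 0 < β * Z * s * (s - c) := by positivity
  rw [← le_div_iff₀ hD] at h5
  refine h5.trans (le_of_eq ?_)
  field_simp

lemma bbl_cutoff (d : ℕ) : ∃ χ : ℕ → EuclideanSpace ℝ (Fin d) → ℝ,
    (∀ n, ContDiff ℝ 2 (χ n)) ∧ (∀ n, HasCompactSupport (χ n)) ∧
    (∀ n x, |χ n x| ≤ 1) ∧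
    (∃ L : ℝ, ∀ n x, (1 + ‖x‖) * ‖fderiv ℝ (χ n) x‖ ≤ L) ∧
    (∀ x, ∀ᶠ n in atTop, χ n x = 1 ∧ fderiv ℝ (χ n) x = 0) := by
  let b : ContDiffBump (0 : EuclideanSpace ℝ (Fin d)) := ⟨1, 2, one_pos, one_lt_two⟩
  have hb : ContDiff ℝ 2 b := b.contDiff
  have hbs : HasCompactSupport b := b.hasCompactSupport
  have hder : ∀ (n : ℕ) x, fderiv ℝ (fun x => b (((n:ℝ) + 1)⁻¹ • x)) x =
      ((n:ℝ) + 1)⁻¹ • fderiv ℝ b (((n:ℝ) + 1)⁻¹ • x) := by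
    intro n x
    exact fderiv_comp_smul (f := b) ((n:ℝ) + 1)⁻¹ 
  refine ⟨fun n x => b (((n:ℝ) + 1)⁻¹ • x), fun n => ?_, fun n => ?_, fun n x => ?_, ?_, ?_⟩
  · exact hb.comp (contDiff_const_smul _)
  · exact hbs.comp_smul (by positivity)
  · rw [abs_of_nonneg b.nonneg]
    exact b.le_one
  · have hc : Continuous fun y => (1 + ‖y‖) * ‖fderiv ℝ b y‖ :=
      (continuous_const.add continuous_norm).mul (hb.continuous_fderiv (by norm_num)).norm
    have hcs : HasCompactSupport fun y => (1 + ‖y‖) * ‖fderiv ℝ b y‖ :=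
      (hbs.fderiv (𝕜 := ℝ)).norm.mul_left
    obtain ⟨L, hL⟩ := hcs.exists_bound_of_continuous hc
    refine ⟨L, fun n x => ?_⟩
    rw [hder]
    refine le_trans ?_ ((le_abs_self _).trans (hL (((n:ℝ) + 1)⁻¹ • x)))
    have hn : 0 < ((n:ℝ) + 1)⁻¹ := by positivity
    have hn1 : ((n:ℝ) + 1)⁻¹ ≤ 1 := inv_le_one_of_one_le₀ (by linarith [(Nat.cast_nonneg n : (0:ℝ) ≤ n)])
    rw [norm_smul, norm_smul, norm_of_nonneg hn.le, ← mul_assoc]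
    refine mul_le_mul_of_nonneg_right ?_ (norm_nonneg _)
    nlinarith
  · intro x
    have ht : ∀ᶠ n : ℕ in atTop, ‖x‖ < (n:ℝ) + 1 :=
      (tendsto_natCast_atTop_atTop.eventually_gt_atTop ‖x‖).mono fun n hn => by linarith
    filter_upwards [ht] with n hn
    have hn0 : 0 < (n:ℝ) + 1 := by positivity
    have hy : ‖((n:ℝ) + 1)⁻¹ • x‖ < 1 := by
      rw [norm_smul, norm_inv, norm_of_nonneg hn0.le, inv_mul_lt_iff₀ hn0]
      linarith
    have hball : ((n:ℝ) + 1)⁻¹ • x ∈ Metric.ball (0 : EuclideanSpace ℝ (Fin d)) b.rIn := by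
      rw [mem_ball_zero_iff]; exact hy
    have he : (b : EuclideanSpace ℝ (Fin d) → ℝ) =ᶠ[𝓝 (((n:ℝ) + 1)⁻¹ • x)] fun _ => 1 :=
      b.eventuallyEq_one_of_mem_ball hball
    refine ⟨he.eq_of_nhds, ?_⟩
    rw [hder, he.fderiv_eq]
    simp

lemma bbl_final {d : ℕ} (β : ℝ) 
    (V : EuclideanSpace ℝ (Fin d) → ℝ)
    (hV : ContDiff ℝ 2 V) (hVpos : ∀ x, 0 < V x)
    (C : ℝ) (hC0 : 0 < C) (hC : ∀ x, ‖fderiv ℝ V x‖ ^ 2 ≤ C * V x)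
    (K A : ℝ)
    (hK : ∀ g : EuclideanSpace ℝ (Fin d) → ℝ, ContDiff ℝ 2 g → HasCompactSupport g →
      (∫ x, g x ^ 2 * V x ^ (-β)) ≤ K * (∫ x, g x * V x ^ (-β)) ^ 2 +
        A * ∫ x, V x * ‖fderiv ℝ g x‖ ^ 2 * V x ^ (-β))
    (f : EuclideanSpace ℝ (Fin d) → ℝ) (hf : ContDiff ℝ 2 f)
    (i2 : Integrable fun x => f x ^ 2 * V x ^ (-β))
    (i1 : Integrable fun x => f x * V x ^ (-β))
    (i3 : Integrable fun x => V x * ‖fderiv ℝ f x‖ ^ 2 * V x ^ (-β)) :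
    (∫ x, f x ^ 2 * V x ^ (-β)) ≤ K * (∫ x, f x * V x ^ (-β)) ^ 2 +
        A * ∫ x, V x * ‖fderiv ℝ f x‖ ^ 2 * V x ^ (-β) := by
  obtain ⟨B, hB0, hB⟩ := bbl_growth V hV hVpos C hC0 hC
  obtain ⟨χ, hχ, hχs, hχ1, ⟨L, hL⟩, hχe⟩ := bbl_cutoff d
  have hVr : Continuous fun x => V x ^ (-β) :=
    hV.continuous.rpow_const fun x => Or.inl (hVpos x).ne'
  have hg : ∀ n, ContDiff ℝ 2 fun x => χ n x * f x := fun n => (hχ n).mul hf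
  have hp : ∀ x, 0 < V x ^ (-β) := fun x => rpow_pos_of_pos (hVpos x) _
  have hder : ∀ n x, fderiv ℝ (fun x => χ n x * f x) x =
      χ n x • fderiv ℝ f x + f x • fderiv ℝ (χ n) x := fun n x =>
    fderiv_fun_mul ((hχ n).differentiable (by norm_num) x) (hf.differentiable (by norm_num) x)
  have t2 : Tendsto (fun n => ∫ x, (χ n x * f x) ^ 2 * V x ^ (-β)) atTop
      (𝓝 (∫ x, f x ^ 2 * V x ^ (-β))) := by
    refine tendsto_integral_of_dominated_convergence (fun x => f x ^ 2 * V x ^ (-β))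
      (fun n => (((hg n).continuous.pow 2).mul hVr).aestronglyMeasurable) i2
      (fun n => ae_of_all _ fun x => ?_) (ae_of_all _ fun x => ?_)
    · rw [Real.norm_eq_abs, abs_of_nonneg (mul_nonneg (sq_nonneg _) (hp x).le), mul_pow]
      refine mul_le_mul_of_nonneg_right ?_ (hp x).le
      have : χ n x ^ 2 ≤ 1 := (sq_le_one_iff_abs_le_one _).2 (hχ1 n x)
      nlinarith [sq_nonneg (f x)]
    · refine tendsto_const_nhds.congr' ?_
      filter_upwards [hχe x] with n hn
      rw [hn.1, one_mul]
  have t1 : Tendsto (fun n => ∫ x, (χ n x * f x) * V x ^ (-β)) atTop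
      (𝓝 (∫ x, f x * V x ^ (-β))) := by
    refine tendsto_integral_of_dominated_convergence (fun x => ‖f x * V x ^ (-β)‖)
      (fun n => ((hg n).continuous.mul hVr).aestronglyMeasurable) i1.norm
      (fun n => ae_of_all _ fun x => ?_) (ae_of_all _ fun x => ?_)
    · rw [mul_assoc, norm_mul]
      exact mul_le_of_le_one_left (norm_nonneg _) (hχ1 n x)
    · refine tendsto_const_nhds.congr' ?_
      filter_upwards [hχe x] with n hn
      rw [hn.1, one_mul]
  have t3 : Tendsto (fun n => ∫ x, V x * ‖fderiv ℝ (fun x => χ n x * f x) x‖ ^ 2 * V x ^ (-β))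
      atTop (𝓝 (∫ x, V x * ‖fderiv ℝ f x‖ ^ 2 * V x ^ (-β))) := by
    refine tendsto_integral_of_dominated_convergence
      (fun x => 2 * (V x * ‖fderiv ℝ f x‖ ^ 2 * V x ^ (-β)) +
        2 * B * L ^ 2 * (f x ^ 2 * V x ^ (-β)))
      (fun n => ((hV.continuous.mul
        (((hg n).continuous_fderiv (by norm_num)).norm.pow 2)).mul hVr).aestronglyMeasurable)
      ((i3.const_mul 2).add (i2.const_mul _))
      (fun n => ae_of_all _ fun x => ?_) (ae_of_all _ fun x => ?_)
    · have hv := hVpos x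
      rw [Real.norm_eq_abs, abs_of_nonneg
        (mul_nonneg (mul_nonneg hv.le (sq_nonneg _)) (hp x).le), hder]
      have n1 : ‖χ n x • fderiv ℝ f x + f x • fderiv ℝ (χ n) x‖ ≤
          ‖fderiv ℝ f x‖ + |f x| * ‖fderiv ℝ (χ n) x‖ := by
        refine (norm_add_le _ _).trans ?_
        rw [norm_smul, norm_smul, Real.norm_eq_abs, Real.norm_eq_abs]
        exact add_le_add_left (mul_le_of_le_one_left (norm_nonneg _) (hχ1 n x)) _
      have n2 : ‖χ n x • fderiv ℝ f x + f x • fderiv ℝ (χ n) x‖ ^ 2 ≤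
          2 * ‖fderiv ℝ f x‖ ^ 2 + 2 * (f x ^ 2 * ‖fderiv ℝ (χ n) x‖ ^ 2) := by
        refine (pow_le_pow_left₀ (norm_nonneg _) n1 2).trans ?_
        rw [← sq_abs (f x)]
        nlinarith [sq_nonneg (‖fderiv ℝ f x‖ - |f x| * ‖fderiv ℝ (χ n) x‖)]
      have n3 : V x * ‖fderiv ℝ (χ n) x‖ ^ 2 ≤ B * L ^ 2 := by
        have h1 : ((1 + ‖x‖) * ‖fderiv ℝ (χ n) x‖) ^ 2 ≤ L ^ 2 :=
          pow_le_pow_left₀ (by positivity) (hL n x) 2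
        calc _ ≤ B * (1 + ‖x‖) ^ 2 * ‖fderiv ℝ (χ n) x‖ ^ 2 := by
              gcongr; exact hB x
          _ = B * ((1 + ‖x‖) * ‖fderiv ℝ (χ n) x‖) ^ 2 := by ring
          _ ≤ _ := by gcongr
      have n4 : V x * ‖χ n x • fderiv ℝ f x + f x • fderiv ℝ (χ n) x‖ ^ 2 ≤
          2 * (V x * ‖fderiv ℝ f x‖ ^ 2) + 2 * B * L ^ 2 * f x ^ 2 := by
        have := mul_le_mul_of_nonneg_left n2 hv.le
        have := mul_le_mul_of_nonneg_left n3 (sq_nonneg (f x))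
        nlinarith
      have := mul_le_mul_of_nonneg_right n4 (hp x).le
      linarith
    · refine tendsto_const_nhds.congr' ?_
      filter_upwards [hχe x] with n hn
      rw [hder, hn.1, hn.2, smul_zero, add_zero, one_smul]
  exact le_of_tendsto_of_tendsto' t2 (((t1.pow 2).const_mul K).add (t3.const_mul A))
    fun n => hK _ (hg n) (hχs n).mul_right

end Helpers

/-- Lemma: if `V` is `α`-strongly convex and `|∇V|² ≤ α C_V V` with `C_V ∈ (0, β+1)`,
then `Var_{π_β}(φ) ≤ α⁻¹ (√(β+1) − √C_V)⁻² ∫ V |∇φ|² dπ_β`. -/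
theorem weighted_poincare_strongly_convex
    (d : ℕ) (hd : 1 ≤ d) (β : ℝ) (hβ : (d : ℝ) < β)
    (V : EuclideanSpace ℝ (Fin d) → ℝ)
    (hV : ContDiff ℝ 2 V) (hVpos : ∀ x, 0 < V x)
    (α : ℝ) (hα : 0 < α)
    (hstrong : ∀ x, (hessianMatrix V x - α • 1).PosSemidef)
    (CV : ℝ) (hCV0 : 0 < CV) (hCVβ : CV < β + 1)
    (hCV : ∀ x, ‖gradient V x‖ ^ 2 ≤ α * CV * V x)
    (Zβ : ℝ) (hZβ : Zβ = ∫ x, V x ^ (-β))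
    (hZint : Integrable fun x : EuclideanSpace ℝ (Fin d) => V x ^ (-β))
    (πβ : EuclideanSpace ℝ (Fin d) → ℝ)
    (hπβ : ∀ x, πβ x = Zβ⁻¹ * V x ^ (-β))
    (φ : EuclideanSpace ℝ (Fin d) → ℝ) (hφ : ContDiff ℝ (⊤ : ℕ∞) φ)
    (hφ2 : Integrable fun x => φ x ^ 2 * πβ x)
    (hφ1 : Integrable fun x => φ x * πβ x)
    (hRHS : Integrable fun x => V x * ‖gradient φ x‖ ^ 2 * πβ x) :
    (∫ x, φ x ^ 2 * πβ x) - (∫ x, φ x * πβ x) ^ 2 ≤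
      α⁻¹ * ((Real.sqrt (β + 1) - Real.sqrt CV)⁻¹) ^ 2 *
        ∫ x, V x * ‖gradient φ x‖ ^ 2 * πβ x := by

  have hd0 : (0:ℝ) ≤ d := by positivity
  have hβ0 : 0 < β := by linarith
  have hgr : ∀ (f : EuclideanSpace ℝ (Fin d) → ℝ) x, ‖gradient f x‖ = ‖fderiv ℝ f x‖ :=
    fun f x => LinearIsometryEquiv.norm_map _ _
  simp only [hgr] at hCV hRHS ⊢
  have hp : ∀ x, 0 < V x ^ (-β) := fun x => rpow_pos_of_pos (hVpos x) _
  have hZ0 : 0 < Zβ := by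
    rw [hZβ, integral_pos_iff_support_of_nonneg (fun x => (hp x).le) hZint]
    have : Function.support (fun x => V x ^ (-β)) = Set.univ := by
      ext x; simpa using (hp x).ne'
    rw [this]
    exact Measure.measure_univ_pos.2 (NeZero.ne _)
  have hH : ∀ x h, α * ‖h‖ ^ 2 ≤ fderiv ℝ (fderiv ℝ V) x h h := fun x h =>
    bbl_hess V α x (hstrong x) h
  obtain ⟨K, hK⟩ := bbl_compact_weighted β hβ V hV hVpos α hα hH CV hCV0 hCVβ hCV Zβ hZβ hZ0
  have hconv : ∀ u : EuclideanSpace ℝ (Fin d) → ℝ, (fun x => u x * πβ x) =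
      fun x => Zβ⁻¹ * (u x * V x ^ (-β)) := by
    intro u; funext x; rw [hπβ]; ring
  have hunit : IsUnit Zβ⁻¹ := (inv_pos.2 hZ0).ne'.isUnit
  have j2 : Integrable fun x => φ x ^ 2 * V x ^ (-β) := by
    rw [hconv (fun x => φ x ^ 2)] at hφ2
    exact (integrable_const_mul_iff hunit _).1 hφ2
  have j1 : Integrable fun x => φ x * V x ^ (-β) := by
    rw [hconv φ] at hφ1
    exact (integrable_const_mul_iff hunit _).1 hφ1
  have j3 : Integrable fun x => V x * ‖fderiv ℝ φ x‖ ^ 2 * V x ^ (-β) := by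
    rw [hconv (fun x => V x * ‖fderiv ℝ φ x‖ ^ 2)] at hRHS
    exact (integrable_const_mul_iff hunit _).1 hRHS
  rw [hconv (fun x => φ x ^ 2), hconv φ, hconv (fun x => V x * ‖fderiv ℝ φ x‖ ^ 2),
    integral_const_mul, integral_const_mul, integral_const_mul]
  have hφ' : ContDiff ℝ 2 φ := contDiff_infty.1 hφ 2
  obtain ⟨m, hm⟩ : ∃ m, m = Zβ⁻¹ * ∫ x, φ x * V x ^ (-β) := ⟨_, rfl⟩
  have e1 : (fun x => (φ x - m) * V x ^ (-β)) =
      fun x => φ x * V x ^ (-β) - m * V x ^ (-β) := by funext x; ring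
  have e2 : (fun x => (φ x - m) ^ 2 * V x ^ (-β)) =
      fun x => φ x ^ 2 * V x ^ (-β) - (2 * m * (φ x * V x ^ (-β)) - m ^ 2 * V x ^ (-β)) := by
    funext x; ring
  have k0 : Integrable fun x => 2 * m * (φ x * V x ^ (-β)) - m ^ 2 * V x ^ (-β) :=
    (j1.const_mul _).sub (hZint.const_mul _)
  have k1 : Integrable fun x => (φ x - m) * V x ^ (-β) := by
    rw [e1]; exact j1.sub (hZint.const_mul m)
  have k2 : Integrable fun x => (φ x - m) ^ 2 * V x ^ (-β) := by
    rw [e2]; exact j2.sub ((j1.const_mul _).sub (hZint.const_mul _))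
  have hfin := bbl_final β V hV hVpos (α * CV) (by positivity) hCV K _ hK (fun x => φ x - m)
    (hφ'.sub contDiff_const) k2 k1 (by simpa only [fderiv_sub_const] using j3)
  simp only [fderiv_sub_const] at hfin
  rw [e1, e2, integral_sub j1 (hZint.const_mul m),
    integral_sub j2 k0,
    integral_sub (j1.const_mul _) (hZint.const_mul _), integral_const_mul, integral_const_mul,
    integral_const_mul, ← hZβ] at hfin
  have hI : (∫ x, φ x * V x ^ (-β)) = Zβ * m := by rw [hm]; field_simp
  rw [hI] at hfin ⊢
  have h5 := mul_le_mul_of_nonneg_left hfin (inv_pos.2 hZ0).le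
  refine le_trans (le_of_eq ?_) (h5.trans (le_of_eq ?_))
  · field_simp
    ring
  · ring
end
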